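/- Let A, B ∈ ℤ be such that the cubic polynomial f(x) = x³ + Ax + B is irreducible over ℚ, and let N be a positive squarefree integer. Let M be the set of prime numbers ℓ such that: ℓ does not divide 2N(4A³ + 27B²); ℓ ≡ 1 (mod 4); the Legendre symbol (-N | ℓ) equals 1; and f has no root modulo ℓ. Then M has a natural density δ, and δ ≥ 1/12. -/

import Mathlib

open Filter

/-- The number of primes `ℓ ∈ S` with `ℓ ≤ X`. -/
noncomputable def primeCount (S : Set ℕ) (X : ℝ) : ℕ :=
  Nat.card {p : ℕ | p.Prime ∧ p ∈ S ∧ (p : ℝ) ≤ X}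

/-- The prime counting function `π(X)`. -/
noncomputable def primePi (X : ℝ) : ℕ :=
  Nat.card {p : ℕ | p.Prime ∧ (p : ℝ) ≤ X}

/-- A set `S` of primes has natural density `δ` if `S(X)/π(X) → δ` as `X → ∞`. -/
def HasPrimeDensity (S : Set ℕ) (δ : ℝ) : Prop :=
  Tendsto (fun X : ℝ => (primeCount S X : ℝ) / (primePi X : ℝ)) atTop (nhds δ)

section
open MeasureTheory Filter Topology Complex

theorem tb_fubini (f : ℝ → ℝ) (hf : Measurable f) (M : ℝ) (hM : ∀ t, |f t| ≤ M)
    (h0 : ∀ t < 0, f t = 0) (φ : ℝ → ℂ) (hφ : Continuous φ) (hφc : HasCompactSupport φ)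
    (y ε : ℝ) (hε : 0 < ε) :
    ∫ t : ℝ, (f t : ℂ) * Real.exp (-ε * t) * (∫ ξ : ℝ, φ ξ * cexp (I * ξ * (y - t)))
      = ∫ ξ : ℝ, φ ξ * cexp (I * ξ * y) * ∫ t : ℝ, (f t : ℂ) * cexp (-(ε + I * ξ) * t) := by
  have hφi : Integrable φ := hφ.integrable_of_hasCompactSupport hφc
  have hfi : Integrable (fun t : ℝ => (f t : ℂ) * Real.exp (-ε * t)) := by
    have h1 : IntegrableOn (fun t : ℝ => Real.exp (-ε * t)) (Set.Ici 0) := by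
      rw [integrableOn_Ici_iff_integrableOn_Ioi]
      exact exp_neg_integrableOn_Ioi 0 hε
    have h2 := (integrable_indicator_iff measurableSet_Ici).2 h1
    refine Integrable.mono' (h2.const_mul M) ?_ ?_
    · apply Measurable.aestronglyMeasurable
      fun_prop
    · filter_upwards with t
      by_cases ht : 0 ≤ t
      · simp only [norm_mul, norm_real, Real.norm_eq_abs, ofReal_exp, norm_exp]
        rw [Set.indicator_of_mem (by exact ht)]
        simp only [ofReal_re]
        gcongr
        exact hM t
      · push Not at ht
        rw [h0 t ht, Set.indicator_of_notMem (by simpa using ht)]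
        simp
  have hprod := hfi.mul_prod hφi
  have hprod2 : Integrable (fun p : ℝ × ℝ => cexp (I * p.2 * (y - p.1)) *
      (((f p.1 : ℂ) * Real.exp (-ε * p.1)) * φ p.2)) (volume.prod volume) := by
    refine hprod.bdd_mul (c := 1) ?_ ?_
    · apply Continuous.aestronglyMeasurable
      fun_prop
    · filter_upwards with p
      have : I * (p.2 : ℂ) * (y - p.1) = ((p.2 * (y - p.1) : ℝ) : ℂ) * I := by push_cast; ring
      rw [this, norm_exp_ofReal_mul_I]
  have := integral_integral_swap (μ := volume) (ν := volume)
    (f := fun t ξ : ℝ => cexp (I * ξ * (y - t)) * (((f t : ℂ) * Real.exp (-ε * t)) * φ ξ)) hprod2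
  calc _ = ∫ t : ℝ, ∫ ξ : ℝ, cexp (I * ξ * (y - t)) * (((f t : ℂ) * Real.exp (-ε * t)) * φ ξ) := by
        congr 1; ext t
        rw [← integral_const_mul]
        congr 1; ext ξ; ring
    _ = _ := this
    _ = _ := by
        congr 1; ext ξ
        rw [← integral_const_mul]
        congr 1; ext t
        have e1 : cexp (I * ξ * (y - t)) = cexp (I * ξ * y) * cexp (- (I * ξ * t)) := by
          rw [← Complex.exp_add]; ring_nf
        have e2 : cexp (-(ε + I * ξ) * t) = (Real.exp (-ε * t) : ℂ) * cexp (- (I * ξ * t)) := by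
          push_cast
          rw [← Complex.exp_add]; ring_nf
        rw [e1, e2]; ring

theorem tb_fourier (f : ℝ → ℝ) (hf : Measurable f) (M : ℝ) (hM : ∀ t, |f t| ≤ M)
    (h0 : ∀ t < 0, f t = 0)
    (hg : ∀ τ : ℝ, ∃ l : ℂ, Tendsto (fun z : ℂ => ∫ t : ℝ, (f t : ℂ) * cexp (-z * t))
      (𝓝[{z | 0 < z.re}] (I * τ)) (𝓝 l))
    (φ : ℝ → ℂ) (hφ : Continuous φ) (hφc : HasCompactSupport φ)
    (hk : Integrable (fun v : ℝ => ∫ ξ : ℝ, φ ξ * cexp (I * ξ * v))) :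
    Tendsto (fun y : ℝ => ∫ t : ℝ, (f t : ℂ) * (∫ ξ : ℝ, φ ξ * cexp (I * ξ * (y - t))))
      atTop (𝓝 0) := by
  set k : ℝ → ℂ := fun v => ∫ ξ : ℝ, φ ξ * cexp (I * ξ * v) with hkdef
  set g : ℂ → ℂ := fun z => ∫ t : ℝ, (f t : ℂ) * cexp (-z * t) with hgdef
  set A : Set ℂ := {z | 0 < z.re} with hA
  have hAo : IsOpen A := isOpen_lt continuous_const continuous_re
  -- continuity of g on A
  have hgc : ∀ z ∈ A, ContinuousAt g z := by
    intro z hz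
    have hz' : 0 < z.re := hz
    refine continuousAt_of_dominated (bound := (Set.Ici 0).indicator
      (fun t => M * Real.exp (-(z.re / 2) * t))) ?_ ?_ ?_ ?_
    · filter_upwards with w
      apply Measurable.aestronglyMeasurable
      fun_prop
    · have : {w : ℂ | z.re / 2 < w.re} ∈ 𝓝 z :=
        (isOpen_lt continuous_const continuous_re).mem_nhds (by simp; linarith)
      filter_upwards [this] with w hw
      filter_upwards with t
      by_cases ht : 0 ≤ t
      · rw [Set.indicator_of_mem (by exact ht)]
        simp only [norm_mul, norm_real, Real.norm_eq_abs, norm_exp, neg_mul, neg_re, mul_re,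
          ofReal_re, ofReal_im, mul_zero, sub_zero]
        gcongr
        · exact le_trans (abs_nonneg _) (hM 0)
        · exact hM t
      · push Not at ht
        rw [h0 t ht, Set.indicator_of_notMem (by simpa using ht)]
        simp
    · rw [integrable_indicator_iff measurableSet_Ici, integrableOn_Ici_iff_integrableOn_Ioi]
      exact (exp_neg_integrableOn_Ioi 0 (by linarith)).const_mul M
    · filter_upwards with t
      fun_prop
  have hext : ContinuousOn (extendFrom A g) {z | 0 ≤ z.re} := by
    apply continuousOn_extendFrom
    · intro z hz
      rw [hA, Complex.closure_setOfPred_lt_re]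
      exact hz
    · intro z hz
      rcases (lt_or_eq_of_le (show (0:ℝ) ≤ z.re from hz)) with h | h
      · exact ⟨g z, ((hgc z h).tendsto).mono_left nhdsWithin_le_nhds⟩
      · have : z = I * z.im := by
          apply Complex.ext <;> simp [← h]
        rw [this]
        exact hg z.im
  set G := extendFrom A g with hG
  have hGg : ∀ z ∈ A, G z = g z := fun z hz =>
    extendFrom_eq (subset_closure hz) (((hgc z hz).tendsto).mono_left nhdsWithin_le_nhds)
  have hGc : ∀ ε : ℝ, 0 ≤ ε → Continuous (fun ξ : ℝ => G (ε + I * ξ)) := by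
    intro ε hε
    apply hext.comp_continuous (by fun_prop)
    intro ξ; simp [hε]
  -- main identity at ε = 0
  have hmain : ∀ y : ℝ, ∫ t : ℝ, (f t : ℂ) * k (y - t)
      = ∫ ξ : ℝ, φ ξ * cexp (I * ξ * y) * G (I * ξ) := by
    intro y
    have hL : Tendsto (fun ε : ℝ => ∫ t : ℝ, (f t : ℂ) * Real.exp (-ε * t) * k (y - t)) (𝓝[>] 0)
        (𝓝 (∫ t : ℝ, (f t : ℂ) * k (y - t))) := by
      refine tendsto_integral_filter_of_dominated_convergence (fun t => M * ‖k (y - t)‖) ?_ ?_ ?_ ?_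
      · filter_upwards with ε
        refine AEStronglyMeasurable.mul ?_ ?_
        · apply Measurable.aestronglyMeasurable
          fun_prop
        · exact (hk.comp_sub_left y).aestronglyMeasurable
      · filter_upwards [self_mem_nhdsWithin] with ε hε
        filter_upwards with t
        rw [norm_mul]
        gcongr
        by_cases ht : 0 ≤ t
        · simp only [norm_mul, norm_real, Real.norm_eq_abs, Real.abs_exp]
          have : Real.exp (-ε * t) ≤ 1 := by
            rw [Real.exp_le_one_iff]; have := mul_nonneg (le_of_lt hε) ht; linarith
          calc |f t| * Real.exp (-ε * t) ≤ |f t| * 1 := by gcongr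
            _ ≤ M := by rw [mul_one]; exact hM t
        · push Not at ht
          rw [h0 t ht]; simp; exact le_trans (abs_nonneg _) (hM 0)
      · exact ((hk.comp_sub_left y).norm).const_mul M
      · filter_upwards with t
        have : Tendsto (fun ε : ℝ => (f t : ℂ) * Real.exp (-ε * t) * k (y - t)) (𝓝 0)
          (𝓝 ((f t : ℂ) * Real.exp (-0 * t) * k (y - t))) := by
          apply Continuous.tendsto
          fun_prop
        simp at this
        simpa using this.mono_left nhdsWithin_le_nhds
    have hR : Tendsto (fun ε : ℝ => ∫ ξ : ℝ, φ ξ * cexp (I * ξ * y) * G (ε + I * ξ)) (𝓝[>] 0)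
        (𝓝 (∫ ξ : ℝ, φ ξ * cexp (I * ξ * y) * G (I * ξ))) := by
      obtain ⟨R, hR⟩ := hφc.isCompact.isBounded.subset_closedBall 0
      have hcomp : IsCompact ((fun p : ℝ × ℝ => (p.1 + I * p.2 : ℂ)) '' (Set.Icc 0 1 ×ˢ Metric.closedBall 0 R)) := by
        apply IsCompact.image
        · exact isCompact_Icc.prod (isCompact_closedBall 0 R)
        · fun_prop
      obtain ⟨B, hB⟩ := hcomp.exists_bound_of_continuousOn (hext.mono (by
        rintro _ ⟨p, hp, rfl⟩
        simpa using hp.1.1))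
      refine tendsto_integral_filter_of_dominated_convergence (fun ξ => ‖φ ξ‖ * B) ?_ ?_ ?_ ?_
      · filter_upwards [self_mem_nhdsWithin] with ε hε
        apply Continuous.aestronglyMeasurable
        have h5 : Continuous fun ξ : ℝ => φ ξ * cexp (I * ξ * y) := by fun_prop
        exact h5.mul (hGc ε (le_of_lt hε))
      · have : Set.Ioc (0:ℝ) 1 ∈ 𝓝[>] (0:ℝ) := Ioc_mem_nhdsGT one_pos
        filter_upwards [this] with ε hε
        filter_upwards with ξ
        have e : I * (ξ : ℂ) * y = ((ξ * y : ℝ) : ℂ) * I := by push_cast; ring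
        rw [norm_mul, norm_mul, e, norm_exp_ofReal_mul_I, mul_one]
        by_cases hξ : φ ξ = 0
        · simp [hξ]
        · gcongr
          apply hB
          refine ⟨(ε, ξ), ⟨⟨hε.1.le, hε.2⟩, hR (subset_closure hξ)⟩, rfl⟩
      · exact (hφ.integrable_of_hasCompactSupport hφc).norm.mul_const B
      · filter_upwards with ξ
        refine Tendsto.const_mul _ ?_
        have h1 : Tendsto G (𝓝[{z | 0 ≤ z.re}] (I * ξ)) (𝓝 (G (I * ξ))) := hext _ (by simp)
        refine h1.comp ?_
        refine tendsto_nhdsWithin_iff.2 ⟨?_, ?_⟩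
        · have : Tendsto (fun ε : ℝ => (ε + I * ξ : ℂ)) (𝓝 0) (𝓝 ((0:ℝ) + I * ξ)) := by
            apply Continuous.tendsto; fun_prop
          simp only [ofReal_zero, zero_add] at this
          exact this.mono_left nhdsWithin_le_nhds
        · filter_upwards [self_mem_nhdsWithin] with ε hε
          simpa using le_of_lt hε
    refine tendsto_nhds_unique hL (hR.congr' ?_)
    filter_upwards [self_mem_nhdsWithin] with ε hε
    have := tb_fubini f hf M hM h0 φ hφ hφc y ε hε
    rw [hkdef]
    simp only [ofReal_sub]
    rw [this]
    congr 1; ext ξ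
    rw [hGg _ (by simpa [hA] using hε)]
  have hRL := Real.tendsto_integral_exp_smul_cocompact (fun ξ : ℝ => φ ξ * G (I * ξ))
  have hy : Tendsto (fun y : ℝ => -y / (2 * Real.pi)) atTop (cocompact ℝ) := by
    refine Tendsto.mono_right ?_ atBot_le_cocompact
    exact (tendsto_neg_atTop_atBot).atBot_div_const (by positivity)
  refine (hRL.comp hy).congr ?_
  intro y
  simp only [Function.comp]
  have := hmain y
  rw [hkdef] at this
  simp only [ofReal_sub] at this
  rw [this]
  congr 1; ext ξ
  rw [Circle.smul_def, Real.fourierChar_apply, smul_eq_mul]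
  have : cexp (((2 * Real.pi * -(ξ * (-y / (2 * Real.pi))) : ℝ) : ℂ) * I) = cexp (I * ξ * y) := by
    congr 1
    have hpi : (2 * Real.pi * -(ξ * (-y / (2 * Real.pi))) : ℝ) = ξ * y := by
      have := Real.pi_pos
      field_simp
    rw [hpi]; push_cast; ring
  rw [this]; ring
end

section
open MeasureTheory Filter Topology Complex

noncomputable def tbK (l v : ℝ) : ℝ := 2 * (1 - Real.cos (l * v)) / (l * v ^ 2)

theorem tbK_nonneg {l : ℝ} (hl : 0 < l) (v : ℝ) : 0 ≤ tbK l v := by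
  unfold tbK
  have := Real.cos_le_one (l * v)
  apply div_nonneg
  · linarith
  · positivity

theorem tbK_integrable {l : ℝ} (hl : 0 < l) : Integrable (tbK l) := by
  refine Integrable.mono' (integrable_inv_one_add_sq.const_mul (l + 4 / l)) ?_ ?_
  · apply Measurable.aestronglyMeasurable
    unfold tbK
    fun_prop
  · filter_upwards with v
    rw [Real.norm_eq_abs, abs_of_nonneg (tbK_nonneg hl v)]
    rw [← div_eq_mul_inv, le_div_iff₀ (by positivity)]
    by_cases hv : v = 0
    · subst hv; unfold tbK; simp; positivity
    · have h1 : tbK l v ≤ l := by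
        unfold tbK
        rw [div_le_iff₀ (by positivity)]
        have := Real.one_sub_sq_div_two_le_cos (x := l * v)
        nlinarith
      have h2 : tbK l v * v ^ 2 ≤ 4 / l := by
        unfold tbK
        have := Real.neg_one_le_cos (l * v)
        have e : 2 * (1 - Real.cos (l * v)) / (l * v ^ 2) * v ^ 2 = 2 * (1 - Real.cos (l * v)) / l := by
          field_simp
        rw [e]
        gcongr
        linarith
      linarith

noncomputable def tbphi (l : ℝ) (ξ : ℝ) : ℝ := max 0 (1 - |ξ| / l)

theorem tbphi_cont {l : ℝ} : Continuous (tbphi l) := by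
  unfold tbphi; fun_prop

theorem tbphi_zero {l : ℝ} (hl : 0 < l) (ξ : ℝ) (h : l ≤ |ξ|) : tbphi l ξ = 0 := by
  unfold tbphi
  rw [max_eq_left]
  have : 1 ≤ |ξ| / l := by rwa [one_le_div hl]
  linarith

theorem tbphi_fourier {l : ℝ} (hl : 0 < l) (v : ℝ) (hv : v ≠ 0) :
    ∫ ξ : ℝ, (tbphi l ξ : ℂ) * cexp (I * ξ * v) = tbK l v := by
  have hvc : (v : ℂ) ≠ 0 := by exact_mod_cast hv
  have hlc : (l : ℂ) ≠ 0 := by exact_mod_cast hl.ne'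
  have hsupp : ∫ ξ : ℝ, (tbphi l ξ : ℂ) * cexp (I * ξ * v) =
      ∫ ξ in (-l)..l, (tbphi l ξ : ℂ) * cexp (I * ξ * v) := by
    rw [intervalIntegral.integral_of_le (by linarith)]
    symm
    apply setIntegral_eq_integral_of_forall_compl_eq_zero
    intro x hx
    rw [tbphi_zero hl]
    · simp
    · by_contra hlt
      push Not at hlt
      rw [abs_lt] at hlt
      exact hx ⟨hlt.1, hlt.2.le⟩
  have hint : ∀ a b, IntervalIntegrable (fun ξ : ℝ => (tbphi l ξ : ℂ) * cexp (I * ξ * v)) volume a b := by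
    intro a b
    apply Continuous.intervalIntegrable
    have := @tbphi_cont l
    fun_prop
  rw [hsupp, ← intervalIntegral.integral_add_adjacent_intervals (hint (-l) 0) (hint 0 l)]
  have key : ∀ s : ℂ, s ≠ 0 → ∀ x : ℝ, HasDerivAt (fun ξ : ℝ => (1 + s * ξ) * cexp (I * ξ * v) / (I * v) -
      s * (cexp (I * ξ * v) / (I * v) ^ 2)) ((1 + s * x) * cexp (I * x * v)) x := by
    intro s hs x
    have h1 : HasDerivAt (fun ξ : ℝ => cexp (I * ξ * v)) (cexp (I * x * v) * (I * 1 * v)) x := by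
      apply HasDerivAt.cexp
      exact ((hasDerivAt_id x).ofReal_comp.const_mul I).mul_const _
    have h2 : HasDerivAt (fun ξ : ℝ => (1 + s * (ξ : ℂ))) (s * 1) x :=
      ((hasDerivAt_id x).ofReal_comp.const_mul s).const_add 1
    have := ((h2.mul h1).div_const (I * v)).sub ((h1.div_const ((I * v) ^ 2)).const_mul s)
    convert! this using 1
    field_simp
    ring
  have e1 : ∫ ξ in (-l)..0, (tbphi l ξ : ℂ) * cexp (I * ξ * v) =
      ∫ ξ in (-l)..0, (1 + (1 / l : ℂ) * ξ) * cexp (I * ξ * v) := by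
    apply intervalIntegral.integral_congr
    intro x hx
    rw [Set.uIcc_of_le (by linarith)] at hx
    simp only
    congr 1
    unfold tbphi
    rw [abs_of_nonpos hx.2, max_eq_right]
    · push_cast; ring
    · have : -x / l ≤ 1 := by rw [div_le_one hl]; linarith [hx.1]
      linarith
  have e2 : ∫ ξ in (0:ℝ)..l, (tbphi l ξ : ℂ) * cexp (I * ξ * v) =
      ∫ ξ in (0:ℝ)..l, (1 + (-1 / l : ℂ) * ξ) * cexp (I * ξ * v) := by
    apply intervalIntegral.integral_congr
    intro x hx
    rw [Set.uIcc_of_le (by linarith)] at hx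
    simp only
    congr 1
    unfold tbphi
    rw [abs_of_nonneg hx.1, max_eq_right]
    · push_cast; ring
    · have : x / l ≤ 1 := by rw [div_le_one hl]; linarith [hx.2]
      linarith
  rw [e1, e2, intervalIntegral.integral_eq_sub_of_hasDerivAt (fun x _ => key _ (by simpa using hl.ne') x)
    (by apply Continuous.intervalIntegrable; fun_prop),
    intervalIntegral.integral_eq_sub_of_hasDerivAt (fun x _ => key _ (by simpa using hl.ne') x)
    (by apply Continuous.intervalIntegrable; fun_prop)]
  have hc : ((Real.cos (l * v) : ℝ) : ℂ) = (cexp (I * l * v) + cexp (I * (-l) * v)) / 2 := by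
    push_cast
    rw [Complex.cos]
    congr 2 <;> ring_nf
  unfold tbK
  rw [ofReal_div, ofReal_mul, ofReal_sub, hc]
  simp only [ofReal_zero, mul_zero, zero_mul, Complex.exp_zero, ofReal_neg, ofReal_mul, ofReal_pow, ofReal_one, ofReal_ofNat]
  field_simp
  rw [I_sq]
  ring

theorem tbK_scale {l : ℝ} (hl : 0 < l) (v : ℝ) : tbK l v = l * tbK 1 (l * v) := by
  unfold tbK
  by_cases hv : v = 0
  · simp [hv]
  · field_simp

theorem tbK_int {l : ℝ} (hl : 0 < l) : ∫ v, tbK l v = ∫ v, tbK 1 v := by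
  simp_rw [tbK_scale hl]
  rw [integral_const_mul, Measure.integral_comp_mul_left, abs_of_pos (by positivity), smul_eq_mul]
  field_simp

theorem tbK_int_pos : 0 < ∫ v, tbK 1 v := by
  have h : ∫ v in (1:ℝ)..2, tbK 1 v ≤ ∫ v, tbK 1 v := by
    rw [intervalIntegral.integral_of_le (by norm_num)]
    exact setIntegral_le_integral (tbK_integrable one_pos) (ae_of_all _ (tbK_nonneg one_pos))
  refine lt_of_lt_of_le ?_ h
  apply intervalIntegral.intervalIntegral_pos_of_pos_on
  · exact (tbK_integrable one_pos).intervalIntegrable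
  · intro x hx
    unfold tbK
    have : Real.cos (1 * x) < 1 := by
      rw [one_mul]
      have h2 := Real.pi_gt_three
      rw [← Real.cos_zero]
      exact Real.cos_lt_cos_of_nonneg_of_le_pi le_rfl (by linarith [hx.2]) (by linarith [hx.1])
    have hx1 : 0 < x := by linarith [hx.1]
    have h3 : 0 < 1 - Real.cos (1 * x) := by linarith
    positivity
  · norm_num

theorem tbK_conc {h η : ℝ} (hh : 0 < h) (hη : 0 < η) : ∃ l > 0,
    (1 - η) * (∫ v, tbK 1 v) ≤ ∫ v in (-h)..h, tbK l v := by
  have hI := tbK_int_pos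
  have := intervalIntegral_tendsto_integral (tbK_integrable one_pos) (l := atTop)
    (a := fun l : ℝ => -(l * h)) (b := fun l : ℝ => l * h)
    (tendsto_neg_atTop_atBot.comp (tendsto_id.atTop_mul_const hh)) (tendsto_id.atTop_mul_const hh)
  have h1 := (this.eventually (eventually_ge_nhds (show (1 - η) * (∫ v, tbK 1 v) < ∫ v, tbK 1 v by nlinarith)))
  obtain ⟨l, hl, hl0⟩ := (h1.and (eventually_gt_atTop 0)).exists
  refine ⟨l, hl0, hl.trans (le_of_eq ?_)⟩
  simp_rw [tbK_scale hl0]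
  rw [intervalIntegral.integral_const_mul, intervalIntegral.integral_comp_mul_left _ hl0.ne', smul_eq_mul]
  rw [mul_neg]
  field_simp

theorem tb_final (B : ℝ → ℝ) (hB : Measurable B) (C : ℝ) (h0 : ∀ t, 0 ≤ B t) (hC : ∀ t, B t ≤ C)
    (hneg : ∀ t < 0, B t = 0)
    (hmono : ∀ t t', t ≤ t' → B t * Real.exp t ≤ B t' * Real.exp t')
    (hlim : ∀ l > 0, Tendsto (fun y : ℝ => ∫ t : ℝ, (Set.Ici 0).indicator (fun t => B t - 1) t * tbK l (y - t))
      atTop (𝓝 0)) : Tendsto B atTop (𝓝 1) := by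
  set J := ∫ v, tbK 1 v with hJ
  have hJ0 : 0 < J := tbK_int_pos
  have hC0 : 0 ≤ C := (h0 0).trans (hC 0)
  have hint : ∀ l > 0, ∀ y, Integrable (fun v => B (y - v) * tbK l v) := by
    intro l hl y
    refine (tbK_integrable hl).bdd_mul (c := C) ?_ ?_
    · exact (hB.comp (measurable_const.sub measurable_id)).aestronglyMeasurable
    · filter_upwards with v
      rw [Real.norm_eq_abs, abs_of_nonneg (h0 _)]; exact hC _
  have hlim2 : ∀ l > 0, Tendsto (fun y : ℝ => ∫ v : ℝ, B (y - v) * tbK l v) atTop (𝓝 J) := by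
    intro l hl
    have h2 : Tendsto (fun y : ℝ => ∫ v in Set.Iic y, tbK l v) atTop (𝓝 J) := by
      have := (tbK_int hl) ▸ (aecover_Iic tendsto_id (μ := volume) (l := atTop)).integral_tendsto_of_countably_generated
        (tbK_integrable hl)
      exact this
    have := (hlim l hl).add h2
    rw [zero_add] at this
    refine this.congr fun y => ?_
    rw [← integral_sub_left_eq_self _ volume y, ← integral_indicator measurableSet_Iic, ← integral_add]
    · congr 1; ext v
      by_cases hv : v ≤ y
      · rw [Set.indicator_of_mem (by simpa using hv), Set.indicator_of_mem (by simpa using hv)]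
        simp only [sub_sub_cancel]; ring
      · push Not at hv
        rw [Set.indicator_of_notMem (by simpa using hv), Set.indicator_of_notMem (by simpa using hv),
          hneg _ (by linarith)]
        ring
    · simp only [sub_sub_cancel]
      refine (tbK_integrable hl).bdd_mul (c := C + 1) ?_ ?_
      · exact (((hB.sub_const 1).indicator measurableSet_Ici).comp (measurable_const.sub measurable_id)).aestronglyMeasurable
      · filter_upwards with v
        refine (norm_indicator_le_norm_self _ _).trans ?_
        rw [Real.norm_eq_abs, abs_le]
        constructor <;> linarith [h0 (y - v), hC (y - v)]
    · exact (tbK_integrable hl).indicator measurableSet_Iic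
  have hup : ∀ η, 0 < η → η < 1 → ∀ᶠ y in atTop, B y ≤ Real.exp (2 * η) * ((1 + η) / (1 - η)) := by
    intro η hη hη1
    obtain ⟨l, hl, hc⟩ := tbK_conc hη hη
    have h1 := ((hlim2 l hl).comp (tendsto_atTop_add_const_right atTop η tendsto_id)).eventually
      (eventually_le_nhds (show J < (1 + η) * J by nlinarith))
    filter_upwards [h1] with y hy
    simp only [Function.comp, id] at hy
    have h3 : ∫ v in (-η)..η, B y * Real.exp (-(2 * η)) * tbK l v ≤ ∫ v : ℝ, B (y + η - v) * tbK l v := by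
      rw [intervalIntegral.integral_of_le (by linarith)]
      refine le_trans ?_ (setIntegral_le_integral (s := Set.Ioc (-η) η) (hint l hl _)
        (ae_of_all _ fun v => mul_nonneg (h0 _) (tbK_nonneg hl v)))
      refine setIntegral_mono_on ((tbK_integrable hl).const_mul _).integrableOn (hint l hl _).integrableOn
        measurableSet_Ioc ?_
      intro v hv
      refine mul_le_mul_of_nonneg_right ?_ (tbK_nonneg hl v)
      have h4 := hmono y (y + η - v) (by linarith [hv.2])
      have h5 : B y * Real.exp y * Real.exp (-(y + 2 * η)) ≤ B (y + η - v) * Real.exp (y + η - v) * Real.exp (-(y + 2 * η)) := by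
        gcongr
      rw [mul_assoc, mul_assoc, ← Real.exp_add, ← Real.exp_add] at h5
      have h6 : B (y + η - v) * Real.exp (y + η - v + -(y + 2 * η)) ≤ B (y + η - v) * 1 := by
        refine mul_le_mul_of_nonneg_left ?_ (h0 _)
        rw [Real.exp_le_one_iff]; linarith [hv.1]
      have h7 : y + -(y + 2 * η) = -(2 * η) := by ring
      rw [h7] at h5
      linarith
    rw [intervalIntegral.integral_const_mul] at h3
    have h8 : B y * Real.exp (-(2 * η)) * ((1 - η) * J) ≤ (1 + η) * J := by
      refine le_trans (mul_le_mul_of_nonneg_left hc (mul_nonneg (h0 _) (Real.exp_pos _).le)) (h3.trans hy)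
    have h9 : B y * Real.exp (-(2 * η)) * (1 - η) ≤ 1 + η := by
      rw [← mul_assoc] at h8
      exact le_of_mul_le_mul_right h8 hJ0
    rw [Real.exp_neg] at h9
    rw [← mul_div_assoc, le_div_iff₀ (by linarith)]
    have h10 := Real.exp_pos (2 * η)
    calc B y * (1 - η) = Real.exp (2 * η) * (B y * (Real.exp (2 * η))⁻¹ * (1 - η)) := by
          field_simp
      _ ≤ _ := by gcongr
  have hlo : ∀ η, 0 < η → η < 1 → ∀ᶠ y in atTop, Real.exp (-(2 * η)) * (1 - η - C * η) ≤ B y := by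
    intro η hη hη1
    obtain ⟨l, hl, hc⟩ := tbK_conc hη hη
    have h1 := ((hlim2 l hl).comp (tendsto_atTop_add_const_right atTop (-η) tendsto_id)).eventually
      (eventually_ge_nhds (show (1 - η) * J < J by nlinarith))
    filter_upwards [h1] with y hy
    simp only [Function.comp, id] at hy
    have hsplit : ∫ v : ℝ, B (y + -η - v) * tbK l v ≤ ∫ v : ℝ, (C * tbK l v +
        (Set.Ioc (-η) η).indicator (fun v => (B y * Real.exp (2 * η) - C) * tbK l v) v) := by
      refine integral_mono (hint l hl _) (((tbK_integrable hl).const_mul _).add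
        (((tbK_integrable hl).const_mul _).indicator measurableSet_Ioc)) ?_
      intro v
      simp only
      by_cases hv : v ∈ Set.Ioc (-η) η
      · rw [Set.indicator_of_mem hv]
        have : B (y + -η - v) ≤ B y * Real.exp (2 * η) := by
          have h4 := hmono (y + -η - v) y (by linarith [hv.1])
          have h5 : B (y + -η - v) * Real.exp (y + -η - v) * Real.exp (-(y - 2 * η)) ≤ B y * Real.exp y * Real.exp (-(y - 2 * η)) := by
            gcongr
          rw [mul_assoc, mul_assoc, ← Real.exp_add, ← Real.exp_add] at h5
          have h6 : B (y + -η - v) * 1 ≤ B (y + -η - v) * Real.exp (y + -η - v + -(y - 2 * η)) := by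
            refine mul_le_mul_of_nonneg_left ?_ (h0 _)
            rw [Real.one_le_exp_iff]; linarith [hv.2]
          have h7 : y + -(y - 2 * η) = (2 * η) := by ring
          rw [h7] at h5
          linarith
        nlinarith [tbK_nonneg hl v]
      · rw [Set.indicator_of_notMem hv, add_zero]
        exact mul_le_mul_of_nonneg_right (hC _) (tbK_nonneg hl v)
    rw [integral_add ((tbK_integrable hl).const_mul _)
        (((tbK_integrable hl).const_mul _).indicator measurableSet_Ioc), integral_indicator measurableSet_Ioc,
        integral_const_mul, integral_const_mul, tbK_int hl, ← hJ,
        ← intervalIntegral.integral_of_le (by linarith)] at hsplit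
    have hle : ∫ v in (-η)..η, tbK l v ≤ J := by
      rw [intervalIntegral.integral_of_le (by linarith), hJ, ← tbK_int hl]
      exact setIntegral_le_integral (tbK_integrable hl) (ae_of_all _ (tbK_nonneg hl))
    set Q := ∫ v in (-η)..η, tbK l v
    have hb : 0 ≤ B y * Real.exp (2 * η) := mul_nonneg (h0 _) (Real.exp_pos _).le
    have h8 : (1 - η) * J ≤ C * η * J + B y * Real.exp (2 * η) * J := by
      have a1 := mul_le_mul_of_nonneg_left hle hb
      have a2 := mul_le_mul_of_nonneg_left hc hC0
      nlinarith
    have h9 : (1 - η - C * η) ≤ B y * Real.exp (2 * η) := by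
      have : (1 - η - C * η) * J ≤ B y * Real.exp (2 * η) * J := by linarith
      exact le_of_mul_le_mul_right this hJ0
    rw [Real.exp_neg, inv_mul_le_iff₀ (Real.exp_pos _)]
    linarith
  have t1 : Tendsto (fun η : ℝ => Real.exp (2 * η) * ((1 + η) / (1 - η))) (𝓝[>] 0) (𝓝 1) := by
    have : ContinuousAt (fun η : ℝ => Real.exp (2 * η) * ((1 + η) / (1 - η))) 0 := by
      apply ContinuousAt.mul (by fun_prop)
      apply ContinuousAt.div (by fun_prop) (by fun_prop) (by norm_num)
    have h := this.tendsto
    simp at h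
    exact h.mono_left nhdsWithin_le_nhds
  have t2 : Tendsto (fun η : ℝ => Real.exp (-(2 * η)) * (1 - η - C * η)) (𝓝[>] 0) (𝓝 1) := by
    have : Continuous (fun η : ℝ => Real.exp (-(2 * η)) * (1 - η - C * η)) := by fun_prop
    have h := this.tendsto 0
    simp at h
    exact h.mono_left nhdsWithin_le_nhds
  have hsm : Set.Ioo (0:ℝ) 1 ∈ 𝓝[>] (0:ℝ) := Ioo_mem_nhdsGT one_pos
  rw [tendsto_order]
  constructor
  · intro a ha
    obtain ⟨η, h1, h2⟩ := ((t2.eventually (lt_mem_nhds ha)).and hsm).exists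
    filter_upwards [hlo η h2.1 h2.2] with y hy
    linarith
  · intro a ha
    obtain ⟨η, h1, h2⟩ := ((t1.eventually (gt_mem_nhds ha)).and hsm).exists
    filter_upwards [hup η h2.1 h2.2] with y hy
    linarith
end

section
open MeasureTheory Filter Topology Complex

theorem tauber (a : ℕ → ℝ) (ha : ∀ n, 0 ≤ a n) (C : ℝ)
    (hC : ∀ n : ℕ, ∑ k ∈ Finset.Icc 1 n, a k ≤ C * n)
    (hG : ∀ t : ℝ, ∃ l : ℂ, Tendsto (fun s => LSeries (fun n => (a n : ℂ)) s - 1 / (s - 1))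
      (𝓝[{s | 1 < s.re}] (1 + t * I)) (𝓝 l)) :
    Tendsto (fun x : ℝ => (∑ k ∈ Finset.Icc 1 ⌊x⌋₊, a k) / x) atTop (𝓝 1) := by
  set S : ℝ → ℝ := fun x => ∑ k ∈ Finset.Icc 1 ⌊x⌋₊, a k with hS
  have hSmono : Monotone S := by
    intro x y hxy
    apply Finset.sum_le_sum_of_subset_of_nonneg
    · exact Finset.Icc_subset_Icc le_rfl (Nat.floor_mono hxy)
    · intros; exact ha _
  have hS0 : ∀ x, 0 ≤ S x := fun x => Finset.sum_nonneg fun _ _ => ha _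
  have hC0 : 0 ≤ C := by simpa using (Finset.sum_nonneg fun _ _ => ha _).trans (hC 1)
  have hSC : ∀ x, 0 ≤ x → S x ≤ C * x := fun x hx =>
    (hC _).trans (mul_le_mul_of_nonneg_left (Nat.floor_le hx) hC0)
  set B : ℝ → ℝ := fun t => S (Real.exp t) * Real.exp (-t) with hB
  have hBm : Measurable B := by
    refine Measurable.mul (hSmono.measurable.comp Real.measurable_exp) (by fun_prop)
  have hB0 : ∀ t, 0 ≤ B t := fun t => mul_nonneg (hS0 _) (Real.exp_pos _).le
  have hBC : ∀ t, B t ≤ C := by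
    intro t
    calc B t ≤ (C * Real.exp t) * Real.exp (-t) :=
          mul_le_mul_of_nonneg_right (hSC _ (Real.exp_pos _).le) (Real.exp_pos _).le
      _ = C := by rw [mul_assoc, ← Real.exp_add]; simp
  have hBneg : ∀ t < 0, B t = 0 := by
    intro t ht
    have : ⌊Real.exp t⌋₊ = 0 := by
      rw [Nat.floor_eq_zero]; exact Real.exp_lt_one_iff.2 ht
    simp [hB, hS, this]
  have hBmono : ∀ t t', t ≤ t' → B t * Real.exp t ≤ B t' * Real.exp t' := by
    intro t t' h
    have h1 : ∀ t, B t * Real.exp t = S (Real.exp t) := fun t => by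
      simp only [hB]; rw [mul_assoc, ← Real.exp_add]; simp
    rw [h1, h1]
    exact hSmono (Real.exp_le_exp.2 h)
  set f : ℝ → ℝ := (Set.Ici 0).indicator (fun t => B t - 1) with hf
  have hfm : Measurable f := (hBm.sub measurable_const).indicator measurableSet_Ici
  have hfM : ∀ t, |f t| ≤ C + 1 := by
    intro t
    simp only [hf]
    by_cases ht : t ∈ Set.Ici (0:ℝ)
    · rw [Set.indicator_of_mem ht, abs_le]; constructor <;> linarith [hB0 t, hBC t]
    · rw [Set.indicator_of_notMem ht]; simp; linarith
  have hf0 : ∀ t < 0, f t = 0 := fun t ht => Set.indicator_of_notMem (by simpa using ht) _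
  have hlap : ∀ z : ℂ, 0 < z.re → ∫ t : ℝ, (f t : ℂ) * cexp (-z * t) =
      (LSeries (fun n => (a n : ℂ)) (1 + z) - 1 / z - 1) / (1 + z) := by
    intro z hz
    have hz1 : (1 + z) ≠ 0 := fun h => by
      have := congrArg Complex.re h; simp at this; linarith
    have hz0 : z ≠ 0 := fun h => by simp [h] at hz
    have hexp : IntegrableOn (fun t : ℝ => cexp (-z * t)) (Set.Ioi 0) :=
      integrableOn_exp_mul_complex_Ioi (by simpa using hz) 0
    have hBexp : IntegrableOn (fun t : ℝ => (B t : ℂ) * cexp (-z * t)) (Set.Ioi 0) := by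
      refine Integrable.bdd_mul (c := C) hexp ?_ ?_
      · exact (Complex.measurable_ofReal.comp hBm).aestronglyMeasurable
      · filter_upwards with t
        rw [Complex.norm_real, Real.norm_eq_abs, abs_of_nonneg (hB0 t)]; exact hBC t
    have h1 : ∫ t : ℝ, (f t : ℂ) * cexp (-z * t) = ∫ t in Set.Ioi (0:ℝ), ((B t : ℂ) * cexp (-z * t) - cexp (-z * t)) := by
      rw [← integral_Ici_eq_integral_Ioi, ← integral_indicator measurableSet_Ici]
      congr 1; ext t
      simp only [hf]
      by_cases ht : t ∈ Set.Ici (0:ℝ)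
      · rw [Set.indicator_of_mem ht, Set.indicator_of_mem ht]; push_cast; ring
      · rw [Set.indicator_of_notMem ht, Set.indicator_of_notMem ht]; simp
    have h2 : LSeries (fun n => (a n : ℂ)) (1 + z) = (1 + z) * ∫ t in Set.Ioi (0:ℝ), (B t : ℂ) * cexp (-z * t) := by
      rw [LSeries_eq_mul_integral_of_nonneg a zero_le_one (by simpa using hz) _ ha]
      · congr 1
        have himg : Real.exp '' Set.Ioi 0 = Set.Ioi 1 := by
          ext x; constructor
          · rintro ⟨y, hy, rfl⟩; exact Real.one_lt_exp_iff.2 hy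
          · intro hx
            exact ⟨Real.log x, Real.log_pos hx, Real.exp_log (zero_lt_one.trans hx)⟩
        rw [← himg, integral_image_eq_integral_abs_deriv_smul measurableSet_Ioi
          (fun x _ => (Real.hasDerivAt_exp x).hasDerivWithinAt) Real.exp_injective.injOn]
        apply setIntegral_congr_fun measurableSet_Ioi
        intro t _
        simp only [hB, hS]
        rw [abs_of_pos (Real.exp_pos _), Complex.real_smul, Complex.ofReal_exp, ← Complex.exp_log (Complex.exp_ne_zero (t:ℂ)),
          ← Complex.ofReal_exp, ← Complex.ofReal_log (Real.exp_pos _).le, Real.log_exp]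
        rw [Complex.cpow_def_of_ne_zero (Complex.exp_ne_zero _), ← Complex.ofReal_exp, ← Complex.ofReal_log (Real.exp_pos _).le, Real.log_exp]
        push_cast
        rw [mul_left_comm, ← Complex.exp_add, mul_assoc, ← Complex.exp_add]
        congr 2; ring
      · refine Asymptotics.IsBigO.of_bound C ?_
        filter_upwards with n
        rw [Real.norm_eq_abs, abs_of_nonneg (Finset.sum_nonneg fun _ _ => ha _)]
        simpa using hC n
    rw [h1, integral_sub hBexp hexp, h2, integral_exp_mul_complex_Ioi (by simpa using hz)]
    simp
    field_simp
    ring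
  have hlim : ∀ τ : ℝ, ∃ l : ℂ, Tendsto (fun z : ℂ => ∫ t : ℝ, (f t : ℂ) * cexp (-z * t)) (𝓝[{z | 0 < z.re}] (I * τ)) (𝓝 l) := by
    intro τ
    obtain ⟨l, hl⟩ := hG τ
    have h1 : Tendsto (fun z : ℂ => 1 + z) (𝓝[{z | 0 < z.re}] (I * τ)) (𝓝[{s | 1 < s.re}] (1 + τ * I)) := by
      apply tendsto_nhdsWithin_of_tendsto_nhds_of_eventually_within
      · refine Tendsto.mono_left ?_ nhdsWithin_le_nhds
        have : Continuous (fun z : ℂ => 1 + z) := by fun_prop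
        simpa [mul_comm] using this.tendsto (I * τ)
      · filter_upwards [self_mem_nhdsWithin] with z hz
        simpa using hz
    have h2 := ((hl.comp h1).sub_const 1).div (l := 𝓝[{z | 0 < z.re}] (I * τ)) (g := fun z => 1 + z)
      (h1.mono_right nhdsWithin_le_nhds) (fun h => by have := congrArg Complex.re h; simp at this)
    refine ⟨_, h2.congr' ?_⟩
    filter_upwards [self_mem_nhdsWithin] with z hz
    rw [hlap z hz]
    simp
  have hBlim : Tendsto B atTop (𝓝 1) := by
    refine tb_final B hBm C hB0 hBC hBneg hBmono fun l hl => ?_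
    have hφ : Continuous (fun ξ => (tbphi l ξ : ℂ)) := Complex.continuous_ofReal.comp tbphi_cont
    have hker : ∀ᵐ v : ℝ, (∫ ξ : ℝ, (tbphi l ξ : ℂ) * cexp (I * ξ * v)) = tbK l v := by
      have : ∀ᵐ v : ℝ, v ≠ 0 := by simp [ae_iff]
      filter_upwards [this] with v hv
      exact tbphi_fourier hl v hv
    have := tb_fourier f hfm (C + 1) hfM hf0 hlim (fun ξ => (tbphi l ξ : ℂ)) hφ ?_ ?_
    · have h2 := (Complex.continuous_re.tendsto _).comp this
      simp only [Complex.zero_re] at h2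
      refine h2.congr fun y => ?_
      have h3 : (∫ t : ℝ, (f t : ℂ) * (∫ ξ : ℝ, (tbphi l ξ : ℂ) * cexp (I * ξ * (y - t)))) =
          ((∫ t : ℝ, f t * tbK l (y - t) : ℝ) : ℂ) := by
        rw [← integral_complex_ofReal]
        apply integral_congr_ae
        have h4 : ∀ᵐ t : ℝ, t ≠ y := by simp [ae_iff]
        filter_upwards [h4] with t ht
        have := tbphi_fourier hl (y - t) (sub_ne_zero.2 ht.symm)
        push_cast at this ⊢
        rw [this]
      simp only [Function.comp]
      rw [h3, Complex.ofReal_re]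
    · refine HasCompactSupport.of_support_subset_isCompact (isCompact_Icc (a := -l) (b := l)) ?_
      intro ξ hξ
      by_contra h
      apply hξ
      simp only [Set.mem_Icc, not_and_or, not_le] at h
      simp only
      rw [tbphi_zero hl ξ, Complex.ofReal_zero]
      rcases h with h | h
      · exact le_abs.2 (Or.inr (by linarith))
      · exact le_abs.2 (Or.inl (by linarith))
    · exact ((tbK_integrable hl).ofReal).congr (hker.mono fun _ h => h.symm)
  have := hBlim.comp Real.tendsto_log_atTop
  refine this.congr' ?_
  filter_upwards [eventually_gt_atTop 0] with x hx
  simp only [Function.comp, hB]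
  rw [Real.exp_log hx, Real.exp_neg, Real.exp_log hx, div_eq_mul_inv]
end

section
open NumberField NumberField.Units NumberField.Units.dirichletUnitTheorem NumberField.mixedEmbedding NumberField.InfinitePlace Module

noncomputable section
variable (K : Type*) [Field K] [NumberField K]

open Classical in
/-- coordinates w.r.t. the unit lattice -/
def zc : logSpace K ≃ₗ[ℝ] (Fin (rank K) → ℝ) := 
  ((basisUnitLattice K).ofZLatticeBasis ℝ (unitLattice K)).equivFun

/-- tent function -/
def ztent (y : ℝ) : ℝ := max 0 (1 - |y|)

variable {K}
open Classical in
/-- the weight -/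
def zwt (x : 𝓞 K) : ℝ := if x = 0 then 0 else ∏ i, ztent (zc K (logMap (mixedEmbedding K (x:K))) i)

/-- the norm -/
def zN (x : 𝓞 K) : ℝ := (Ideal.absNorm (Ideal.span {x}) : ℕ)

theorem ztent_nonneg (y : ℝ) : 0 ≤ ztent y := le_max_left _ _
theorem ztent_le_one (y : ℝ) : ztent y ≤ 1 := max_le zero_le_one (by linarith [abs_nonneg y])

theorem ztent_lip (y z : ℝ) : |ztent y - ztent z| ≤ |y - z| := by
  unfold ztent
  have h1 := abs_max_sub_max_le_max 0 (1 - |y|) 0 (1 - |z|)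
  refine h1.trans (max_le (by simp) ?_)
  have : 1 - |y| - (1 - |z|) = |z| - |y| := by ring
  rw [this, abs_sub_comm y z]
  exact abs_abs_sub_abs_le z y

theorem ztent_ne {y : ℝ} (h : ztent y ≠ 0) : |y| ≤ 1 := by
  by_contra h1
  apply h
  unfold ztent
  rw [max_eq_left]; linarith

theorem ztent_sum (y : ℝ) : ∑ e ∈ ({-⌊y⌋, -⌊y⌋ - 1} : Finset ℤ), ztent (y + e) = 1 := by
  rw [Finset.sum_pair (by omega)]
  have h1 := Int.fract_nonneg y
  have h2 := Int.fract_lt_one y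
  have e1 : y + ((-⌊y⌋ : ℤ) : ℝ) = Int.fract y := by unfold Int.fract; push_cast; ring
  have e2 : y + ((-⌊y⌋ - 1 : ℤ) : ℝ) = Int.fract y - 1 := by unfold Int.fract; push_cast; ring
  rw [e1, e2]; unfold ztent
  rw [abs_of_nonneg h1, abs_of_nonpos (by linarith), max_eq_right (by linarith), max_eq_right (by linarith)]
  ring

theorem ztent_out (y : ℝ) (e : ℤ) (he : e ∉ ({-⌊y⌋, -⌊y⌋ - 1} : Finset ℤ)) : ztent (y + e) = 0 := by
  have h1 := Int.fract_nonneg y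
  have h2 := Int.fract_lt_one y
  simp only [Finset.mem_insert, Finset.mem_singleton, not_or] at he
  unfold ztent
  rw [max_eq_left]
  have e1 : y + (e : ℝ) = Int.fract y + ((⌊y⌋ + e : ℤ) : ℝ) := by unfold Int.fract; push_cast; ring
  rw [e1]
  rcases lt_or_ge (⌊y⌋ + e) (-1) with h | h
  · have : ((⌊y⌋ + e : ℤ) : ℝ) ≤ -2 := by exact_mod_cast (show ⌊y⌋ + e ≤ -2 by omega)
    have := neg_abs_le (Int.fract y + ((⌊y⌋ + e : ℤ) : ℝ))
    linarith
  · have : (1:ℝ) ≤ ((⌊y⌋ + e : ℤ) : ℝ) := by exact_mod_cast (show 1 ≤ ⌊y⌋ + e by omega)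
    have := le_abs_self (Int.fract y + ((⌊y⌋ + e : ℤ) : ℝ))
    linarith

theorem zN_eq (x : 𝓞 K) : mixedEmbedding.norm (mixedEmbedding K (x:K)) = zN x := by
  rw [norm_eq_norm, zN, Ideal.absNorm_span_singleton, ← Algebra.coe_norm_int, Nat.cast_natAbs]
  push_cast; rfl

theorem zN_pos {x : 𝓞 K} (hx : x ≠ 0) : 1 ≤ zN x := by
  unfold zN
  have : Ideal.absNorm (Ideal.span {x}) ≠ 0 := by
    rw [Ne, Ideal.absNorm_eq_zero_iff]; simpa using hx
  exact_mod_cast Nat.one_le_iff_ne_zero.2 this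

theorem zwt_nonneg (x : 𝓞 K) : 0 ≤ zwt x := by
  unfold zwt; split_ifs
  · rfl
  · exact Finset.prod_nonneg fun _ _ => ztent_nonneg _

theorem zwt_le_one (x : 𝓞 K) : zwt x ≤ 1 := by
  unfold zwt; split_ifs
  · exact zero_le_one
  · exact Finset.prod_le_one (fun _ _ => ztent_nonneg _) fun _ _ => ztent_le_one _

theorem zwt_zero : zwt (0 : 𝓞 K) = 0 := if_pos rfl

open Classical in
theorem zc_unit (ζ : torsion K) (e : Fin (rank K) → ℤ) (i : Fin (rank K)) :
    zc K (logEmbedding K (Additive.ofMul ((ζ : (𝓞 K)ˣ) * ∏ i, (fundSystem K i) ^ (e i)))) i = e i := by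
  rw [ofMul_mul, map_add, logEmbedding_eq_zero_iff.2 ζ.2, zero_add, ofMul_prod, map_sum]
  have : ∀ j, logEmbedding K (Additive.ofMul (fundSystem K j ^ e j)) = 
    (e j : ℝ) • ((basisUnitLattice K).ofZLatticeBasis ℝ (unitLattice K)) j := by
    intro j
    rw [ofMul_zpow, map_zsmul, logEmbedding_fundSystem, Module.Basis.ofZLatticeBasis_apply]
    exact (Int.cast_smul_eq_zsmul ℝ _ _).symm
  simp_rw [this]
  unfold zc
  rw [map_sum, Finset.sum_apply, Finset.sum_eq_single i]
  · simp
  · intro j _ hj; simp [hj, Finsupp.single_apply]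
  · simp

theorem zwt_unit_mul {x : 𝓞 K} (hx : x ≠ 0) (ζ : torsion K) (e : Fin (rank K) → ℤ) :
    zwt ((((ζ : (𝓞 K)ˣ) * ∏ i, (fundSystem K i) ^ (e i) : (𝓞 K)ˣ) : 𝓞 K) * x) = 
     ∏ i, ztent (zc K (logMap (mixedEmbedding K (x:K))) i + e i) := by
  have hx0 : mixedEmbedding.norm (mixedEmbedding K (x:K)) ≠ 0 := by
    rw [zN_eq]; linarith [zN_pos hx]
  unfold zwt
  rw [if_neg (mul_ne_zero (Units.ne_zero _) hx)]
  have := logMap_unit_smul ((ζ : (𝓞 K)ˣ) * ∏ i, (fundSystem K i) ^ (e i)) hx0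
  rw [unitSMul_smul, ← map_mul, ← RingOfIntegers.coe_eq_algebraMap, ← map_mul] at this
  apply Finset.prod_congr rfl
  intro i _
  rw [this, map_add, Pi.add_apply, zc_unit, add_comm]

theorem zwt_units {x : 𝓞 K} (hx : x ≠ 0) : ∃ S : Finset (𝓞 K)ˣ, S.card ≤ torsionOrder K * 2 ^ (rank K) ∧
    (∀ u ∉ S, zwt ((u : 𝓞 K) * x) = 0) ∧ ∑ u ∈ S, zwt ((u : 𝓞 K) * x) = torsionOrder K := by
  classical
  haveI := Fintype.ofFinite (torsion K)
  set y := zc K (logMap (mixedEmbedding K (x:K))) with hy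
  set φ : torsion K × (Fin (rank K) → ℤ) → (𝓞 K)ˣ := fun p => (p.1 : (𝓞 K)ˣ) * ∏ i, (fundSystem K i) ^ (p.2 i) with hφ
  have hinj : Function.Injective φ := by
    intro p q h
    exact (exist_unique_eq_mul_prod K (φ p)).unique rfl h
  set T : Finset (torsion K × (Fin (rank K) → ℤ)) := Finset.univ ×ˢ Fintype.piFinset (fun i => ({-⌊y i⌋, -⌊y i⌋ - 1} : Finset ℤ))
  have hc : Fintype.card (torsion K) = torsionOrder K := by 
    rw [← Nat.card_eq_fintype_card]; rfl
  refine ⟨T.image φ, ?_, ?_, ?_⟩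
  · refine Finset.card_image_le.trans ?_
    rw [Finset.card_product, Finset.card_univ, hc, Fintype.card_piFinset]
    refine Nat.mul_le_mul_left _ ?_
    calc _ ≤ ∏ i : Fin (rank K), 2 := Finset.prod_le_prod' fun i _ => Finset.card_le_two
      _ = _ := by simp
  · intro u hu
    obtain ⟨p, hp, -⟩ := exist_unique_eq_mul_prod K u
    have hpT : p ∉ T := fun h => hu (Finset.mem_image.2 ⟨p, h, hp.symm⟩)
    rw [hp, zwt_unit_mul hx]
    simp only [T, Finset.mem_product, Finset.mem_univ, true_and, Fintype.mem_piFinset, not_forall] at hpT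
    obtain ⟨i, hi⟩ := hpT
    exact Finset.prod_eq_zero (Finset.mem_univ i) (ztent_out _ _ hi)
  · rw [Finset.sum_image hinj.injOn, Finset.sum_product]
    simp only [hφ, zwt_unit_mul hx]
    rw [Finset.sum_const, Finset.card_univ, hc, ← Finset.prod_univ_sum (f := fun i (e : ℤ) => ztent (y i + e))]
    simp [ztent_sum]

end
end

section
open NumberField NumberField.Units NumberField.Units.dirichletUnitTheorem NumberField.mixedEmbedding NumberField.InfinitePlace Module

section
variable {K : Type*} [Field K] [NumberField K]

theorem zl_sum {x : 𝓞 K} (hx : x ≠ 0) : ∑ w : InfinitePlace K, (mult w : ℝ) * Real.log (w (x:K)) = Real.log (zN x) := by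
  rw [← zN_eq, norm_eq_norm, ← prod_eq_abs_norm, Real.log_prod]
  · simp
  · intro w _
    have : (x:K) ≠ 0 := by simpa using hx
    exact pow_ne_zero _ (by simpa using this)

theorem zfin : (0:ℝ) < finrank ℚ K := by exact_mod_cast Module.finrank_pos

theorem zsum_mult : ∑ w : InfinitePlace K, (mult w : ℝ) = finrank ℚ K := by
  exact_mod_cast congrArg (Nat.cast (R := ℝ)) (sum_mult_eq (K := K))

theorem zlm {x : 𝓞 K} (w : {w : InfinitePlace K // w ≠ w₀}) : logMap (mixedEmbedding K (x:K)) w =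
    mult w.val * (Real.log (w.val (x:K)) - Real.log (zN x) / finrank ℚ K) := by
  rw [logMap_apply, zN_eq, normAtPlace_apply, div_eq_mul_inv]

theorem zmult_bd (w : InfinitePlace K) : (1:ℝ) ≤ mult w ∧ (mult w : ℝ) ≤ 2 := by
  unfold mult; split_ifs <;> norm_num

open Classical in
theorem zwt_supp : ∃ C : ℝ, 0 ≤ C ∧ ∀ x : 𝓞 K, zwt x ≠ 0 → ∀ w : InfinitePlace K,
    |Real.log (w (x:K)) - Real.log (zN x) / finrank ℚ K| ≤ C := by
  set L := LinearMap.toContinuousLinearMap (zc K).symm.toLinearMap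
  refine ⟨2 * Fintype.card (InfinitePlace K) * ‖L‖ + ‖L‖, by positivity, ?_⟩
  intro x hx
  have hx0 : x ≠ 0 := by rintro rfl; exact hx zwt_zero
  set v := logMap (mixedEmbedding K (x:K)) with hv
  have h1 : ‖v‖ ≤ ‖L‖ := by
    have h2 : L (zc K v) = v := by simp [L]
    have h3 : ‖zc K v‖ ≤ 1 := by
      rw [pi_norm_le_iff_of_nonneg zero_le_one]
      intro i
      unfold zwt at hx
      rw [if_neg hx0, Finset.prod_ne_zero_iff] at hx
      exact ztent_ne (hx i (Finset.mem_univ i))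
    calc ‖v‖ = ‖L (zc K v)‖ := by rw [h2]
      _ ≤ ‖L‖ * ‖zc K v‖ := L.le_opNorm _
      _ ≤ ‖L‖ * 1 := by gcongr
      _ = _ := mul_one _
  have h2 : ∀ w : InfinitePlace K, w ≠ w₀ → |Real.log (w (x:K)) - Real.log (zN x) / finrank ℚ K| ≤ ‖L‖ := by
    intro w hw
    have h3 := (norm_le_pi_norm v ⟨w, hw⟩).trans h1
    rw [hv, zlm, Real.norm_eq_abs, abs_mul, abs_of_nonneg (by positivity)] at h3
    have := (zmult_bd w).1
    nlinarith [abs_nonneg (Real.log (w (x:K)) - Real.log (zN x) / finrank ℚ K)]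
  intro w
  by_cases hw : w = w₀
  · have h3 : ∑ w : InfinitePlace K, (mult w : ℝ) * (Real.log (w (x:K)) - Real.log (zN x) / finrank ℚ K) = 0 := by
      simp_rw [mul_sub]
      rw [Finset.sum_sub_distrib, zl_sum hx0, ← Finset.sum_mul, zsum_mult]
      have := zfin (K := K)
      field_simp
      simp
    rw [← Finset.add_sum_erase _ _ (Finset.mem_univ w)] at h3
    have h4 : |∑ w' ∈ Finset.univ.erase w, (mult w' : ℝ) * (Real.log (w' (x:K)) - Real.log (zN x) / finrank ℚ K)| ≤
       Fintype.card (InfinitePlace K) * (2 * ‖L‖) := by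
      refine (Finset.abs_sum_le_sum_abs _ _).trans ?_
      refine (Finset.sum_le_card_nsmul _ _ (2 * ‖L‖) ?_).trans ?_
      · intro w' hw'
        rw [abs_mul, abs_of_nonneg (by positivity)]
        exact mul_le_mul (zmult_bd w').2 (h2 w' (by rintro rfl; simp [hw] at hw')) (abs_nonneg _) (by norm_num)
      · rw [nsmul_eq_mul]
        gcongr
        exact Finset.card_le_univ _
    have h5 := (zmult_bd w).1
    rw [← abs_neg, ← eq_neg_of_add_eq_zero_left h3, abs_mul, abs_of_nonneg (by positivity)] at h4
    nlinarith [abs_nonneg (Real.log (w (x:K)) - Real.log (zN x) / finrank ℚ K), norm_nonneg L]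
  · have := h2 w hw
    have h3 : 0 ≤ 2 * (Fintype.card (InfinitePlace K) : ℝ) * ‖L‖ := by positivity
    linarith

theorem zprod_sub {ι : Type*} (s : Finset ι) (a b : ι → ℝ) (ha : ∀ i, 0 ≤ a i ∧ a i ≤ 1) (hb : ∀ i, 0 ≤ b i ∧ b i ≤ 1) :
    |∏ i ∈ s, a i - ∏ i ∈ s, b i| ≤ ∑ i ∈ s, |a i - b i| := by
  classical
  induction s using Finset.induction_on with
  | empty => simp
  | insert i s hi ih =>
    rw [Finset.prod_insert hi, Finset.prod_insert hi, Finset.sum_insert hi]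
    have e : a i * ∏ j ∈ s, a j - b i * ∏ j ∈ s, b j = (a i - b i) * ∏ j ∈ s, a j + b i * (∏ j ∈ s, a j - ∏ j ∈ s, b j) := by ring
    rw [e]
    refine (abs_add_le _ _).trans (add_le_add ?_ ?_)
    · rw [abs_mul]
      refine mul_le_of_le_one_right (abs_nonneg _) ?_
      rw [abs_of_nonneg (Finset.prod_nonneg fun i _ => (ha i).1)]
      exact Finset.prod_le_one (fun i _ => (ha i).1) fun i _ => (ha i).2
    · rw [abs_mul, abs_of_nonneg (hb i).1]
      exact (mul_le_of_le_one_left (abs_nonneg _) (hb i).2).trans ih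

theorem zlN_lip {x y : 𝓞 K} (hx : x ≠ 0) (hy : y ≠ 0) (δ : ℝ)
    (h : ∀ w : InfinitePlace K, |Real.log (w (x:K)) - Real.log (w (y:K))| ≤ δ) :
    |Real.log (zN x) - Real.log (zN y)| ≤ finrank ℚ K * δ := by
  rw [← zl_sum hx, ← zl_sum hy, ← Finset.sum_sub_distrib, ← zsum_mult, Finset.sum_mul]
  refine (Finset.abs_sum_le_sum_abs _ _).trans (Finset.sum_le_sum fun w _ => ?_)
  rw [← mul_sub, abs_mul, abs_of_nonneg (by positivity)]
  exact mul_le_mul_of_nonneg_left (h w) (by positivity)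

open Classical in
theorem zwt_lip : ∃ C : ℝ, 0 ≤ C ∧ ∀ x y : 𝓞 K, x ≠ 0 → y ≠ 0 → ∀ δ : ℝ,
    (∀ w : InfinitePlace K, |Real.log (w (x:K)) - Real.log (w (y:K))| ≤ δ) →
    |zwt x - zwt y| ≤ C * δ := by
  set L := LinearMap.toContinuousLinearMap (zc K).toLinearMap
  refine ⟨rank K * (‖L‖ * 4), by positivity, ?_⟩
  intro x y hx hy δ h
  have hδ : 0 ≤ δ := (abs_nonneg _).trans (h (Classical.arbitrary _))
  have hN := zlN_lip hx hy δ h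
  set v := logMap (mixedEmbedding K (x:K)) with hv
  set v' := logMap (mixedEmbedding K (y:K)) with hv'
  have h1 : ‖v - v'‖ ≤ 4 * δ := by
    rw [pi_norm_le_iff_of_nonneg (by positivity)]
    intro w
    rw [Pi.sub_apply, hv, hv', zlm, zlm, ← mul_sub, Real.norm_eq_abs, abs_mul, abs_of_nonneg (by positivity)]
    have h2 : |Real.log (w.val (x:K)) - Real.log (zN x) / finrank ℚ K - (Real.log (w.val (y:K)) - Real.log (zN y) / finrank ℚ K)| ≤ 2 * δ := by
      have e : Real.log (w.val (x:K)) - Real.log (zN x) / finrank ℚ K - (Real.log (w.val (y:K)) - Real.log (zN y) / finrank ℚ K)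
        = (Real.log (w.val (x:K)) - Real.log (w.val (y:K))) - (Real.log (zN x) - Real.log (zN y)) / finrank ℚ K := by ring
      rw [e]
      refine (abs_sub _ _).trans ?_
      have := h w.val
      have h3 : |(Real.log (zN x) - Real.log (zN y)) / finrank ℚ K| ≤ δ := by
        rw [abs_div, abs_of_pos (zfin (K := K)), div_le_iff₀ zfin, mul_comm]; exact hN
      linarith
    have := (zmult_bd w.val)
    nlinarith [abs_nonneg (Real.log (w.val (x:K)) - Real.log (zN x) / finrank ℚ K - (Real.log (w.val (y:K)) - Real.log (zN y) / finrank ℚ K))]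
  have h2 : ∀ i, |zc K v i - zc K v' i| ≤ ‖L‖ * (4 * δ) := by
    intro i
    have h3 : zc K v - zc K v' = L (v - v') := by simp [L]
    rw [← Pi.sub_apply, h3]
    refine (norm_le_pi_norm (L (v - v')) i).trans ((L.le_opNorm _).trans ?_)
    gcongr
  unfold zwt
  rw [if_neg hx, if_neg hy]
  refine (zprod_sub _ _ _ (fun i => ⟨ztent_nonneg _, ztent_le_one _⟩) (fun i => ⟨ztent_nonneg _, ztent_le_one _⟩)).trans ?_
  refine (Finset.sum_le_card_nsmul _ _ (‖L‖ * (4 * δ)) fun i _ => (ztent_lip _ _).trans (h2 i)).trans ?_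
  simp; linarith

theorem zN_nat_mul (n : ℕ) (x : 𝓞 K) : zN ((n : 𝓞 K) * x) = (n : ℝ) ^ (finrank ℚ K) * zN x := by
  rw [← zN_eq, ← zN_eq]
  rw [← Nat.abs_cast (R := ℝ) n, ← mixedEmbedding.norm_smul]
  congr 1
  rw [RingOfIntegers.coe_eq_algebraMap, map_mul, map_natCast, map_mul, map_natCast, Nat.cast_smul_eq_nsmul, nsmul_eq_mul]

theorem zwt_nat_mul (n : ℕ) (hn : n ≠ 0) (x : 𝓞 K) : zwt ((n : 𝓞 K) * x) = zwt x := by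
  by_cases hx : x = 0
  · simp [hx]
  unfold zwt
  rw [if_neg hx, if_neg (mul_ne_zero (by exact_mod_cast hn) hx)]
  have hx0 : mixedEmbedding.norm (mixedEmbedding K (x:K)) ≠ 0 := by
    rw [zN_eq]; linarith [zN_pos hx]
  have := logMap_real_smul hx0 (c := n) (by exact_mod_cast hn)
  rw [← this]
  rw [RingOfIntegers.coe_eq_algebraMap, map_mul, map_natCast, map_mul, map_natCast, Nat.cast_smul_eq_nsmul, nsmul_eq_mul]

end
end

section
open NumberField NumberField.InfinitePlace Module

noncomputable section
variable {K : Type*} [Field K] [NumberField K]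

/-- weighted norm power -/
def zF (s : ℂ) (x : 𝓞 K) : ℂ := (zwt x : ℂ) * ((zN x : ℝ) : ℂ) ^ (-s)

theorem zNpow {x : 𝓞 K} (hx : x ≠ 0) (s : ℂ) : ‖((zN x : ℝ) : ℂ) ^ (-s)‖ = zN x ^ (-s.re) := by
  rw [Complex.norm_cpow_eq_rpow_re_of_pos (by linarith [zN_pos hx])]; simp

theorem zF_zero (s : ℂ) : zF s (0 : 𝓞 K) = 0 := by simp [zF, zwt_zero]

theorem zF_wt {s : ℂ} {x : 𝓞 K} (h : zwt x = 0) : zF s x = 0 := by simp [zF, h]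

theorem zF_norm_le (s : ℂ) (x : 𝓞 K) : ‖zF s x‖ ≤ zN x ^ (-s.re) := by
  by_cases hx : x = 0
  · subst hx; rw [zF_zero, norm_zero]; exact Real.rpow_nonneg (by unfold zN; positivity) _
  unfold zF
  rw [norm_mul, zNpow hx, Complex.norm_real, Real.norm_eq_abs, abs_of_nonneg (zwt_nonneg x)]
  exact mul_le_of_le_one_left (Real.rpow_nonneg (by linarith [zN_pos hx]) _) (zwt_le_one x)

theorem zF_le_one {s : ℂ} (hs : 0 ≤ s.re) (x : 𝓞 K) : ‖zF s x‖ ≤ 1 := by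
  by_cases hx : x = 0
  · subst hx; rw [zF_zero, norm_zero]; exact zero_le_one
  exact (zF_norm_le s x).trans (Real.rpow_le_one_of_one_le_of_nonpos (zN_pos hx) (by linarith))

theorem zlog {a b R : ℝ} (ha : 0 < a) (h : |b - a| ≤ R) (hR : 2 * R ≤ a) :
    0 < b ∧ |Real.log b - Real.log a| ≤ 2 * R / a := by
  have h1 := abs_le.1 h
  have hb : 0 < b := by linarith
  refine ⟨hb, ?_⟩
  rw [← Real.log_div hb.ne' ha.ne', abs_le]
  constructor
  · refine le_trans ?_ (Real.one_sub_inv_le_log_of_pos (by positivity))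
    rw [inv_div]
    have : a / b - 1 ≤ 2 * R / a := by
      have e : a / b - 1 = (a - b) / b := by field_simp
      rw [e, div_le_div_iff₀ hb ha]
      nlinarith
    linarith
  · refine (Real.log_le_sub_one_of_pos (by positivity)).trans ?_
    have e : b / a - 1 = (b - a) / a := by field_simp
    rw [e, div_le_div_iff_of_pos_right ha]
    have := (abs_nonneg _).trans h
    linarith

theorem zF_diff (R σ₀ S : ℝ) (hR : 0 < R) (hσ : 0 < σ₀) (hS : 0 ≤ S) : ∃ C : ℝ, 0 ≤ C ∧ ∀ x y : 𝓞 K, zwt x ≠ 0 →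
    (∀ w : InfinitePlace K, w ((y - x : 𝓞 K) : K) ≤ R) → ∀ s : ℂ, σ₀ ≤ s.re → ‖s‖ ≤ S →
    ‖zF s y - zF s x‖ ≤ C * zN x ^ (-(σ₀ + 1 / finrank ℚ K)) := by
  obtain ⟨C0, hC0, H0⟩ := zwt_supp (K := K)
  obtain ⟨C1, hC1, H1⟩ := zwt_lip (K := K)
  have hd := zfin (K := K)
  set d : ℝ := (finrank ℚ K : ℝ) with hd'
  set Q := 2 * R * Real.exp C0 with hQ
  have hQ0 : 0 < Q := by positivity
  refine ⟨2 * Q ^ (d * σ₀ + 1) + Q * (C1 + S * d) * Real.exp (S * d), by positivity, ?_⟩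
  intro x y hx hxy s hs hsS
  have hx0 : x ≠ 0 := by rintro rfl; exact hx zwt_zero
  have hN := zN_pos hx0
  have hN0 : 0 < zN x := by linarith
  set T := zN x ^ (1 / d) with hT
  have hT0 : 0 < T := by positivity
  have hTl : Real.log T = Real.log (zN x) / d := by rw [hT, Real.log_rpow hN0]; ring
  have hsum : zN x ^ (-(σ₀ + 1 / d)) = zN x ^ (-σ₀) * T⁻¹ := by
    rw [neg_add, Real.rpow_add hN0, Real.rpow_neg hN0.le (1/d)]
  by_cases hcase : Q ≤ T
  · set δ := Q / T with hδ
    have hδ0 : 0 < δ := by positivity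
    have hδ1 : δ ≤ 1 := by rw [hδ, div_le_one hT0]; exact hcase
    have hw : ∀ w : InfinitePlace K, 0 < w (y : K) ∧ |Real.log (w (y:K)) - Real.log (w (x:K))| ≤ δ := by
      intro w
      have hwx : 0 < w (x:K) := by
        rw [w.pos_iff]; simpa using hx0
      have h2 : T * Real.exp (-C0) ≤ w (x:K) := by
        rw [← Real.exp_log hT0, ← Real.exp_add, ← Real.exp_log hwx, Real.exp_le_exp, hTl]
        have := abs_le.1 (H0 x hx w)
        linarith
      have h3 : 2 * R ≤ T * Real.exp (-C0) := by
        rw [Real.exp_neg, ← div_eq_mul_inv, le_div_iff₀ (Real.exp_pos _)]; exact hcase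
      have h4 : |w (y:K) - w (x:K)| ≤ R := by
        refine le_trans ?_ (hxy w)
        have := abs_sub_map_le_sub w.1 (y:K) (x:K)
        simp only [map_sub]
        exact this
      obtain ⟨h5, h6⟩ := zlog hwx h4 (h3.trans h2)
      refine ⟨h5, h6.trans ?_⟩
      rw [hδ, div_le_div_iff₀ hwx hT0, hQ]
      rw [Real.exp_neg, ← div_eq_mul_inv, div_le_iff₀ (Real.exp_pos _)] at h2
      nlinarith
    have hy0 : y ≠ 0 := by
      rintro rfl
      have := (hw (Classical.arbitrary _)).1
      simp at this
    have hyN0 : 0 < zN y := by linarith [zN_pos hy0]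
    have hwt := H1 y x hy0 hx0 δ (fun w => (hw w).2)
    have hlN := zlN_lip hy0 hx0 δ (fun w => (hw w).2)
    set Δ := Real.log (zN y) - Real.log (zN x) with hΔ
    have hpow : ((zN y : ℝ) : ℂ) ^ (-s) = ((zN x : ℝ) : ℂ) ^ (-s) * Complex.exp (-s * Δ) := by
      rw [Complex.cpow_def_of_ne_zero (by exact_mod_cast hyN0.ne'), Complex.cpow_def_of_ne_zero (by exact_mod_cast hN0.ne'),
        ← Complex.exp_add, ← Complex.ofReal_log hyN0.le, ← Complex.ofReal_log hN0.le, hΔ]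
      congr 1; push_cast; ring
    have hz : ‖-s * Δ‖ ≤ S * d * δ := by
      rw [norm_mul, norm_neg, Complex.norm_real, Real.norm_eq_abs, mul_assoc]
      gcongr
    have hz1 : ‖-s * Δ‖ ≤ S * d := hz.trans (mul_le_of_le_one_right (by positivity) hδ1)
    have he : ‖Complex.exp (-s * Δ)‖ ≤ Real.exp (S * d) :=
      (Complex.norm_exp_le_exp_norm _).trans (Real.exp_le_exp.2 hz1)
    have he1 : ‖Complex.exp (-s * Δ) - 1‖ ≤ S * d * δ * Real.exp (S * d) := by
      have := Complex.norm_exp_sub_sum_le_norm_mul_exp (-s * Δ) 1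
      simp only [Finset.sum_range_one, pow_zero, Nat.factorial_zero, Nat.cast_one, div_one, pow_one] at this
      exact this.trans (mul_le_mul hz (Real.exp_le_exp.2 hz1) (Real.exp_pos _).le (by positivity))
    have hp : ‖((zN x : ℝ) : ℂ) ^ (-s)‖ ≤ zN x ^ (-σ₀) := by
      rw [zNpow hx0]; exact Real.rpow_le_rpow_of_exponent_le hN (by linarith)
    have key : zF s y - zF s x = ((zN x : ℝ) : ℂ) ^ (-s) * (((zwt y - zwt x : ℝ) : ℂ) * Complex.exp (-s * Δ) + 
        (zwt x : ℂ) * (Complex.exp (-s * Δ) - 1)) := by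
      unfold zF; rw [hpow]; push_cast; ring
    rw [key, norm_mul, hsum]
    have hin : ‖((zwt y - zwt x : ℝ) : ℂ) * Complex.exp (-s * Δ) + 
        (zwt x : ℂ) * (Complex.exp (-s * Δ) - 1)‖ ≤ C1 * δ * Real.exp (S * d) + 1 * (S * d * δ * Real.exp (S * d)) := by
      refine (norm_add_le _ _).trans (add_le_add ?_ ?_)
      · rw [norm_mul, Complex.norm_real]; exact mul_le_mul hwt he (norm_nonneg _) (by positivity)
      · rw [norm_mul, Complex.norm_real, Real.norm_eq_abs, abs_of_nonneg (zwt_nonneg x)]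
        exact mul_le_mul (zwt_le_one x) he1 (norm_nonneg _) zero_le_one
    calc _ ≤ zN x ^ (-σ₀) * (C1 * δ * Real.exp (S * d) + 1 * (S * d * δ * Real.exp (S * d))) := by gcongr
      _ = (Q * (C1 + S * d) * Real.exp (S * d)) * (zN x ^ (-σ₀) * T⁻¹) := by rw [hδ]; ring
      _ ≤ _ := by
        gcongr
        have : 0 ≤ 2 * Q ^ (d * σ₀ + 1) := by positivity
        linarith
  · push Not at hcase
    have h1 : ‖zF s y - zF s x‖ ≤ 2 := by
      refine (norm_sub_le _ _).trans ?_
      have := zF_le_one (K := K) (s := s) (by linarith) y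
      have := zF_le_one (K := K) (s := s) (by linarith) x
      linarith
    refine h1.trans ?_
    have h2 : zN x ^ (-(σ₀ + 1 / d)) = (T ^ (d * σ₀ + 1))⁻¹ := by
      rw [Real.rpow_neg hN0.le, hT, ← Real.rpow_mul hN0.le]
      congr 2; field_simp
    rw [h2, ← div_eq_mul_inv, le_div_iff₀ (by positivity)]
    have h3 : T ^ (d * σ₀ + 1) ≤ Q ^ (d * σ₀ + 1) := Real.rpow_le_rpow hT0.le hcase.le (by positivity)
    have : 0 ≤ Q * (C1 + S * d) * Real.exp (S * d) := by positivity
    linarith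

end
end

section
open NumberField Filter Topology

theorem zterm {ι : Type*} (N : ι → ℕ) (g : ι → ℂ) (s : ℂ) (hs : s ≠ 0) (n : ℕ) :
    ∑' i : {i // N i = n}, g i * (N i : ℂ) ^ (-s) = LSeries.term (fun n => ∑' i : {i // N i = n}, g i) s n := by
  have : ∀ i : {i // N i = n}, g i * (N i : ℂ) ^ (-s) = g i * (n : ℂ) ^ (-s) := fun i => by rw [i.2]
  simp_rw [this]
  rw [tsum_mul_right]
  by_cases hn : n = 0
  · subst hn; simp [hs]
  · rw [LSeries.term_of_ne_zero hn, Complex.cpow_neg, div_eq_mul_inv]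

theorem zregroup {ι : Type*} (N : ι → ℕ) (g : ι → ℂ) (s : ℂ) (hs : s ≠ 0)
    (h : Summable (fun i => g i * (N i : ℂ) ^ (-s))) :
    ∑' i, g i * (N i : ℂ) ^ (-s) = LSeries (fun n => ∑' i : {i // N i = n}, g i) s := by
  unfold LSeries
  simp_rw [← zterm N g s hs]
  rw [← (Equiv.sigmaFiberEquiv N).tsum_eq]
  have h2 := (Equiv.sigmaFiberEquiv N).summable_iff.2 h
  exact Summable.tsum_sigma h2

theorem zregroup_summable {ι : Type*} (N : ι → ℕ) (g : ι → ℝ) (hg : ∀ i, 0 ≤ g i)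
    (hfib : ∀ n ≠ 0, Summable (fun i : {i // N i = n} => g i)) (s : ℝ) (hs : s ≠ 0)
    (h : LSeriesSummable (fun n => ((∑' i : {i // N i = n}, g i : ℝ) : ℂ)) s) :
    Summable (fun i => g i * (N i : ℝ) ^ (-s)) := by
  rw [← (Equiv.sigmaFiberEquiv N).summable_iff]
  rw [summable_sigma_of_nonneg]
  · constructor
    · intro n
      have : ∀ i : {i // N i = n}, g i * (N i : ℝ) ^ (-s) = g i * (n : ℝ) ^ (-s) := fun i => by rw [i.2]
      change Summable fun i : {i // N i = n} => g i * (N i : ℝ) ^ (-s)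
      simp_rw [this]
      by_cases hn : n = 0
      · subst hn; simp [Real.zero_rpow (neg_ne_zero.2 hs), summable_zero]
      · exact (hfib n hn).mul_right _
    · have h3 := h.norm
      refine h3.congr fun n => ?_
      change _ = ∑' i : {i // N i = n}, g i * (N i : ℝ) ^ (-s)
      have : ∀ i : {i // N i = n}, g i * (N i : ℝ) ^ (-s) = g i * (n : ℝ) ^ (-s) := fun i => by rw [i.2]
      simp_rw [this]
      rw [tsum_mul_right]
      by_cases hn : n = 0
      · subst hn; simp [Real.zero_rpow (neg_ne_zero.2 hs)]
      · rw [LSeries.norm_term_eq, if_neg hn, Complex.norm_real, Real.norm_eq_abs, abs_of_nonneg (tsum_nonneg fun i => hg _), Real.rpow_neg (by positivity),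
          div_eq_mul_inv]
        simp
  · intro x
    simp only [Function.comp]
    exact mul_nonneg (hg _) (by positivity)

section
variable (K : Type*) [Field K] [NumberField K]

theorem zcoef (n : ℕ) : (∑' _i : {I : Ideal (𝓞 K) // Ideal.absNorm I = n}, (1:ℝ)) = Nat.card {I : Ideal (𝓞 K) // Ideal.absNorm I = n} := by
  rw [tsum_const]; simp

theorem zideal_lsummable {s : ℂ} (hs : 1 < s.re) :
    LSeriesSummable (fun n ↦ (Nat.card {I : Ideal (𝓞 K) // Ideal.absNorm I = n} : ℂ)) s := by
  have h1 : Tendsto (fun n : ℕ => (∑ k ∈ Finset.Icc 1 n, (Nat.card {I : Ideal (𝓞 K) // Ideal.absNorm I = k} : ℝ)) / n) atTop (𝓝 (dedekindZeta_residue K)) := by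
    refine ((Ideal.tendsto_norm_le_div_atTop₀ K).comp tendsto_natCast_atTop_atTop).congr fun n ↦ ?_
    simp only [Function.comp_apply, Nat.cast_le, ← Nat.cast_sum]
    congr
    rw [← add_left_inj 1, ← Ideal.card_norm_le_eq_card_norm_le_add_one,
      show Finset.Icc 1 n = Finset.Ioc 0 n from Finset.Icc_succ_left_eq_Ioc _ _,
      show 1 = Nat.card {I : Ideal (𝓞 K) // Ideal.absNorm I = 0} by simp [Ideal.absNorm_eq_zero_iff],
      Finset.sum_Ioc_add_eq_sum_Icc (n.zero_le),
      ← Finset.card_preimage_eq_sum_card_image_eq (fun k _ ↦ Ideal.finite_setOfPred_absNorm_eq k)]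
    simp [Set.coe_eq_subtype]
  have h2 := LSeriesSummable_of_sum_norm_bigO_and_nonneg (f := fun n ↦ (Nat.card {I : Ideal (𝓞 K) // Ideal.absNorm I = n} : ℝ)) (r := 1)
    (s := s) ?_ (fun _ => Nat.cast_nonneg _) zero_le_one (by simpa using hs)
  · simpa using h2
  · have h3 := h1.isBigO_one ℝ
    simp only [Real.rpow_one]
    have h4 := h3.mul (Asymptotics.isBigO_refl (fun n : ℕ => (n:ℝ)) atTop)
    simp only [one_mul] at h4
    refine h4.congr' ?_ EventuallyEq.rfl
    filter_upwards [eventually_gt_atTop 0] with n hn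
    have : (n:ℝ) ≠ 0 := by positivity
    field_simp

theorem zideal_summable {τ : ℝ} (hτ : 1 < τ) : Summable (fun I : Ideal (𝓞 K) => (Ideal.absNorm I : ℝ) ^ (-τ)) := by
  have := zregroup_summable (ι := Ideal (𝓞 K)) (fun I => Ideal.absNorm I) (fun _ => 1) (fun _ => zero_le_one) ?_ τ (by linarith) ?_
  · simpa using this
  · intro n _
    have : Finite {I : Ideal (𝓞 K) // Ideal.absNorm I = n} := Ideal.finite_setOfPred_absNorm_eq n
    exact Summable.of_finite
  · simp_rw [zcoef]
    simpa using zideal_lsummable K (s := τ) (by simpa using hτ)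

theorem zideal_summableC {s : ℂ} (hs : 1 < s.re) : Summable (fun I : Ideal (𝓞 K) => (Ideal.absNorm I : ℂ) ^ (-s)) := by
  refine Summable.of_norm ((zideal_summable K hs).congr fun I => ?_)
  by_cases h : Ideal.absNorm I = 0
  · rw [h]; 
    have h1 : s ≠ 0 := by rintro rfl; simp at hs; linarith
    simp [h1, Real.zero_rpow (show -s.re ≠ 0 by linarith)]
  · rw [Complex.norm_natCast_cpow_of_pos (Nat.pos_of_ne_zero h)]; simp

theorem zideal_tsum {s : ℂ} (hs : 1 < s.re) : ∑' I : Ideal (𝓞 K), (Ideal.absNorm I : ℂ) ^ (-s) = dedekindZeta K s := by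
  have h1 : s ≠ 0 := by rintro rfl; simp at hs; linarith
  have := zregroup (ι := Ideal (𝓞 K)) (fun I => Ideal.absNorm I) (fun _ => 1) s h1 (by simpa using zideal_summableC K hs)
  simp only [one_mul] at this
  rw [this]
  unfold dedekindZeta
  congr 1; ext n
  rw [tsum_const]; simp
end
end

section
open NumberField NumberField.Units Filter Topology Module
open scoped nonZeroDivisors

noncomputable section
variable {K : Type*} [Field K] [NumberField K]

theorem zfib {A : Ideal (𝓞 K)} (hA : A ≠ ⊥) : ∃ T : Finset {x : 𝓞 K // Ideal.span {x} = A},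
    T.card ≤ torsionOrder K * 2 ^ (rank K) ∧ (∀ x ∉ T, zwt x.1 = 0) ∧ 
    (A.IsPrincipal → ∑ x ∈ T, zwt x.1 = torsionOrder K) := by
  classical
  by_cases hp : A.IsPrincipal
  · obtain ⟨a, ha⟩ := hp.principal
    replace ha : A = Ideal.span {a} := ha
    have ha0 : a ≠ 0 := by rintro rfl; simp at ha; exact hA ha
    obtain ⟨S, hS1, hS2, hS3⟩ := zwt_units ha0
    let φ : (𝓞 K)ˣ → {x : 𝓞 K // Ideal.span {x} = A} := fun u => ⟨u * a, by
      rw [ha, Ideal.span_singleton_eq_span_singleton]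
      exact associated_unit_mul_left a _ u.isUnit⟩
    have hφ : Function.Injective φ := by
      intro u v h
      have := congrArg Subtype.val h
      simp only [φ] at this
      exact Units.ext (mul_right_cancel₀ ha0 this)
    refine ⟨S.image φ, Finset.card_image_le.trans hS1, ?_, fun _ => ?_⟩
    · rintro ⟨x, hx⟩ hxS
      have h1 := hx
      rw [ha, Ideal.span_singleton_eq_span_singleton] at h1
      obtain ⟨u, hu⟩ := h1.symm
      have : φ u = ⟨x, hx⟩ := Subtype.ext (by simp only [φ]; rw [mul_comm]; exact hu)
      rw [← this] at hxS ⊢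
      exact hS2 u fun h => hxS (Finset.mem_image_of_mem φ h)
    · rw [Finset.sum_image hφ.injOn, ← hS3]
  · refine ⟨∅, by simp, fun x _ => ?_, fun h => absurd h hp⟩
    exact absurd ⟨⟨x.1, x.2.symm⟩⟩ hp

open Classical in
/-- majorant -/
def zg (τ : ℝ) (x : 𝓞 K) : ℝ := if zwt x = 0 then 0 else zN x ^ (-τ)

theorem zg_nonneg (τ : ℝ) (x : 𝓞 K) : 0 ≤ zg τ x := by
  unfold zg; split_ifs
  · rfl
  · exact Real.rpow_nonneg (by unfold zN; positivity) _

theorem zg_summable {τ : ℝ} (hτ : 1 < τ) : Summable (zg (K := K) τ) := by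
  classical
  rw [← (Equiv.sigmaFiberEquiv (fun x : 𝓞 K => Ideal.span {x})).summable_iff]
  have hfib : ∀ A : Ideal (𝓞 K), ∃ T : Finset {x : 𝓞 K // Ideal.span {x} = A},
    T.card ≤ torsionOrder K * 2 ^ (rank K) ∧ (∀ x ∉ T, zg τ x.1 = 0) := by
    intro A
    by_cases hA : A = ⊥
    · refine ⟨∅, by simp, fun x _ => ?_⟩
      have : x.1 = 0 := by have := x.2.trans hA; simpa using this
      rw [this]; simp [zg, zwt_zero]
    · obtain ⟨T, h1, h2, -⟩ := zfib hA
      exact ⟨T, h1, fun x hx => by simp [zg, h2 x hx]⟩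
  refine (summable_sigma_of_nonneg (f := fun x => zg τ (Equiv.sigmaFiberEquiv (fun x : 𝓞 K => Ideal.span {x}) x)) (fun _ => zg_nonneg _ _)).2 ⟨?_, ?_⟩
  · intro A
    obtain ⟨T, -, hT⟩ := hfib A
    exact summable_of_ne_finset_zero hT
  · refine Summable.of_nonneg_of_le (fun A => tsum_nonneg fun _ => zg_nonneg _ _) (fun A => ?_)
      ((zideal_summable K hτ).mul_left ((torsionOrder K * 2 ^ (rank K) : ℕ) : ℝ))
    obtain ⟨T, h1, hT⟩ := hfib A
    change ∑' x : {x : 𝓞 K // Ideal.span {x} = A}, zg τ x.1 ≤ _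
    rw [tsum_eq_sum hT]
    refine (Finset.sum_le_card_nsmul _ _ ((Ideal.absNorm A : ℝ) ^ (-τ)) fun x _ => ?_).trans ?_
    · unfold zg zN
      rw [x.2]
      split_ifs
      · positivity
      · rfl
    · rw [nsmul_eq_mul]; gcongr

theorem zF_norm_le_zg (s : ℂ) (x : 𝓞 K) : ‖zF s x‖ ≤ zg s.re x := by
  unfold zg; split_ifs with h
  · rw [zF_wt h, norm_zero]
  · exact zF_norm_le s x

theorem zF_summable {s : ℂ} (hs : 1 < s.re) : Summable (zF (K := K) s) :=
  Summable.of_norm_bounded (zg_summable hs) (zF_norm_le_zg s)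

open Classical in
theorem zJ_tsum {s : ℂ} (hs : 1 < s.re) {J : Ideal (𝓞 K)} (hJ : J ≠ ⊥) :
    ∑' x : J, zF s x.1 = (Ideal.absNorm J : ℂ) ^ (-s) * ∑' I : Ideal (𝓞 K), 
      (if (I * J).IsPrincipal then (torsionOrder K : ℂ) * (Ideal.absNorm I : ℂ) ^ (-s) else 0) := by
  have hs0 : s ≠ 0 := by rintro rfl; simp at hs; linarith
  have h1 : ∑' x : J, zF s x.1 = ∑' x : 𝓞 K, (J : Set (𝓞 K)).indicator (zF s) x := tsum_subtype (J : Set (𝓞 K)) (zF s)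
  have h2 : Summable ((J : Set (𝓞 K)).indicator (zF s)) := (zF_summable hs).indicator _
  rw [h1, ← (Equiv.sigmaFiberEquiv (fun x : 𝓞 K => Ideal.span {x})).tsum_eq]
  refine (Summable.tsum_sigma ((Equiv.sigmaFiberEquiv (fun x : 𝓞 K => Ideal.span {x})).summable_iff.2 h2)).trans ?_
  have h3 : ∀ A : Ideal (𝓞 K), ∑' x : {x : 𝓞 K // Ideal.span {x} = A}, (J : Set (𝓞 K)).indicator (zF s) x.1 =
      if A ≤ J ∧ A.IsPrincipal then (torsionOrder K : ℂ) * (Ideal.absNorm A : ℂ) ^ (-s) else 0 := by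
    intro A
    by_cases hA : A = ⊥
    · have : ∀ x : {x : 𝓞 K // Ideal.span {x} = A}, (J : Set (𝓞 K)).indicator (zF s) x.1 = 0 := by
        intro x
        have : x.1 = 0 := by have := x.2.trans hA; simpa using this
        rw [this, Set.indicator_apply_eq_zero]; intro; exact zF_zero s
      simp_rw [this]
      simp [hA, hs0]
    obtain ⟨T, -, hT2, hT3⟩ := zfib hA
    by_cases hAJ : A ≤ J
    · have h4 : ∀ x : {x : 𝓞 K // Ideal.span {x} = A}, (J : Set (𝓞 K)).indicator (zF s) x.1 = (zwt x.1 : ℂ) * (Ideal.absNorm A : ℂ) ^ (-s) := by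
        intro x
        rw [Set.indicator_of_mem]
        · unfold zF zN; rw [x.2]; simp
        · exact hAJ (x.2.le (Ideal.mem_span_singleton_self _))
      simp_rw [h4]
      rw [tsum_mul_right]
      by_cases hp : A.IsPrincipal
      · rw [if_pos ⟨hAJ, hp⟩, tsum_eq_sum (s := T) (fun x hx => by rw [hT2 x hx]; simp)]
        rw [← Complex.ofReal_sum, hT3 hp]; simp
      · rw [if_neg (fun h => hp h.2)]
        have : IsEmpty {x : 𝓞 K // Ideal.span {x} = A} := ⟨fun x => hp ⟨⟨x.1, x.2.symm⟩⟩⟩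
        simp
    · rw [if_neg (fun h => hAJ h.1)]
      have : ∀ x : {x : 𝓞 K // Ideal.span {x} = A}, (J : Set (𝓞 K)).indicator (zF s) x.1 = 0 := by
        intro x
        rw [Set.indicator_of_notMem]
        intro h
        exact hAJ (x.2.symm.le.trans ((Ideal.span_singleton_le_iff_mem _).2 h))
      simp_rw [this]; simp
  have h5 : ∀ A : Ideal (𝓞 K), ∑' x : {x : 𝓞 K // Ideal.span {x} = A}, 
    (J : Set (𝓞 K)).indicator (zF s) ((Equiv.sigmaFiberEquiv (fun x : 𝓞 K => Ideal.span {x})) ⟨A, x⟩) =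
      if A ≤ J ∧ A.IsPrincipal then (torsionOrder K : ℂ) * (Ideal.absNorm A : ℂ) ^ (-s) else 0 := h3
  refine (tsum_congr h5).trans ?_
  have hinj : Function.Injective (fun I : Ideal (𝓞 K) => I * J) := fun I I' h => mul_right_cancel₀ hJ h
  rw [← hinj.tsum_eq, ← tsum_mul_left]
  · congr 1; ext I
    have : I * J ≤ J := Ideal.mul_le_right
    simp only [this, true_and]
    split_ifs
    · rw [map_mul, Nat.cast_mul, Complex.natCast_mul_natCast_cpow]; ring
    · simp
  · intro A hA
    simp only [Function.mem_support, ne_eq, ite_eq_right_iff, Classical.not_imp] at hA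
    obtain ⟨I, hI⟩ := Ideal.dvd_iff_le.2 hA.1.1
    exact ⟨I, by simp only; rw [hI, mul_comm]⟩

theorem zclass : ∃ J : ClassGroup (𝓞 K) → Ideal (𝓞 K), (∀ c, J c ≠ ⊥) ∧ 
    ∀ s : ℂ, 1 < s.re → ∑ c, (Ideal.absNorm (J c) : ℂ) ^ s * ∑' x : J c, zF s x.1 = torsionOrder K * dedekindZeta K s := by
  classical
  have h : ∀ c : ClassGroup (𝓞 K), ∃ J : (Ideal (𝓞 K))⁰, ClassGroup.mk0 J = c⁻¹ := fun c => ClassGroup.mk0_surjective _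
  choose J hJ using h
  have hJ0 : ∀ c, (J c : Ideal (𝓞 K)) ≠ ⊥ := fun c => nonZeroDivisors.ne_zero (J c).2
  refine ⟨fun c => J c, hJ0, fun s hs => ?_⟩
  have hs0 : s ≠ 0 := by rintro rfl; simp at hs; linarith
  have h1 : ∀ c, (Ideal.absNorm (J c : Ideal (𝓞 K)) : ℂ) ^ s * ∑' x : (J c : Ideal (𝓞 K)), zF s x.1 = ∑' I : Ideal (𝓞 K), 
      (if (I * J c).IsPrincipal then (torsionOrder K : ℂ) * (Ideal.absNorm I : ℂ) ^ (-s) else 0) := by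
    intro c
    rw [zJ_tsum hs (hJ0 c), ← mul_assoc, ← Complex.cpow_add _ _ (by simpa [Ideal.absNorm_eq_zero_iff] using hJ0 c)]
    simp
  simp_rw [h1]
  rw [← Summable.tsum_finsetSum, ← zideal_tsum K hs, ← tsum_mul_left]
  · congr 1; ext I
    by_cases hI : I = ⊥
    · simp [hI, hs0]
    have hI' : I ∈ (Ideal (𝓞 K))⁰ := mem_nonZeroDivisors_of_ne_zero hI
    have h2 : ∀ c, (I * J c).IsPrincipal ↔ ClassGroup.mk0 ⟨I, hI'⟩ = c := by
      intro c
      rw [← ClassGroup.mk0_eq_one_iff (mul_mem hI' (J c).2), ← mul_inv_eq_one (a := ClassGroup.mk0 ⟨I, hI'⟩) (b := c), ← hJ c, ← map_mul]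
      rfl
    simp_rw [h2]
    simp
  · intro c _
    refine Summable.of_norm_bounded ((zideal_summableC K hs).norm.mul_left (torsionOrder K : ℝ)) fun I => ?_
    split_ifs
    · simp
    · simp; positivity
end
end

section
open NumberField NumberField.Units Filter Topology Module
open scoped nonZeroDivisors

noncomputable section
variable {K : Type*} [Field K] [NumberField K]

theorem zlat {J : Ideal (𝓞 K)} (hJ : J ≠ ⊥) (n : ℕ) [NeZero n] :
    ∃ r : (Fin (finrank ℚ K) → Fin n) → J,
      Function.Bijective (fun p : (Fin (finrank ℚ K) → Fin n) × J => n • p.2 + r p.1) := by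
  classical
  let b0 := Ideal.selfBasis (RingOfIntegers.basis K) J hJ
  have hc : Fintype.card (Free.ChooseBasisIndex ℤ (𝓞 K)) = finrank ℚ K := by
    rw [← RingOfIntegers.rank, finrank_eq_card_chooseBasisIndex]
  let b := b0.reindex (Fintype.equivFinOfCardEq hc)
  let r : (Fin (finrank ℚ K) → Fin n) → J := fun q => b.equivFun.symm (fun i => ((q i : ℕ) : ℤ))
  let e1 : (Fin (finrank ℚ K) → ℤ) ≃ (Fin (finrank ℚ K) → ℤ) × (Fin (finrank ℚ K) → Fin n) :=
    (Equiv.arrowCongr (Equiv.refl _) (Int.divModEquiv n)).trans (Equiv.arrowProdEquivProdArrow _ _ _)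
  let E : (Fin (finrank ℚ K) → Fin n) × J ≃ J :=
    (Equiv.prodComm _ _).trans (((b.equivFun.toEquiv.prodCongr (Equiv.refl _)).trans e1.symm).trans b.equivFun.symm.toEquiv)
  refine ⟨r, ?_⟩
  convert E.bijective using 1
  ext p : 1
  have : (n • p.2 : J) = b.equivFun.symm (fun i => (n:ℤ) * b.equivFun p.2 i) := by
    apply b.equivFun.injective
    ext i
    rw [LinearEquiv.apply_symm_apply, map_nsmul]
    simp
  rw [this]
  simp only [r]
  rw [← map_add]
  simp only [E, Equiv.trans_apply]
  change _ = b.equivFun.symm _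
  congr 1
  ext i
  simp [e1, Equiv.arrowProdEquivProdArrow]
  ring

theorem zF_differentiable (x : 𝓞 K) : Differentiable ℂ (fun s => zF s x) := by
  unfold zF
  by_cases hx : x = 0
  · simp [hx, zwt_zero]
  · have := zN_pos hx
    have h : ((zN x : ℝ) : ℂ) ≠ 0 := by exact_mod_cast (by linarith : zN x ≠ 0)
    intro s
    exact (differentiableAt_id.neg.const_cpow (Or.inl h)).const_mul _

theorem zH {J : Ideal (𝓞 K)} (hJ : J ≠ ⊥) (n : ℕ) (hn : n ≠ 0) :
    ∃ H : ℂ → ℂ, DifferentiableOn ℂ H {s | 1 - 1 / (finrank ℚ K : ℝ) < s.re} ∧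
    ∀ s : ℂ, 1 < s.re → H s = (1 - (n:ℂ) ^ ((finrank ℚ K : ℂ) * (1 - s))) * ∑' x : J, zF s x.1 := by
  classical
  have : NeZero n := ⟨hn⟩
  have hz := zlat hJ n
  set d := finrank ℚ K with hd
  obtain ⟨r, hr⟩ := hz
  have hd0 : (0:ℝ) < d := zfin
  have hd1 : (1:ℝ) ≤ d := by
    have : 0 < d := by exact_mod_cast hd0
    exact_mod_cast this
  have hinj1 : ∀ q, Function.Injective (fun y : J => ((n • y + r q : J) : 𝓞 K)) := by
    intro q y y' h
    have := @hr.1 (q, y) (q, y') (Subtype.ext h)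
    exact (Prod.mk.inj this).2
  have hinj0 : Function.Injective (fun y : J => ((n • y : J) : 𝓞 K)) := by
    intro y y' h
    have h2 : (n • y : J) = n • y' := Subtype.ext h
    exact hinj1 (fun _ => 0) (by simp only [h2])
  refine ⟨fun s => ∑ q, ∑' y : J, (zF s ((n • y + r q : J) : 𝓞 K) - zF s ((n • y : J) : 𝓞 K)), ?_, ?_⟩
  · intro s0 hs0
    apply DifferentiableAt.differentiableWithinAt
    simp only [Set.mem_ofPred_eq] at hs0
    have hd2 : 0 ≤ 1 - 1 / (d:ℝ) := by
      rw [sub_nonneg, div_le_one hd0]; exact hd1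
    obtain ⟨σ, hσ1, hσ2⟩ := exists_between hs0
    have : ∀ q, DifferentiableAt ℂ (fun s => ∑' y : J, (zF s ((n • y + r q : J) : 𝓞 K) - zF s ((n • y : J) : 𝓞 K))) s0 := by
      intro q
      let R : ℝ := 1 + ∑ w : InfinitePlace K, w ((r q : 𝓞 K) : K)
      have hR : 0 < R := by
        have : 0 ≤ ∑ w : InfinitePlace K, w ((r q : 𝓞 K) : K) := Finset.sum_nonneg fun _ _ => apply_nonneg _ _
        simp only [R]; linarith
      have hRw : ∀ w : InfinitePlace K, w ((r q : 𝓞 K) : K) ≤ R := by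
        intro w
        have : w ((r q : 𝓞 K) : K) ≤ ∑ w : InfinitePlace K, w ((r q : 𝓞 K) : K) :=
          Finset.single_le_sum (f := fun w : InfinitePlace K => w ((r q : 𝓞 K) : K)) (fun _ _ => apply_nonneg _ _) (Finset.mem_univ w)
        simp only [R]; linarith
      obtain ⟨C, hC0, hC⟩ := zF_diff (K := K) R σ (‖s0‖ + 1) hR (by linarith) (by positivity)
      set τ := σ + 1 / (d:ℝ) with hτ
      have hτ1 : 1 < τ := by simp only [hτ]; linarith
      let U : Set ℂ := {s | σ < s.re} ∩ Metric.ball 0 (‖s0‖ + 1)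
      have hU : IsOpen U := (isOpen_lt continuous_const Complex.continuous_re).inter Metric.isOpen_ball
      have hs0U : s0 ∈ U := ⟨hσ2, by simp⟩
      refine DifferentiableOn.differentiableAt (s := U) ?_ (hU.mem_nhds hs0U)
      refine Complex.differentiableOn_tsum_of_summable_norm
        (u := fun y : J => C * (zg τ ((n • y + r q : J) : 𝓞 K) + zg τ ((n • y : J) : 𝓞 K))) ?_ ?_ hU ?_
      · exact (((zg_summable hτ1).comp_injective (hinj1 q)).add ((zg_summable hτ1).comp_injective hinj0)).mul_left C
      · intro y
        exact ((zF_differentiable _).sub (zF_differentiable _)).differentiableOn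
      · intro y s hs
        have hs1 : σ ≤ s.re := le_of_lt hs.1
        have hs2 : ‖s‖ ≤ ‖s0‖ + 1 := by have := hs.2; simp at this; exact this.le
        have g1 := zg_nonneg τ ((n • y + r q : J) : 𝓞 K)
        have g2 := zg_nonneg τ ((n • y : J) : 𝓞 K)
        by_cases h1 : zwt ((n • y : J) : 𝓞 K) = 0
        · by_cases h2 : zwt ((n • y + r q : J) : 𝓞 K) = 0
          · rw [zF_wt h1, zF_wt h2, sub_zero, norm_zero]; positivity
          · rw [norm_sub_rev]
            refine (hC _ ((n • y : J) : 𝓞 K) h2 (fun w => ?_) s hs1 hs2).trans ?_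
            · have : ((n • y : J) : 𝓞 K) - ((n • y + r q : J) : 𝓞 K) = - (r q : 𝓞 K) := by simp
              rw [this]
              have h3 : ((-(r q : 𝓞 K) : 𝓞 K) : K) = -((r q : 𝓞 K) : K) := map_neg (algebraMap (𝓞 K) K) _
              rw [h3]
              exact (w.1.map_neg _).trans_le (hRw w)
            · have : zg τ ((n • y + r q : J) : 𝓞 K) = zN ((n • y + r q : J) : 𝓞 K) ^ (-τ) := by
                unfold zg; rw [if_neg h2]
              rw [← this]; gcongr; linarith
        · refine (hC _ ((n • y + r q : J) : 𝓞 K) h1 (fun w => ?_) s hs1 hs2).trans ?_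
          · have : ((n • y + r q : J) : 𝓞 K) - ((n • y : J) : 𝓞 K) = (r q : 𝓞 K) := by simp
            rw [this]
            simpa using hRw w
          · have : zg τ ((n • y : J) : 𝓞 K) = zN ((n • y : J) : 𝓞 K) ^ (-τ) := by
              unfold zg; rw [if_neg h1]
            rw [← this]; gcongr; linarith
    exact DifferentiableAt.fun_sum fun q _ => this q
  · intro s hs
    have S1 : ∀ q, Summable (fun y : J => zF s ((n • y + r q : J) : 𝓞 K)) := fun q => (zF_summable hs).comp_injective (hinj1 q)
    have S0 : Summable (fun y : J => zF s ((n • y : J) : 𝓞 K)) := (zF_summable hs).comp_injective hinj0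
    have SJ : Summable (fun y : J => zF s (y : 𝓞 K)) := (zF_summable hs).comp_injective Subtype.val_injective
    have e1 : ∀ y : J, zF s ((n • y : J) : 𝓞 K) = (n:ℂ) ^ (-(d:ℂ) * s) * zF s (y : 𝓞 K) := by
      intro y
      have : ((n • y : J) : 𝓞 K) = (n : 𝓞 K) * y := by simp
      rw [this]
      unfold zF
      rw [zN_nat_mul, zwt_nat_mul n hn, ← hd, Complex.ofReal_mul, Complex.mul_cpow_ofReal_nonneg (by positivity) (by unfold zN; positivity)]
      have : (((n:ℝ) ^ d : ℝ) : ℂ) ^ (-s) = (n:ℂ) ^ (-(d:ℂ) * s) := by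
        push_cast
        rw [← Complex.natCast_cpow_natCast_mul]
        congr 1; ring
      rw [this]; ring
    have e2 : ∑ q, ∑' y : J, zF s ((n • y + r q : J) : 𝓞 K) = ∑' y : J, zF s (y : 𝓞 K) := by
      rw [← (Equiv.ofBijective _ hr).tsum_eq, ← tsum_fintype (L := .unconditional _)]
      exact (Summable.tsum_prod ((Equiv.ofBijective _ hr).summable_iff.2 SJ)).symm
    simp only
    simp_rw [fun q => Summable.tsum_sub (S1 q) S0]
    rw [Finset.sum_sub_distrib, e2]
    simp_rw [e1]
    rw [tsum_mul_left]
    simp only [Finset.sum_const, Finset.card_univ, Fintype.card_pi, Fintype.card_fin, Finset.prod_const, nsmul_eq_mul]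
    have : (n:ℂ) ^ ((d:ℂ) * (1 - s)) = (n:ℂ) ^ d * (n:ℂ) ^ (-(d:ℂ) * s) := by
      rw [← Complex.cpow_natCast, ← Complex.cpow_add _ _ (by exact_mod_cast hn)]
      congr 1; ring
    rw [this]; push_cast; ring

theorem zHK (K : Type*) [Field K] [NumberField K] (n : ℕ) (hn : n ≠ 0) :
    ∃ H : ℂ → ℂ, DifferentiableOn ℂ H {s | 1 - 1 / (finrank ℚ K : ℝ) < s.re} ∧
    ∀ s : ℂ, 1 < s.re → H s = (1 - (n:ℂ) ^ ((finrank ℚ K : ℂ) * (1 - s))) * dedekindZeta K s := by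
  obtain ⟨J, hJ, hJ2⟩ := zclass (K := K)
  choose H hH1 hH2 using fun c => zH (hJ c) n hn
  have hw : (torsionOrder K : ℂ) ≠ 0 := by
    have : 0 < torsionOrder K := torsionOrder_pos K
    exact_mod_cast this.ne'
  refine ⟨fun s => (torsionOrder K : ℂ)⁻¹ * ∑ c, (Ideal.absNorm (J c) : ℂ) ^ s * H c s, ?_, ?_⟩
  · refine DifferentiableOn.const_mul ?_ _
    refine DifferentiableOn.fun_sum fun c _ => DifferentiableOn.mul ?_ (hH1 c)
    intro s _
    refine (differentiableAt_id.const_cpow (Or.inl ?_)).differentiableWithinAt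
    simpa [Ideal.absNorm_eq_zero_iff] using hJ c
  · intro s hs
    simp only
    simp_rw [fun c => hH2 c s hs]
    have : ∀ c, (Ideal.absNorm (J c) : ℂ) ^ s * ((1 - (n:ℂ) ^ ((finrank ℚ K : ℂ) * (1 - s))) * ∑' x : J c, zF s x.1) =
      (1 - (n:ℂ) ^ ((finrank ℚ K : ℂ) * (1 - s))) * ((Ideal.absNorm (J c) : ℂ) ^ s * ∑' x : J c, zF s x.1) := fun c => by ring
    simp_rw [this]
    rw [← Finset.mul_sum, hJ2 s hs]
    field_simp
end
end

section
open NumberField Filter Topology Module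

noncomputable section

theorem z23 {k m : ℤ} (hk : k ≠ 0) (h : (k:ℝ) * Real.log 3 = m * Real.log 2) : False := by
  have h2 : 0 < Real.log 2 := Real.log_pos (by norm_num)
  have h3 : 0 < Real.log 3 := Real.log_pos (by norm_num)
  have h4 : (k.natAbs:ℝ) * Real.log 3 = m.natAbs * Real.log 2 := by
    have := congrArg abs h
    rw [abs_mul, abs_mul, abs_of_pos h2, abs_of_pos h3] at this
    simpa [Nat.cast_natAbs] using this
  rw [← Real.log_pow, ← Real.log_pow] at h4
  have h5 : (3:ℝ) ^ k.natAbs = 2 ^ m.natAbs := Real.log_injOn_pos (by simp) (by simp) h4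
  have h6 : 3 ^ k.natAbs = 2 ^ m.natAbs := by exact_mod_cast h5
  have h7 : ¬ Even (3 ^ k.natAbs) := by simp [Nat.even_pow]; intro h; exact absurd h (by decide)
  have h8 : m.natAbs = 0 := by
    by_contra h0
    apply h7; rw [h6]; simp [Nat.even_pow]; omega
  rw [h8] at h6
  have : 1 < 3 ^ k.natAbs := Nat.one_lt_pow (by omega) (by norm_num)
  omega

theorem zlocal (K : Type*) [Field K] [NumberField K] (t : ℝ) :
    ∃ h : ℂ → ℂ, AnalyticAt ℂ h (1 + t * Complex.I) ∧
      ∀ᶠ s in 𝓝 (1 + t * Complex.I), 1 < s.re → h s = (s - 1) * dedekindZeta K s := by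
  set d := finrank ℚ K with hd
  have hd0 : (0:ℝ) < d := zfin
  have hdc : (d:ℂ) ≠ 0 := by exact_mod_cast hd0.ne'
  have hopen : IsOpen {s : ℂ | 1 - 1 / (d : ℝ) < s.re} := isOpen_lt continuous_const Complex.continuous_re
  have hmem : (1 + t * Complex.I : ℂ) ∈ {s : ℂ | 1 - 1 / (d : ℝ) < s.re} := by
    have : 0 < 1 / (d:ℝ) := by positivity
    simp
    exact_mod_cast hd0
  have gdiff : ∀ n : ℕ, n ≠ 0 → Differentiable ℂ (fun s : ℂ => 1 - (n:ℂ) ^ ((d:ℂ) * (1 - s))) := by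
    intro n hn s
    refine (differentiableAt_const _).sub (DifferentiableAt.const_cpow (by fun_prop) (Or.inl (by exact_mod_cast hn)))
  have key : ∀ n : ℕ, n ≠ 0 → (1 - (n:ℂ) ^ ((d:ℂ) * (1 - (1 + t * Complex.I))) ≠ 0) → ∃ h : ℂ → ℂ, AnalyticAt ℂ h (1 + t * Complex.I) ∧
      ∀ᶠ s in 𝓝 (1 + t * Complex.I), 1 < s.re → h s = (s - 1) * dedekindZeta K s := by
    intro n hn hne
    obtain ⟨H, hH1, hH2⟩ := zHK K n hn
    have hHa : AnalyticAt ℂ H (1 + t * Complex.I) := hH1.analyticAt (hopen.mem_nhds hmem)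
    have hga := (gdiff n hn).analyticAt (1 + t * Complex.I)
    refine ⟨fun s => (s - 1) * H s / (1 - (n:ℂ) ^ ((d:ℂ) * (1 - s))), ((analyticAt_id.sub analyticAt_const).mul hHa).div hga hne, ?_⟩
    filter_upwards [hga.continuousAt.eventually_ne hne] with s hs1 hs2
    rw [hH2 s hs2, ← hd]
    field_simp
  have hzero : ∀ n : ℕ, n ≠ 0 → 1 - (n:ℂ) ^ ((d:ℂ) * (1 - (1 + t * Complex.I))) = 0 → ∃ k : ℤ, (d * t * Real.log n : ℝ) = k * (2 * Real.pi) := by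
    intro n hn h0
    have h1 : (n:ℂ) ^ ((d:ℂ) * (1 - (1 + t * Complex.I))) = 1 := (sub_eq_zero.1 h0).symm
    rw [Complex.cpow_def_of_ne_zero (by exact_mod_cast hn), Complex.exp_eq_one_iff] at h1
    obtain ⟨k, hk⟩ := h1
    refine ⟨-k, ?_⟩
    rw [← Complex.natCast_log] at hk
    have := congrArg Complex.im hk
    simp [-Complex.natCast_log] at this
    push_cast
    linarith
  by_cases ht : t = 0
  · subst ht
    obtain ⟨H, hH1, hH2⟩ := zHK K 2 (by norm_num)
    have hHa : AnalyticAt ℂ H 1 := hH1.analyticAt (hopen.mem_nhds (by simpa using hmem))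
    simp only [Complex.ofReal_zero, zero_mul, add_zero]
    set g : ℂ → ℂ := fun s => 1 - ((2:ℕ):ℂ) ^ ((d:ℂ) * (1 - s)) with hg
    have hgd : Differentiable ℂ g := gdiff 2 (by norm_num)
    have hD : HasDerivAt g (d * Complex.log 2) 1 := by
      have h1 : HasDerivAt (fun s : ℂ => (d:ℂ) * (1 - s)) (-d) 1 := by
        simpa using ((hasDerivAt_id (1:ℂ)).const_sub 1).const_mul (d:ℂ)
      have h2 := (h1.const_cpow (c := ((2:ℕ):ℂ)) (Or.inl (by norm_num))).const_sub 1
      have h3 : (-(((2:ℕ):ℂ) ^ ((d:ℂ) * (1 - 1)) * Complex.log ((2:ℕ):ℂ) * -(d:ℂ))) = d * Complex.log 2 := by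
        have : ((2:ℕ):ℂ) = 2 := by norm_num
        rw [this, sub_self, mul_zero, Complex.cpow_zero]
        ring
      rw [h3] at h2
      exact h2
    have hds : Differentiable ℂ (dslope g 1) := by
      rw [← differentiableOn_univ]
      exact (Complex.differentiableOn_dslope (Filter.univ_mem)).2 hgd.differentiableOn
    have hne : dslope g 1 1 ≠ 0 := by
      rw [dslope_same, hD.deriv]
      refine mul_ne_zero hdc ?_
      have : Complex.log 2 = ((Real.log 2 : ℝ) : ℂ) := by
        have := Complex.natCast_log (n := 2)
        push_cast at this
        exact this.symm
      rw [this]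
      exact_mod_cast (Real.log_pos (by norm_num : (1:ℝ) < 2)).ne'
    have hda := hds.analyticAt 1
    refine ⟨fun s => H s / dslope g 1 s, hHa.div hda hne, ?_⟩
    filter_upwards [hda.continuousAt.eventually_ne hne] with s hs1 hs2
    rw [hH2 s hs2, ← hd]
    have : (1 - ((2:ℕ):ℂ) ^ ((d:ℂ) * (1 - s))) = (s - 1) * dslope g 1 s := by
      have := sub_smul_dslope g 1 s
      rw [smul_eq_mul] at this
      rw [this]
      simp [hg]
    rw [this]
    field_simp
  · by_cases h2 : 1 - ((2:ℕ):ℂ) ^ ((d:ℂ) * (1 - (1 + t * Complex.I))) = 0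
    · by_cases h3 : 1 - ((3:ℕ):ℂ) ^ ((d:ℂ) * (1 - (1 + t * Complex.I))) = 0
      · exfalso
        obtain ⟨k, hk⟩ := hzero 2 (by norm_num) h2
        obtain ⟨m, hm⟩ := hzero 3 (by norm_num) h3
        have l2 : 0 < Real.log 2 := Real.log_pos (by norm_num)
        have hdt : (d:ℝ) * t ≠ 0 := mul_ne_zero hd0.ne' ht
        push_cast at hk hm
        have hk0 : k ≠ 0 := by
          rintro rfl
          simp at hk
          rcases hk with h | h
          · exact hdt (by rcases h with h | h <;> simp [h])
          · linarith
        refine z23 (k := k) (m := m) hk0 ?_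
        have h5 : (2 * Real.pi) * ((k:ℝ) * Real.log 3 - m * Real.log 2) = 0 := by
          have e1 : (2 * Real.pi) * ((k:ℝ) * Real.log 3 - m * Real.log 2) = (k * (2 * Real.pi)) * Real.log 3 - (m * (2 * Real.pi)) * Real.log 2 := by ring
          rw [e1, ← hk, ← hm]; ring
        have hp : (2 * Real.pi) ≠ 0 := by positivity
        have := (mul_eq_zero.1 h5).resolve_left hp
        linarith
      · exact key 3 (by norm_num) h3
    · exact key 2 (by norm_num) h2
end
end

section
open NumberField Filter Topology Module

noncomputable section
variable {K : Type*} [Field K] [NumberField K]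

open Classical in
def vg (P : Ideal (𝓞 K)) : ℝ := if Prime P then Real.log (Ideal.absNorm P) else 0

theorem vg_nonneg (P : Ideal (𝓞 K)) : 0 ≤ vg P := by
  unfold vg; split_ifs
  · exact Real.log_natCast_nonneg _
  · rfl

def vN (i : Ideal (𝓞 K) × ℕ) : ℕ := Ideal.absNorm i.1 ^ (i.2 + 1)

variable (K) in
def vL (n : ℕ) : ℝ := ∑' i : {i : Ideal (𝓞 K) × ℕ // vN i = n}, vg i.1.1

open Classical in
theorem vlog {I : Ideal (𝓞 K)} (hI : I ≠ ⊥) :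
    HasSum (fun i : Ideal (𝓞 K) × ℕ => if i.1 ^ (i.2 + 1) ∣ I then vg i.1 else 0) (Real.log (Ideal.absNorm I)) := by
  let M := UniqueFactorizationMonoid.normalizedFactors I
  have hM : M.prod = I := by
    have := UniqueFactorizationMonoid.prod_normalizedFactors hI
    exact associated_iff_eq.1 this
  let S : Finset (Σ _ : Ideal (𝓞 K), ℕ) := M.toFinset.sigma (fun P => Finset.range (M.count P))
  let S' : Finset (Ideal (𝓞 K) × ℕ) := S.map (Equiv.sigmaEquivProd _ _).toEmbedding
  have hdvd : ∀ P : Ideal (𝓞 K), Prime P → ∀ k, (P ^ (k+1) ∣ I ↔ k < M.count P) := by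
    intro P hP k
    rw [pow_dvd_iff_le_emultiplicity,
      UniqueFactorizationMonoid.emultiplicity_eq_count_normalizedFactors hP.irreducible hI, normalize_eq]
    norm_cast
  have hsum : ∑ i ∈ S', (if i.1 ^ (i.2 + 1) ∣ I then vg i.1 else 0) = Real.log (Ideal.absNorm I) := by
    rw [Finset.sum_map, Finset.sum_sigma]
    have h1 : ∀ P ∈ M.toFinset, ∑ k ∈ Finset.range (M.count P), (if P ^ (k + 1) ∣ I then vg P else 0) = M.count P • Real.log (Ideal.absNorm P) := by
      intro P hP
      have hP' : Prime P := UniqueFactorizationMonoid.prime_of_normalized_factor P (Multiset.mem_toFinset.1 hP)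
      rw [Finset.sum_congr rfl (g := fun _ => Real.log (Ideal.absNorm P))]
      · simp
      · intro k hk
        rw [if_pos ((hdvd P hP' k).2 (Finset.mem_range.1 hk))]
        simp [vg, hP']
    refine (Finset.sum_congr rfl h1).trans ?_
    rw [← Finset.sum_multiset_map_count]
    conv_rhs => rw [← hM]
    rw [map_multiset_prod, Nat.cast_multiset_prod, Real.log_multiset_prod]
    · simp
    · intro x hx
      simp only [Multiset.mem_map] at hx
      obtain ⟨y, ⟨P, hP, rfl⟩, rfl⟩ := hx
      have hP' : Prime P := UniqueFactorizationMonoid.prime_of_normalized_factor P hP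
      simpa [Ideal.absNorm_eq_zero_iff] using hP'.ne_zero
  rw [← hsum]
  apply hasSum_sum_of_ne_finset_zero
  rintro ⟨P, k⟩ hPk
  by_cases hP : Prime P
  · rw [if_neg]
    intro h
    apply hPk
    have h1 := (hdvd P hP k).1 h
    simp only [S', S, Finset.mem_map, Finset.mem_sigma, Multiset.mem_toFinset, Finset.mem_range]
    refine ⟨⟨P, k⟩, ⟨?_, h1⟩, rfl⟩
    exact Multiset.count_pos.1 (lt_of_le_of_lt (Nat.zero_le k) h1)
  · simp [vg, hP]

open Classical in
theorem vL_finset (n : ℕ) (T : Finset {i : Ideal (𝓞 K) × ℕ // vN i = n}) :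
    ∑ i ∈ T, vg i.1.1 ≤ finrank ℚ K * ArithmeticFunction.vonMangoldt n := by
  let T' := T.filter (fun i => Prime i.1.1)
  have h0 : ∑ i ∈ T, vg i.1.1 = ∑ i ∈ T', Real.log (Ideal.absNorm i.1.1) := by
    rw [Finset.sum_filter]
    rfl
  rw [h0]
  rcases T'.eq_empty_or_nonempty with h | ⟨i0, hi0⟩
  · rw [h, Finset.sum_empty]
    exact mul_nonneg (by positivity) ArithmeticFunction.vonMangoldt_nonneg
  have hp0 : Prime i0.1.1 := (Finset.mem_filter.1 hi0).2
  -- residue field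
  obtain ⟨p, a, hp, ha, hn⟩ : ∃ p a : ℕ, p.Prime ∧ a ≠ 0 ∧ n = p ^ a := by
    have hmax : i0.1.1.IsMaximal := (Ideal.isPrime_of_prime hp0).isMaximal hp0.ne_zero
    let := Ideal.Quotient.field i0.1.1
    have : Finite (𝓞 K ⧸ i0.1.1) := Ideal.finiteQuotientOfFreeOfNeBot _ hp0.ne_zero
    let := Fintype.ofFinite (𝓞 K ⧸ i0.1.1)
    obtain ⟨p, _, m, hp, hm⟩ := FiniteField.card' (𝓞 K ⧸ i0.1.1)
    refine ⟨p, m * (i0.1.2 + 1), hp, by positivity, ?_⟩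
    refine i0.2.symm.trans ?_
    rw [vN, pow_mul, ← hm, ← Nat.card_eq_fintype_card]
    rfl
  have hmem : ∀ i ∈ T', i.1.1 ∣ Ideal.span {(p : 𝓞 K)} := by
    intro i hi
    have hPi : Prime i.1.1 := (Finset.mem_filter.1 hi).2
    have := Ideal.isPrime_of_prime hPi
    rw [Ideal.dvd_span_singleton]
    apply this.mem_of_pow_mem a
    have h2 := Ideal.absNorm_mem i.1.1
    have h3 : ((p ^ a : ℕ) : 𝓞 K) = ((Ideal.absNorm i.1.1 ^ (i.1.2 + 1) : ℕ) : 𝓞 K) :=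
      congrArg _ (hn.symm.trans i.2.symm)
    push_cast at h3
    rw [h3]
    exact Ideal.pow_mem_of_mem _ h2 _ (by omega)
  have hinj : Set.InjOn (fun i : {i : Ideal (𝓞 K) × ℕ // vN i = n} => i.1.1) T' := by
    rintro ⟨⟨P, k⟩, hi⟩ hiT ⟨⟨Q, l⟩, hj⟩ hjT h
    simp only at h
    subst h
    have hPi : Prime P := (Finset.mem_filter.1 hiT).2
    have h2 : 1 < Ideal.absNorm P := by
      have h3 : Ideal.absNorm P ≠ 0 := by simpa [Ideal.absNorm_eq_zero_iff] using hPi.ne_zero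
      have h4 : Ideal.absNorm P ≠ 1 := by
        rw [Ne, Ideal.absNorm_eq_one_iff]; exact (Ideal.isPrime_of_prime hPi).ne_top
      omega
    have h5 : Ideal.absNorm P ^ (k+1) = Ideal.absNorm P ^ (l+1) := hi.trans hj.symm
    have h6 := Nat.pow_right_injective h2 h5
    simp only [add_left_inj] at h6
    subst h6; rfl
  have hprod : (∏ P ∈ T'.image (fun i => i.1.1), P) ∣ Ideal.span {(p : 𝓞 K)} := by
    apply Finset.prod_dvd_of_coprime
    · intro P hP Q hQ hPQ
      simp only [Finset.coe_image, Set.mem_image] at hP hQ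
      obtain ⟨i, hi, rfl⟩ := hP
      obtain ⟨j, hj, rfl⟩ := hQ
      have hPi : Prime i.1.1 := (Finset.mem_filter.1 hi).2
      have hPj : Prime j.1.1 := (Finset.mem_filter.1 hj).2
      have m1 := (Ideal.isPrime_of_prime hPi).isMaximal hPi.ne_zero
      have m2 := (Ideal.isPrime_of_prime hPj).isMaximal hPj.ne_zero
      exact Ideal.isCoprime_of_isMaximal hPQ
    · intro P hP
      obtain ⟨i, hi, rfl⟩ := Finset.mem_image.1 hP
      exact hmem i hi
  have hN := map_dvd Ideal.absNorm hprod
  rw [Ideal.absNorm_span_natCast, RingOfIntegers.rank, map_prod] at hN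
  have hle := Nat.le_of_dvd (by have := hp.pos; positivity) hN
  have hL : ArithmeticFunction.vonMangoldt n = Real.log p := by
    rw [hn, ArithmeticFunction.vonMangoldt_apply_pow ha, ArithmeticFunction.vonMangoldt_apply_prime hp]
  rw [hL, ← Real.log_pow]
  rw [← Finset.sum_image (f := fun P : Ideal (𝓞 K) => Real.log (Ideal.absNorm P)) hinj, ← Real.log_prod]
  · apply Real.log_le_log
    · apply Finset.prod_pos
      intro P hP
      obtain ⟨i, hi, rfl⟩ := Finset.mem_image.1 hP
      have hPi : Prime i.1.1 := (Finset.mem_filter.1 hi).2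
      have h3 : Ideal.absNorm i.1.1 ≠ 0 := by simpa [Ideal.absNorm_eq_zero_iff] using hPi.ne_zero
      exact_mod_cast Nat.pos_of_ne_zero h3
    · exact_mod_cast hle
  · intro P hP
    obtain ⟨i, hi, rfl⟩ := Finset.mem_image.1 hP
    have hPi : Prime i.1.1 := (Finset.mem_filter.1 hi).2
    simpa [Ideal.absNorm_eq_zero_iff] using hPi.ne_zero

theorem vL_fib (n : ℕ) : Summable (fun i : {i : Ideal (𝓞 K) × ℕ // vN i = n} => vg i.1.1) :=
  summable_of_sum_le (fun _ => vg_nonneg _) (vL_finset n)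

theorem vL_nonneg (n : ℕ) : 0 ≤ vL K n := tsum_nonneg fun _ => vg_nonneg _

theorem vL_le (n : ℕ) : vL K n ≤ finrank ℚ K * ArithmeticFunction.vonMangoldt n :=
  Real.tsum_le_of_sum_le (fun _ => vg_nonneg _) (vL_finset n)

theorem vL_lsum {s : ℂ} (hs : 1 < s.re) : LSeriesSummable (fun n => (vL K n : ℂ)) s := by
  have h1 := (ArithmeticFunction.LSeriesSummable_vonMangoldt hs).norm.mul_left (finrank ℚ K : ℝ)
  refine Summable.of_norm_bounded h1 fun n => ?_
  rw [LSeries.norm_term_eq, LSeries.norm_term_eq]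
  split_ifs
  · simp
  · rw [← mul_div_assoc]
    gcongr
    rw [Complex.norm_real, Complex.norm_real, Real.norm_of_nonneg (vL_nonneg n), Real.norm_of_nonneg ArithmeticFunction.vonMangoldt_nonneg]
    exact vL_le n

theorem v_summable {σ : ℝ} (hσ : 1 < σ) : Summable (fun i : Ideal (𝓞 K) × ℕ => vg i.1 * (vN i : ℝ) ^ (-σ)) := by
  refine zregroup_summable vN (fun i => vg i.1) (fun _ => vg_nonneg _) (fun n _ => vL_fib n) σ (by linarith) ?_
  exact vL_lsum (K := K) (s := σ) (by simpa using hσ)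
end
end

section
open NumberField Filter Topology Module

noncomputable section
variable {K : Type*} [Field K] [NumberField K]

theorem zabs : LSeries.abscissaOfAbsConv (fun n ↦ (Nat.card {I : Ideal (𝓞 K) // Ideal.absNorm I = n} : ℂ)) ≤ 1 := by
  refine LSeries.abscissaOfAbsConv_le_of_forall_lt_LSeriesSummable fun y hy => ?_
  exact zideal_lsummable K (by simpa using hy)

theorem zabs_lt {s : ℂ} (hs : 1 < s.re) : LSeries.abscissaOfAbsConv (fun n ↦ (Nat.card {I : Ideal (𝓞 K) // Ideal.absNorm I = n} : ℂ)) < s.re :=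
  lt_of_le_of_lt zabs (by exact_mod_cast hs)

theorem vlogN_coef (n : ℕ) : ∑' I : {I : Ideal (𝓞 K) // Ideal.absNorm I = n}, ((Real.log (Ideal.absNorm I.1) : ℝ) : ℂ) =
    LSeries.logMul (fun n ↦ (Nat.card {I : Ideal (𝓞 K) // Ideal.absNorm I = n} : ℂ)) n := by
  have : ∀ I : {I : Ideal (𝓞 K) // Ideal.absNorm I = n}, ((Real.log (Ideal.absNorm I.1) : ℝ) : ℂ) = ((Real.log n : ℝ) : ℂ) := by
    intro I; rw [I.2]
  simp_rw [this]
  rw [tsum_const, LSeries.logMul]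
  simp [mul_comm]

theorem vlogN_summable {σ : ℝ} (hσ : 1 < σ) :
    Summable (fun I : Ideal (𝓞 K) => Real.log (Ideal.absNorm I) * (Ideal.absNorm I : ℝ) ^ (-σ)) := by
  refine zregroup_summable (fun I => Ideal.absNorm I) (fun I => Real.log (Ideal.absNorm I)) (fun _ => Real.log_natCast_nonneg _)
    (fun n _ => ?_) σ (by linarith) ?_
  · have : Finite {I : Ideal (𝓞 K) // Ideal.absNorm I = n} := Ideal.finite_setOfPred_absNorm_eq n
    exact Summable.of_finite
  · have h1 := LSeriesSummable_logMul_of_lt_re (zabs_lt (K := K) (s := σ) (by simpa using hσ))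
    have h2 : (fun n => ((∑' I : {I : Ideal (𝓞 K) // Ideal.absNorm I = n}, Real.log (Ideal.absNorm I.1) : ℝ) : ℂ)) =
      LSeries.logMul (fun n ↦ (Nat.card {I : Ideal (𝓞 K) // Ideal.absNorm I = n} : ℂ)) := by
      ext n
      rw [← vlogN_coef, Complex.ofReal_tsum]
    rw [h2]
    exact h1

theorem vnorm {a : ℝ} (ha : 0 ≤ a) {n : ℕ} {s : ℂ} (hs : 1 < s.re) : ‖(a:ℂ) * (n:ℂ) ^ (-s)‖ = a * (n:ℝ) ^ (-s.re) := by
  rw [norm_mul, Complex.norm_real, Real.norm_of_nonneg ha]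
  congr 1
  by_cases hn : n = 0
  · subst hn
    have h1 : s ≠ 0 := by rintro rfl; simp at hs; linarith
    simp [h1, Real.zero_rpow (show -s.re ≠ 0 by linarith)]
  · rw [Complex.norm_natCast_cpow_of_pos (Nat.pos_of_ne_zero hn)]; simp

theorem zderiv {s : ℂ} (hs : 1 < s.re) : HasDerivAt (dedekindZeta K) 
    (-∑' I : Ideal (𝓞 K), ((Real.log (Ideal.absNorm I) : ℝ) : ℂ) * (Ideal.absNorm I : ℂ) ^ (-s)) s := by
  have h := LSeries_hasDerivAt (zabs_lt (K := K) hs)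
  rw [zregroup (ι := Ideal (𝓞 K)) (fun I => Ideal.absNorm I) (fun I => ((Real.log (Ideal.absNorm I) : ℝ) : ℂ)) s
    (by rintro rfl; simp at hs; linarith)]
  · simp_rw [vlogN_coef]
    exact h
  · refine Summable.of_norm ((vlogN_summable (K := K) hs).congr fun I => ?_)
    rw [vnorm (Real.log_natCast_nonneg _) hs]

open Classical in
theorem vinner {s : ℂ} (hs : 1 < s.re) (P : Ideal (𝓞 K)) (k : ℕ) :
    ∑' I : Ideal (𝓞 K), ((if P ^ (k+1) ∣ I then vg P else 0 : ℝ) : ℂ) * (Ideal.absNorm I : ℂ) ^ (-s) =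
     (vg P : ℂ) * (vN (P, k) : ℂ) ^ (-s) * dedekindZeta K s := by
  by_cases hP : Prime P
  · have hP0 : P ^ (k+1) ≠ 0 := pow_ne_zero _ hP.ne_zero
    have hinj : Function.Injective (fun I : Ideal (𝓞 K) => P ^ (k+1) * I) := fun I I' h => mul_left_cancel₀ hP0 h
    rw [← hinj.tsum_eq, ← zideal_tsum K hs, ← tsum_mul_left]
    · congr 1; ext I
      rw [if_pos (dvd_mul_right _ _), map_mul, map_pow, vN, Nat.cast_mul, Complex.natCast_mul_natCast_cpow, mul_assoc]
    · intro I hI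
      by_contra h
      apply hI
      simp only
      rw [if_neg]
      · simp
      · rintro ⟨J, hJ⟩
        exact h ⟨J, hJ.symm⟩
  · simp [vg, hP]

theorem vmain {s : ℂ} (hs : 1 < s.re) : HasDerivAt (dedekindZeta K) (-(dedekindZeta K s * LSeries (fun n => (vL K n : ℂ)) s)) s := by
  classical
  have hs0 : s ≠ 0 := by rintro rfl; simp at hs; linarith
  convert zderiv (K := K) hs using 2
  have hD : LSeries (fun n => (vL K n : ℂ)) s = ∑' i : Ideal (𝓞 K) × ℕ, (vg i.1 : ℂ) * (vN i : ℂ) ^ (-s) := by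
    rw [zregroup (ι := Ideal (𝓞 K) × ℕ) vN (fun i => (vg i.1 : ℂ)) s hs0]
    · unfold vL; simp_rw [Complex.ofReal_tsum]
    · refine Summable.of_norm ((v_summable (K := K) hs).congr fun i => ?_)
      rw [vnorm (vg_nonneg _) hs]
  let F : Ideal (𝓞 K) → Ideal (𝓞 K) × ℕ → ℂ := fun I i =>
    ((if i.1 ^ (i.2+1) ∣ I then vg i.1 else 0 : ℝ) : ℂ) * (Ideal.absNorm I : ℂ) ^ (-s)
  have hrow : ∀ I, HasSum (fun i => F I i) (((Real.log (Ideal.absNorm I) : ℝ) : ℂ) * (Ideal.absNorm I : ℂ) ^ (-s)) := by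
    intro I
    by_cases hI : I = ⊥
    · subst hI; simp only [F]; simp [hs0]
    · simp only [F]
      refine HasSum.mul_right _ ?_
      exact Complex.hasSum_ofReal.2 (vlog hI)
  have hrowR : ∀ I : Ideal (𝓞 K), HasSum (fun i : Ideal (𝓞 K) × ℕ => (if i.1 ^ (i.2+1) ∣ I then vg i.1 else 0 : ℝ) * (Ideal.absNorm I : ℝ) ^ (-s.re))
     (Real.log (Ideal.absNorm I) * (Ideal.absNorm I : ℝ) ^ (-s.re)) := by
    intro I
    by_cases hI : I = ⊥
    · subst hI; simp [Real.zero_rpow (show -s.re ≠ 0 by linarith)]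
    · exact (vlog hI).mul_right _
  have hFn : ∀ I i, ‖F I i‖ = (if i.1 ^ (i.2+1) ∣ I then vg i.1 else 0 : ℝ) * (Ideal.absNorm I : ℝ) ^ (-s.re) := by
    intro I i
    refine vnorm ?_ hs
    split_ifs
    · exact vg_nonneg _
    · rfl
  have hF : Summable (Function.uncurry F) := by
    refine Summable.of_norm ?_
    rw [summable_prod_of_nonneg (fun _ => norm_nonneg _)]
    simp only [Function.uncurry, hFn]
    refine ⟨fun I => (hrowR I).summable, ?_⟩
    simp_rw [fun I => (hrowR I).tsum_eq]
    exact vlogN_summable hs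
  have hcomm := Summable.tsum_comm hF
  simp_rw [fun I => (hrow I).tsum_eq] at hcomm
  rw [← hcomm, hD, mul_comm, ← tsum_mul_right]
  congr 1; ext i
  exact (vinner hs i.1 i.2).symm
end
end

section
open NumberField Filter Topology Module

noncomputable section
variable {K : Type*} [Field K] [NumberField K]

variable (K) in
def vD (s : ℂ) : ℂ := LSeries (fun n => (vL K n : ℂ)) s

theorem zeta_open : IsOpen {s : ℂ | 1 < s.re} := isOpen_lt continuous_const Complex.continuous_re

theorem zeta_not_locally_zero {s₁ : ℂ} (h1 : 1 < s₁.re) (h : ∀ᶠ s in 𝓝 s₁, dedekindZeta K s = 0) : False := by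
  have hd : DifferentiableOn ℂ (dedekindZeta K) {s | 1 < s.re} := fun s hs =>
    (vmain hs).differentiableAt.differentiableWithinAt
  have ha := hd.analyticOnNhd zeta_open
  have hc : IsPreconnected {s : ℂ | 1 < s.re} := (convex_halfSpace_re_gt 1).isPreconnected
  have h2 := ha.eqOn_zero_of_preconnected_of_eventuallyEq_zero hc h1 h
  have h3 := tendsto_sub_one_mul_dedekindZeta_nhdsGT K
  have h4 : Tendsto (fun s : ℝ ↦ ((s:ℂ) - 1) * dedekindZeta K s) (𝓝[>] 1) (𝓝 0) := by
    refine Tendsto.congr' ?_ tendsto_const_nhds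
    filter_upwards [self_mem_nhdsWithin] with s hs
    rw [h2 (show (1:ℝ) < (s:ℂ).re by simpa using hs)]
    simp
  have h5 := tendsto_nhds_unique h3 h4
  exact dedekindZeta_residue_ne_zero K (by exact_mod_cast h5)

theorem vre (t : ℝ) : (1 + t * Complex.I : ℂ).re = 1 := by simp

theorem vlocal (t : ℝ) {h : ℂ → ℂ} (hh : AnalyticAt ℂ h (1 + t * Complex.I))
    (heq : ∀ᶠ s in 𝓝 (1 + t * Complex.I), 1 < s.re → h s = (s - 1) * dedekindZeta K s) :
    ∃ n : ℕ, ∃ r : ℂ → ℂ, (h (1 + t * Complex.I) ≠ 0 → n = 0) ∧ ContinuousAt r (1 + t * Complex.I) ∧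
     ∀ᶠ s in 𝓝 (1 + t * Complex.I), 1 < s.re → vD K s = 1 / (s - 1) - n / (s - (1 + t * Complex.I)) - r s := by
  set s₀ : ℂ := 1 + t * Complex.I with hs₀
  have hre : s₀.re = 1 := vre t
  have hnz : ¬ ∀ᶠ z in 𝓝 s₀, h z = 0 := by
    intro h0
    have h1 : ∀ᶠ s in 𝓝 s₀, 1 < s.re → dedekindZeta K s = 0 := by
      filter_upwards [h0, heq] with s a b c
      have := b c
      rw [a] at this
      have h2 : s - 1 ≠ 0 := by intro h; rw [sub_eq_zero.1 h] at c; simp at c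
      exact (mul_eq_zero.1 this.symm).resolve_left h2
    obtain ⟨ε, hε, hball⟩ := Metric.eventually_nhds_iff_ball.1 h1
    refine zeta_not_locally_zero (K := K) (s₁ := s₀ + ((ε/2 : ℝ) : ℂ)) (by rw [Complex.add_re, hre, Complex.ofReal_re]; linarith) ?_
    have m1 : s₀ + ((ε/2 : ℝ) : ℂ) ∈ Metric.ball s₀ ε := by
      rw [Metric.mem_ball, dist_eq_norm, add_sub_cancel_left, Complex.norm_real, Real.norm_of_nonneg (by linarith)]; linarith
    filter_upwards [Metric.isOpen_ball.mem_nhds m1, zeta_open.mem_nhds (show 1 < (s₀ + ((ε/2 : ℝ) : ℂ)).re by rw [Complex.add_re, hre, Complex.ofReal_re]; linarith)] with s a b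
    exact hball s a b
  obtain ⟨n, g, hg, hg0, hgh⟩ := hh.exists_eventuallyEq_pow_smul_nonzero_iff.2 hnz
  refine ⟨n, logDeriv g, ?_, ?_, ?_⟩
  · intro h0
    by_contra hn
    have := hgh.self_of_nhds
    rw [sub_self, zero_pow hn, zero_smul] at this
    exact h0 this
  · exact (hg.deriv.div hg hg0).continuousAt
  · have hev : ∀ᶠ s in 𝓝 s₀, (g s ≠ 0 ∧ DifferentiableAt ℂ g s) ∧ (∀ᶠ z in 𝓝 s, h z = (z - s₀) ^ n • g z) ∧ (∀ᶠ z in 𝓝 s, 1 < z.re → h z = (z - 1) * dedekindZeta K z) := by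
      filter_upwards [hg.continuousAt.eventually_ne hg0, hg.eventually_analyticAt, hgh.eventually_nhds, heq.eventually_nhds] with s a b c d
      exact ⟨⟨a, b.differentiableAt⟩, c, d⟩
    filter_upwards [hev] with s ⟨⟨a1, a2⟩, b, c⟩ hs
    have hs1 : s - 1 ≠ 0 := by intro h; rw [sub_eq_zero.1 h] at hs; simp at hs
    have hs2 : s - s₀ ≠ 0 := by intro h; rw [sub_eq_zero.1 h, hre] at hs; exact lt_irrefl _ hs
    have e1 : (fun z => (z - 1) * dedekindZeta K z) =ᶠ[𝓝 s] fun z => (z - s₀) ^ n * g z := by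
      filter_upwards [b, c, zeta_open.mem_nhds hs] with z p q r
      rw [← q r, p, smul_eq_mul]
    have hz : dedekindZeta K s ≠ 0 := by
      intro h0
      have := e1.self_of_nhds
      simp only [h0, mul_zero] at this
      exact mul_ne_zero (pow_ne_zero n hs2) a1 this.symm
    have e2 : logDeriv (fun z => (z - 1) * dedekindZeta K z) s = logDeriv (fun z => (z - s₀) ^ n * g z) s := by
      rw [logDeriv_apply, logDeriv_apply, e1.deriv_eq]
      exact congrArg _ e1.self_of_nhds
    rw [logDeriv_mul s hs1 hz (by fun_prop) (vmain hs).differentiableAt,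
      logDeriv_mul (f := fun z => (z - s₀) ^ n) s (pow_ne_zero n hs2) a1 (by fun_prop) a2, logDeriv_fun_pow (f := fun z => z - s₀) (by fun_prop),
      logDeriv_apply (dedekindZeta K), (vmain hs).deriv, logDeriv_apply (fun z => z - 1), logDeriv_apply (fun z => z - s₀)] at e2
    simp only [deriv_sub_const, deriv_id''] at e2
    have e3 : -(dedekindZeta K s * LSeries (fun n => (vL K n : ℂ)) s) / dedekindZeta K s = - vD K s := by
      unfold vD; field_simp
    rw [e3] at e2
    have e4 : (n:ℂ) / (s - s₀) = n * (1 / (s - s₀)) := by ring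
    rw [e4]
    linear_combination -e2

theorem v341_term (n : ℕ) (σ t : ℝ) : 0 ≤ (3 * LSeries.term (fun n => (vL K n : ℂ)) σ n + 4 * LSeries.term (fun n => (vL K n : ℂ)) (σ + t * Complex.I) n
    + LSeries.term (fun n => (vL K n : ℂ)) (σ + (2 * t : ℝ) * Complex.I) n).re := by
  by_cases hn : n = 0
  · subst hn; simp
  have key : ∀ u : ℝ, (LSeries.term (fun n => (vL K n : ℂ)) (σ + u * Complex.I) n).re = vL K n * ((n:ℝ) ^ (-σ) * Real.cos (u * Real.log n)) := by
    intro u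
    have hn' : (n:ℂ) ≠ 0 := by exact_mod_cast hn
    rw [LSeries.term_of_ne_zero hn, div_eq_mul_inv, ← Complex.cpow_neg, Complex.re_ofReal_mul]
    congr 1
    rw [neg_add, Complex.cpow_add _ _ hn', ← Complex.ofReal_neg, ← Complex.ofReal_natCast, ← Complex.ofReal_cpow (by positivity), Complex.re_ofReal_mul]
    congr 1
    rw [Complex.ofReal_natCast, Complex.cpow_def_of_ne_zero hn', ← Complex.natCast_log]
    have : ((Real.log n : ℝ) : ℂ) * (-(u * Complex.I)) = ((-(u * Real.log n) : ℝ) : ℂ) * Complex.I := by push_cast; ring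
    rw [this, Complex.exp_ofReal_mul_I_re, Real.cos_neg]
  have k0 := key 0
  have k1 := key t
  have k2 := key (2 * t)
  simp only [Complex.ofReal_zero, zero_mul, add_zero, Real.cos_zero, mul_one] at k0
  simp only [Complex.add_re, Complex.mul_re, Complex.re_ofNat, Complex.im_ofNat, zero_mul, sub_zero]
  rw [k0, k1, k2, mul_assoc 2 t, Real.cos_two_mul]
  have h1 : 0 ≤ vL K n * (n:ℝ) ^ (-σ) := mul_nonneg (vL_nonneg n) (by positivity)
  have h2 : 0 ≤ (1 + Real.cos (t * Real.log n)) ^ 2 := sq_nonneg _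
  nlinarith [mul_nonneg h1 h2]

theorem v341 {σ : ℝ} (hσ : 1 < σ) (t : ℝ) : 0 ≤ (3 * vD K σ + 4 * vD K (σ + t * Complex.I) + vD K (σ + (2 * t : ℝ) * Complex.I)).re := by
  have h0 : HasSum _ (vD K σ) := (vL_lsum (K := K) (s := σ) (by simpa using hσ)).hasSum
  have h1 : HasSum _ (vD K (σ + t * Complex.I)) := (vL_lsum (K := K) (s := σ + t * Complex.I) (by simpa using hσ)).hasSum
  have h2 : HasSum _ (vD K (σ + (2 * t : ℝ) * Complex.I)) := (vL_lsum (K := K) (s := σ + (2 * t : ℝ) * Complex.I) (by simpa using hσ)).hasSum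
  have h3 := Complex.hasSum_re (((h0.mul_left 3).add (h1.mul_left 4)).add h2)
  exact h3.nonneg fun n => v341_term n σ t

theorem vtend {t : ℝ} {n : ℕ} {r : ℂ → ℂ} (hr : ContinuousAt r (1 + t * Complex.I))
    (h : ∀ᶠ s in 𝓝 (1 + t * Complex.I), 1 < s.re → vD K s = 1 / (s - 1) - n / (s - (1 + t * Complex.I)) - r s) :
    Tendsto (fun σ : ℝ => ((σ - 1 : ℝ) : ℂ) * vD K (σ + t * Complex.I)) (𝓝[>] 1) (𝓝 ((if t = 0 then 1 else 0) - n)) := by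
  have hpath : Tendsto (fun σ : ℝ => (σ + t * Complex.I : ℂ)) (𝓝[>] 1) (𝓝 (1 + t * Complex.I)) := by
    have : Continuous (fun σ : ℝ => (σ + t * Complex.I : ℂ)) := by fun_prop
    have := this.tendsto 1
    simp only [Complex.ofReal_one] at this
    exact this.mono_left nhdsWithin_le_nhds
  have hx : Tendsto (fun σ : ℝ => ((σ - 1 : ℝ) : ℂ)) (𝓝[>] 1) (𝓝 0) := by
    have : Continuous (fun σ : ℝ => ((σ - 1 : ℝ) : ℂ)) := by fun_prop
    have := this.tendsto 1
    simp only [sub_self, Complex.ofReal_zero] at this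
    exact this.mono_left nhdsWithin_le_nhds
  have h3 : Tendsto (fun σ : ℝ => ((σ - 1 : ℝ) : ℂ) * r (σ + t * Complex.I)) (𝓝[>] 1) (𝓝 0) := by
    simpa using hx.mul (hr.tendsto.comp hpath)
  have h2 : Tendsto (fun σ : ℝ => ((σ - 1 : ℝ) : ℂ) * (1 / (σ + t * Complex.I - 1))) (𝓝[>] 1) (𝓝 (if t = 0 then 1 else 0)) := by
    split_ifs with ht
    · subst ht
      refine Tendsto.congr' ?_ tendsto_const_nhds
      filter_upwards [self_mem_nhdsWithin] with σ hσ
      have : (σ:ℂ) - 1 ≠ 0 := by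
        have : (1:ℝ) < σ := hσ
        exact_mod_cast (by linarith : σ - 1 ≠ 0)
      simp; field_simp
    · have hne : (1 + t * Complex.I - 1 : ℂ) ≠ 0 := by simp [ht]
      have := hx.mul (tendsto_const_nhds (x := (1:ℂ)).div (hpath.sub_const 1) hne)
      simpa using this
  have h4 := (h2.sub (tendsto_const_nhds (x := (n:ℂ)))).sub h3
  rw [sub_zero] at h4
  refine h4.congr' ?_
  filter_upwards [hpath.eventually h, self_mem_nhdsWithin] with σ a hσ
  have hσ' : (1:ℝ) < σ := hσ
  rw [a (by simpa using hσ')]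
  have e : (σ + t * Complex.I - (1 + t * Complex.I) : ℂ) = ((σ - 1 : ℝ) : ℂ) := by push_cast; ring
  rw [e]
  have : ((σ - 1 : ℝ) : ℂ) ≠ 0 := by exact_mod_cast (by linarith : σ - 1 ≠ 0)
  field_simp

theorem vlim (t : ℝ) : ∃ l : ℂ, Tendsto (fun s => vD K s - 1 / (s - 1)) (𝓝[{s | 1 < s.re}] (1 + t * Complex.I)) (𝓝 l) := by
  have key : ∀ u : ℝ, ∃ n : ℕ, ∃ r : ℂ → ℂ, (u = 0 → n = 0) ∧ ContinuousAt r (1 + u * Complex.I) ∧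
     ∀ᶠ s in 𝓝 (1 + u * Complex.I), 1 < s.re → vD K s = 1 / (s - 1) - n / (s - (1 + u * Complex.I)) - r s := by
    intro u
    obtain ⟨h, h1, h2⟩ := zlocal K u
    obtain ⟨n, r, a, b, c⟩ := vlocal u h1 h2
    refine ⟨n, r, fun hu => a ?_, b, c⟩
    subst hu
    have hpath : Tendsto (fun σ : ℝ => (σ : ℂ)) (𝓝[>] 1) (𝓝 (1 + (0:ℝ) * Complex.I)) := by
      have : Continuous (fun σ : ℝ => (σ : ℂ)) := by fun_prop
      have := this.tendsto 1
      simp only [Complex.ofReal_one] at this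
      simpa using this.mono_left nhdsWithin_le_nhds
    have h3 := h1.continuousAt.tendsto.comp hpath
    have h4 : Tendsto (h ∘ fun σ : ℝ => (σ : ℂ)) (𝓝[>] 1) (𝓝 (dedekindZeta_residue K)) := by
      refine (tendsto_sub_one_mul_dedekindZeta_nhdsGT K).congr' ?_
      filter_upwards [hpath.eventually h2, self_mem_nhdsWithin] with σ a hσ
      exact (a (by simpa using hσ)).symm
    rw [tendsto_nhds_unique h3 h4]
    exact_mod_cast dedekindZeta_residue_ne_zero K
  obtain ⟨n, r, hn, hr, h⟩ := key t
  have hn0 : n = 0 := by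
    by_cases ht : t = 0
    · exact hn ht
    obtain ⟨n0, r0, hn0, hr0, h0⟩ := key 0
    obtain ⟨n2, r2, hn2, hr2, h2⟩ := key (2 * t)
    have T0 := vtend hr0 h0
    have T1 := vtend hr h
    have T2 := vtend hr2 h2
    have T := ((T0.const_mul 3).add (T1.const_mul 4)).add T2
    have T' := (Complex.continuous_re.tendsto _).comp T
    have := ge_of_tendsto T' (b := 0) (by
      filter_upwards [self_mem_nhdsWithin] with σ hσ
      have hσ' : (1:ℝ) < σ := hσ
      have h5 := v341 (K := K) hσ' t
      have h6 := mul_nonneg (by linarith : 0 ≤ σ - 1) h5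
      rw [← Complex.re_ofReal_mul] at h6
      refine h6.trans_eq ?_
      simp only [Function.comp]
      congr 1
      simp
      ring)
    rw [hn0 rfl] at this
    simp [ht] at this
    have h7 : (4:ℝ) * n ≤ 3 := by have : (0:ℝ) ≤ n2 := by positivity
                                  linarith
    have : 4 * n ≤ 3 := by exact_mod_cast h7
    omega
  subst hn0
  refine ⟨- r (1 + t * Complex.I), ?_⟩
  have h8 : Tendsto (fun s => - r s) (𝓝[{s | 1 < s.re}] (1 + t * Complex.I)) (𝓝 (- r (1 + t * Complex.I))) :=
    (hr.tendsto.neg).mono_left nhdsWithin_le_nhds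
  refine h8.congr' ?_
  filter_upwards [nhdsWithin_le_nhds h, self_mem_nhdsWithin] with s a b
  rw [a b]; simp

variable (K) in
theorem vpnt : Tendsto (fun x : ℝ => (∑ k ∈ Finset.Icc 1 ⌊x⌋₊, vL K k) / x) atTop (𝓝 1) := by
  refine tauber (vL K) vL_nonneg (finrank ℚ K * (Real.log 4 + 4)) ?_ ?_
  · intro n
    calc _ ≤ ∑ k ∈ Finset.Icc 1 n, (finrank ℚ K : ℝ) * ArithmeticFunction.vonMangoldt k := Finset.sum_le_sum fun k _ => vL_le k
      _ = finrank ℚ K * Chebyshev.psi n := by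
        rw [← Finset.mul_sum, Chebyshev.psi, Nat.floor_natCast]; rfl
      _ ≤ _ := by
        rw [mul_assoc]
        gcongr
        exact Chebyshev.psi_le_const_mul_self (by positivity)
  · exact vlim
end
end

section
open NumberField Filter Topology Module

noncomputable section
variable {K : Type*} [Field K] [NumberField K]

theorem hom_card (ℓ : ℕ) [hℓ : Fact ℓ.Prime] : 
    Nat.card (𝓞 K →+* ZMod ℓ) = Nat.card {P : Ideal (𝓞 K) // Ideal.absNorm P = ℓ} := by
  have hN : ∀ φ : 𝓞 K →+* ZMod ℓ, Ideal.absNorm (RingHom.ker φ) = ℓ := by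
    intro φ
    have hs : Function.Surjective φ := ZMod.ringHom_surjective φ
    rw [Ideal.absNorm_apply, Submodule.cardQuot_apply, Nat.card_congr (RingHom.quotientKerEquivOfSurjective hs).toEquiv]
    simp
  refine Nat.card_congr (Equiv.ofBijective (fun φ => ⟨RingHom.ker φ, hN φ⟩) ⟨?_, ?_⟩)
  · intro φ ψ h
    have hk : RingHom.ker φ = RingHom.ker ψ := congrArg Subtype.val h
    have hs : Function.Surjective φ := ZMod.ringHom_surjective φ
    have hs' : Function.Surjective ψ := ZMod.ringHom_surjective ψ
    let e := RingHom.quotientKerEquivOfSurjective hs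
    let e' := RingHom.quotientKerEquivOfSurjective hs'
    let g : ZMod ℓ →+* ZMod ℓ := (e'.toRingHom.comp (Ideal.quotEquivOfEq hk).toRingHom).comp e.symm.toRingHom
    have hg : g = RingHom.id _ := Subsingleton.elim _ _
    ext x
    have h1 : g (φ x) = ψ x := by
      have : e.symm (φ x) = Ideal.Quotient.mk _ x := by
        rw [RingEquiv.symm_apply_eq]; rfl
      change e' ((Ideal.quotEquivOfEq hk) (e.symm (φ x))) = _
      rw [this]; rfl
    rw [← h1, hg]; rfl
  · rintro ⟨P, hP⟩
    have hc : Nat.card (𝓞 K ⧸ P) = ℓ := by rw [← hP]; rfl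
    have : Finite (𝓞 K ⧸ P) := Nat.finite_of_card_ne_zero (by rw [hc]; exact hℓ.out.ne_zero)
    let := Fintype.ofFinite (𝓞 K ⧸ P)
    rw [Nat.card_eq_fintype_card] at hc
    let e := ZMod.ringEquivOfPrime (𝓞 K ⧸ P) hℓ.out hc
    refine ⟨e.symm.toRingHom.comp (Ideal.Quotient.mk P), Subtype.ext ?_⟩
    simp only
    ext x
    simp [RingHom.mem_ker, Ideal.Quotient.eq_zero_iff_mem]

variable (K) in
def aK (ℓ : ℕ) : ℕ := Nat.card {P : Ideal (𝓞 K) // Ideal.absNorm P = ℓ}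

theorem vL_prime {ℓ : ℕ} (hℓ : ℓ.Prime) : vL K ℓ = aK K ℓ * Real.log ℓ := by
  classical
  have h0 : ∀ i : {i : Ideal (𝓞 K) × ℕ // vN i = ℓ}, i.1.2 = 0 ∧ Ideal.absNorm i.1.1 = ℓ := by
    rintro ⟨⟨P, k⟩, h⟩
    simp only [vN] at h
    have h1 : k + 1 = 1 := by
      rw [← h] at hℓ
      exact Nat.Prime.eq_one_of_pow hℓ
    have hk : k = 0 := by omega
    subst hk
    simpa using h
  have h1 : ∀ i : {i : Ideal (𝓞 K) × ℕ // vN i = ℓ}, vg i.1.1 = Real.log ℓ := by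
    intro i
    have h2 := (h0 i).2
    have hp : i.1.1.IsPrime := Ideal.isPrime_of_irreducible_absNorm (by rw [h2]; exact hℓ)
    have hp' : Prime i.1.1 := by
      refine Ideal.prime_of_isPrime ?_ hp
      intro h; rw [h] at h2; simp at h2; exact hℓ.ne_zero h2.symm
    rw [vg, if_pos hp', h2]
  unfold vL
  simp_rw [h1]
  rw [tsum_const, nsmul_eq_mul]
  congr 2
  refine Nat.card_congr ⟨fun i => ⟨i.1.1, (h0 i).2⟩, fun P => ⟨(P.1, 0), by simp [vN, P.2]⟩, ?_, ?_⟩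
  · rintro ⟨⟨P, k⟩, h⟩
    have := (h0 ⟨⟨P, k⟩, h⟩).1
    simp only at this
    subst this; rfl
  · rintro ⟨P, h⟩; rfl

variable (K) in
theorem theta_K : Tendsto (fun x : ℝ => (∑ p ∈ Finset.Icc 1 ⌊x⌋₊ with p.Prime, aK K p * Real.log p) / x) atTop (𝓝 1) := by
  have h1 := vpnt K
  have h2 : Tendsto (fun x : ℝ => (∑ p ∈ Finset.Icc 1 ⌊x⌋₊ with ¬ p.Prime, vL K p) / x) atTop (𝓝 0) := by
    have h3 : Tendsto (fun x : ℝ => (finrank ℚ K : ℝ) * (2 * (Real.log x / x ^ (1/2:ℝ)))) atTop (𝓝 0) := by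
      have := (isLittleO_log_rpow_atTop (show (0:ℝ) < 1/2 by norm_num)).tendsto_div_nhds_zero
      simpa using (this.const_mul 2).const_mul (finrank ℚ K : ℝ)
    refine tendsto_of_tendsto_of_tendsto_of_le_of_le' tendsto_const_nhds h3 ?_ ?_
    · filter_upwards [eventually_gt_atTop 0] with x hx
      exact div_nonneg (Finset.sum_nonneg fun _ _ => vL_nonneg _) hx.le
    · filter_upwards [eventually_ge_atTop 1] with x hx
      have hx0 : 0 < x := by linarith
      rw [div_le_iff₀ hx0]
      calc _ ≤ ∑ p ∈ Finset.Icc 1 ⌊x⌋₊ with ¬ p.Prime, (finrank ℚ K : ℝ) * ArithmeticFunction.vonMangoldt p := Finset.sum_le_sum fun k _ => vL_le k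
        _ = finrank ℚ K * (Chebyshev.psi x - Chebyshev.theta x) := by
          rw [← Finset.mul_sum, Chebyshev.psi_sub_theta_eq_sum_not_prime]; rfl
        _ ≤ finrank ℚ K * (2 * √x * Real.log x) := by
          gcongr; exact Chebyshev.psi_sub_theta_le hx
        _ = _ := by
          rw [Real.sqrt_eq_rpow]
          have : x ^ (1/2:ℝ) * x ^ (1/2:ℝ) = x := by rw [← Real.rpow_add hx0]; norm_num
          have h4 : x ^ (1/2:ℝ) ≠ 0 := (Real.rpow_pos_of_pos hx0 _).ne'
          field_simp
          have h5 : (x ^ (1/2:ℝ)) ^ 2 = x := by rw [sq, this]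
          rw [h5]
          ring
  have h3 := h1.sub h2
  rw [sub_zero] at h3
  refine h3.congr fun x => ?_
  rw [← sub_div, ← Finset.sum_filter_add_sum_filter_not (Finset.Icc 1 ⌊x⌋₊) (fun p => p.Prime) (vL K), add_sub_cancel_right]
  congr 1
  refine Finset.sum_congr rfl fun p hp => ?_
  exact vL_prime (Finset.mem_filter.1 hp).2
end
end

section
open NumberField Filter Topology Module Polynomial

noncomputable section

theorem tower_m {K L : Type*} [Field K] [NumberField K] [Field L] [NumberField L] [Algebra K L]
    (α : 𝓞 L) (pb : PowerBasis K L) (hpb : pb.gen = (α : L)) :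
    ∃ m : ℕ, m ≠ 0 ∧ ∀ x : 𝓞 L, ∃ p : (𝓞 K)[X], (m : 𝓞 L) * x = aeval α p := by
  have hint : IsIntegral (𝓞 K) pb.gen := by
    rw [hpb]
    exact (RingOfIntegers.isIntegral_coe α).tower_top
  have hd : IsIntegral ℤ (Algebra.discr K pb.basis) := by
    have : IsIntegral (𝓞 K) (Algebra.discr K pb.basis) := by
      apply Algebra.discr_isIntegral
      intro i
      rw [pb.basis_eq_pow]
      exact hint.pow _
    exact isIntegral_trans (R := ℤ) (A := 𝓞 K) _ this
  let d : 𝓞 K := ⟨Algebra.discr K pb.basis, hd⟩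
  have hd0 : d ≠ 0 := by
    intro h
    have : Algebra.discr K pb.basis = 0 := congrArg (fun x : 𝓞 K => (x : K)) h
    exact Algebra.discr_not_zero_of_basis K pb.basis this
  refine ⟨Ideal.absNorm (Ideal.span {d}), ?_, fun x => ?_⟩
  · simpa [Ideal.absNorm_eq_zero_iff] using hd0
  · obtain ⟨e, he⟩ := Ideal.mem_span_singleton'.1 (Ideal.absNorm_mem (Ideal.span {d}))
    have h1 := Algebra.discr_mul_isIntegral_mem_adjoin K hint (z := (x : L)) (RingOfIntegers.isIntegral_coe x).tower_top
    rw [Algebra.adjoin_singleton_eq_range_aeval] at h1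
    obtain ⟨p, hp⟩ := h1
    refine ⟨C e * p, ?_⟩
    apply RingOfIntegers.coe_injective
    have h2 : ((aeval α (C e * p) : 𝓞 L) : L) = algebraMap K L e * aeval pb.gen p := by
      have h3 : ((aeval α (C e * p) : 𝓞 L) : L) = aeval (algebraMap (𝓞 L) L α) (C e * p) := (aeval_algebraMap_apply L α _).symm
      rw [h3, map_mul, aeval_C, hpb]
      rfl
    refine Eq.trans ?_ h2.symm
    have hp' : aeval pb.gen p = Algebra.discr K pb.basis • (x : L) := hp
    rw [hp', Algebra.smul_def, ← mul_assoc, ← map_mul]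
    have h4 : (e : K) * Algebra.discr K pb.basis = ((Ideal.absNorm (Ideal.span {d}) : 𝓞 K) : K) := by
      rw [← he]; rfl
    rw [h4]
    simp

theorem tower_bij {K L : Type*} [Field K] [NumberField K] [Field L] [NumberField L] [Algebra K L]
    (α : 𝓞 L) (pb : PowerBasis K L) (hpb : pb.gen = (α : L)) (h : (𝓞 K)[X]) (hm : h.Monic)
    (hmin : minpoly K (α : L) = h.map (algebraMap (𝓞 K) K)) :
    ∃ m : ℕ, m ≠ 0 ∧ ∀ ℓ : ℕ, ∀ [Fact ℓ.Prime], ¬ ℓ ∣ m → 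
      Nat.card (𝓞 L →+* ZMod ℓ) = Nat.card (Σ φ : 𝓞 K →+* ZMod ℓ, {z : ZMod ℓ // eval₂ φ z h = 0}) := by
  obtain ⟨m, hm0, hP⟩ := tower_m α pb hpb
  refine ⟨m, hm0, fun ℓ _ hℓ => ?_⟩
  choose P hP using hP
  have hmF : (m : ZMod ℓ) ≠ 0 := by rwa [Ne, ZMod.natCast_eq_zero_iff]
  have hroot : aeval α h = 0 := by
    apply RingOfIntegers.coe_injective
    have h3 : ((aeval α h : 𝓞 L) : L) = aeval (algebraMap (𝓞 L) L α) h := (aeval_algebraMap_apply L α _).symm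
    refine h3.trans ?_
    rw [← aeval_map_algebraMap K, ← hmin, map_zero]
    exact minpoly.aeval K (α : L)
  have hdvd : ∀ p : (𝓞 K)[X], aeval α p = 0 → h ∣ p := by
    intro p hp
    rw [← map_dvd_map (algebraMap (𝓞 K) K) RingOfIntegers.coe_injective hm, ← hmin]
    apply minpoly.dvd
    rw [aeval_map_algebraMap]
    have h3 : ((aeval α p : 𝓞 L) : L) = aeval (algebraMap (𝓞 L) L α) p := (aeval_algebraMap_apply L α _).symm
    rw [← h3, hp]; simp
  have hwd : ∀ (φ : 𝓞 K →+* ZMod ℓ) (z : ZMod ℓ), eval₂ φ z h = 0 → ∀ p q : (𝓞 K)[X], aeval α p = aeval α q → eval₂ φ z p = eval₂ φ z q := by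
    intro φ z hz p q hpq
    obtain ⟨r, hr⟩ := hdvd (p - q) (by rw [map_sub, hpq, sub_self])
    have : eval₂ φ z (p - q) = 0 := by rw [hr, eval₂_mul, hz, zero_mul]
    rwa [eval₂_sub, sub_eq_zero] at this
  have hψ : ∀ (ψ : 𝓞 L →+* ZMod ℓ) (p : (𝓞 K)[X]), ψ (aeval α p) = eval₂ (ψ.comp (algebraMap (𝓞 K) (𝓞 L))) (ψ α) p := by
    intro ψ p
    rw [aeval_def, hom_eval₂]
  refine Nat.card_congr (Equiv.ofBijective (fun ψ => ⟨ψ.comp (algebraMap (𝓞 K) (𝓞 L)), ⟨ψ α, by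
    rw [← hψ, hroot, map_zero]⟩⟩) ⟨?_, ?_⟩)
  · intro ψ ψ' hh
    obtain ⟨h1, h2⟩ := Sigma.mk.inj hh
    have h3 : ψ α = ψ' α := by
      have key : ∀ (φ φ' : 𝓞 K →+* ZMod ℓ) (hφ : φ = φ') (a : {z : ZMod ℓ // eval₂ φ z h = 0}) (b : {z : ZMod ℓ // eval₂ φ' z h = 0}), a ≍ b → a.1 = b.1 := by
        rintro φ _ rfl a b hab; rw [eq_of_heq hab]
      exact key _ _ h1 _ _ h2
    ext x
    have e1 : (m : ZMod ℓ) * ψ x = m * ψ' x := by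
      have a1 : ψ ((m : 𝓞 L) * x) = m * ψ x := by simp
      have a2 : ψ' ((m : 𝓞 L) * x) = m * ψ' x := by simp
      rw [← a1, ← a2, hP x, hψ, hψ, h1, h3]
    exact mul_left_cancel₀ hmF e1
  · rintro ⟨φ, z, hz⟩
    have W := hwd φ z hz
    let ψ : 𝓞 L →+* ZMod ℓ := 
      { toFun := fun x => (m : ZMod ℓ)⁻¹ * eval₂ φ z (P x)
        map_one' := by
          have := W (P 1) (C (m : 𝓞 K)) (by rw [← hP]; simp)
          rw [this]; simp [hmF]
        map_zero' := by
          have := W (P 0) 0 (by rw [← hP]; simp)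
          rw [this]; simp
        map_mul' := fun x y => by
          have := W (P (x * y) * C (m : 𝓞 K)) (P x * P y) (by rw [map_mul, map_mul, ← hP, ← hP, ← hP]; simp; ring)
          rw [eval₂_mul, eval₂_mul] at this
          simp at this
          field_simp
          linear_combination this
        map_add' := fun x y => by
          have := W (P (x + y)) (P x + P y) (by rw [map_add, ← hP, ← hP, ← hP]; ring)
          rw [this, eval₂_add]; ring }
    have hψ1 : ψ.comp (algebraMap (𝓞 K) (𝓞 L)) = φ := by
      ext a
      have := W (P (algebraMap _ _ a)) (C ((m : 𝓞 K) * a)) (by rw [← hP]; simp)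
      change (m : ZMod ℓ)⁻¹ * eval₂ φ z (P (algebraMap _ _ a)) = φ a
      rw [this]; simp [hmF]
    have hψ2 : ψ α = z := by
      have := W (P α) (C (m : 𝓞 K) * X) (by rw [← hP]; simp)
      change (m : ZMod ℓ)⁻¹ * eval₂ φ z (P α) = z
      rw [this]; simp [hmF]
    refine ⟨ψ, ?_⟩
    have key : ∀ (φ' : 𝓞 K →+* ZMod ℓ) (hφ : φ' = φ) (w : {z : ZMod ℓ // eval₂ φ' z h = 0}), w.1 = z →
        (⟨φ', w⟩ : Σ φ : 𝓞 K →+* ZMod ℓ, {z : ZMod ℓ // eval₂ φ z h = 0}) = ⟨φ, ⟨z, hz⟩⟩ := by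
      rintro _ rfl w hw
      congr 1
      exact Subtype.ext hw
    exact key _ hψ1 _ hψ2

theorem ext_exists {K : Type} [Field K] [NumberField K] (h : (𝓞 K)[X]) (hm : h.Monic)
    (hirr : Irreducible (h.map (algebraMap (𝓞 K) K))) :
    ∃ (L : Type) (_ : Field L) (_ : NumberField L) (ι : 𝓞 K →+* 𝓞 L) (α : 𝓞 L), 
     finrank ℚ L = finrank ℚ K * h.natDegree ∧ eval₂ ι α h = 0 ∧
     ∃ m : ℕ, m ≠ 0 ∧ ∀ ℓ : ℕ, ∀ [Fact ℓ.Prime], ¬ ℓ ∣ m → 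
      Nat.card (𝓞 L →+* ZMod ℓ) = Nat.card (Σ φ : 𝓞 K →+* ZMod ℓ, {z : ZMod ℓ // eval₂ φ z h = 0}) := by
  let g := h.map (algebraMap (𝓞 K) K)
  have hg : g.Monic := hm.map _
  have : Fact (Irreducible g) := ⟨hirr⟩
  let L := AdjoinRoot g
  have : CharZero L := charZero_of_injective_algebraMap (algebraMap K L).injective
  let pb : PowerBasis K L := AdjoinRoot.powerBasis hirr.ne_zero
  have hfinK : Module.Finite K L := pb.finite
  have hst : IsScalarTower ℚ K L := inferInstance
  have hfin : Module.Finite ℚ L := Module.Finite.trans K L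
  have hnf : NumberField L := { to_charZero := inferInstance, to_finiteDimensional := hfin }
  have hroot0 : aeval (pb.gen) h = 0 := by
    have : aeval (AdjoinRoot.root g) g = 0 := by rw [AdjoinRoot.aeval_eq, AdjoinRoot.mk_self]
    rw [← aeval_map_algebraMap K]
    exact this
  have hint : IsIntegral (𝓞 K) pb.gen := ⟨h, hm, hroot0⟩
  have hintZ : IsIntegral ℤ pb.gen := isIntegral_trans (R := ℤ) (A := 𝓞 K) _ hint
  let α : 𝓞 L := ⟨pb.gen, hintZ⟩
  have hmin : minpoly K (α : L) = h.map (algebraMap (𝓞 K) K) := by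
    change minpoly K (AdjoinRoot.root g) = g
    rw [AdjoinRoot.minpoly_root hirr.ne_zero, hg.leadingCoeff]; simp; rfl
  have hroot : aeval α h = 0 := by
    apply RingOfIntegers.coe_injective
    have h3 : ((aeval α h : 𝓞 L) : L) = aeval (algebraMap (𝓞 L) L α) h := (aeval_algebraMap_apply L α _).symm
    refine h3.trans ?_
    rw [map_zero]
    exact hroot0
  refine ⟨L, inferInstance, hnf, algebraMap (𝓞 K) (𝓞 L), α, ?_, hroot, tower_bij α pb rfl h hm hmin⟩
  rw [← Module.finrank_mul_finrank ℚ K L, pb.finrank]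
  congr 1
  change g.natDegree = _
  exact hm.natDegree_map _
end
end

section
open NumberField Filter Topology Module Polynomial

noncomputable section

def bK (K : Type) [Field K] [NumberField K] (ℓ : ℕ) : ℕ := Nat.card (𝓞 K →+* ZMod ℓ)

theorem step_ext {K : Type} [Field K] [NumberField K] (h : (𝓞 K)[X]) (hm : h.Monic)
    (hirr : ∀ w : 𝓞 K, eval w h ≠ 0) (hd2 : 2 ≤ h.natDegree) (hd3 : h.natDegree ≤ 3) :
    ∃ (L : Type) (_ : Field L) (_ : NumberField L) (ι : 𝓞 K →+* 𝓞 L) (α : 𝓞 L),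
     finrank ℚ L = finrank ℚ K * h.natDegree ∧ eval₂ ι α h = 0 ∧
     ∃ m : ℕ, m ≠ 0 ∧ ∀ ℓ : ℕ, ∀ [Fact ℓ.Prime], ¬ ℓ ∣ m → ∀ c : ℕ,
      (∀ φ : 𝓞 K →+* ZMod ℓ, Nat.card {z : ZMod ℓ // eval₂ φ z h = 0} = c) → bK L ℓ = bK K ℓ * c := by
  have hg : (h.map (algebraMap (𝓞 K) K)).Monic := hm.map _
  have hirr' : Irreducible (h.map (algebraMap (𝓞 K) K)) := by
    rw [hg.irreducible_iff_roots_eq_zero_of_degree_le_three (by rwa [hm.natDegree_map]) (by rwa [hm.natDegree_map])]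
    rw [Multiset.eq_zero_iff_forall_notMem]
    intro w hw
    rw [mem_roots hg.ne_zero, IsRoot.def, eval_map] at hw
    have hint : IsIntegral (𝓞 K) w := ⟨h, hm, hw⟩
    have hintZ : IsIntegral ℤ w := isIntegral_trans (R := ℤ) (A := 𝓞 K) _ hint
    apply hirr ⟨w, hintZ⟩
    apply RingOfIntegers.coe_injective
    rw [map_zero, ← hw]
    exact (eval₂_at_apply (algebraMap (𝓞 K) K) (⟨w, hintZ⟩ : 𝓞 K)).symm
  obtain ⟨L, i1, i2, ι, α, h1, h2, m, hm0, h3⟩ := ext_exists h hm hirr'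
  refine ⟨L, i1, i2, ι, α, h1, h2, m, hm0, fun ℓ _ hℓ c hc => ?_⟩
  rw [bK, h3 ℓ hℓ]
  have e : ∀ φ : 𝓞 K →+* ZMod ℓ, Nonempty ({z : ZMod ℓ // eval₂ φ z h = 0} ≃ Fin c) := by
    intro φ
    refine ⟨(Finite.equivFinOfCardEq (hc φ))⟩
  have e2 := (Equiv.sigmaCongrRight (fun φ => (e φ).some)).trans (Equiv.sigmaEquivProd _ _)
  rw [Nat.card_congr e2, Nat.card_prod, Nat.card_fin, bK]

theorem bK_rat (ℓ : ℕ) : bK ℚ ℓ = 1 := by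
  have : (𝓞 ℚ →+* ZMod ℓ) ≃ (ℤ →+* ZMod ℓ) :=
    { toFun := fun f => f.comp (Rat.ringOfIntegersEquiv.symm : ℤ →+* 𝓞 ℚ)
      invFun := fun f => f.comp (Rat.ringOfIntegersEquiv : 𝓞 ℚ →+* ℤ)
      left_inv := fun f => by
        ext x
        change f (Rat.ringOfIntegersEquiv.symm (Rat.ringOfIntegersEquiv x)) = f x
        rw [RingEquiv.symm_apply_apply]
      right_inv := fun f => RingHom.ext_int _ _ }
  have hne : Nonempty (ℤ →+* ZMod ℓ) := ⟨Int.castRingHom _⟩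
  rw [bK, Nat.card_congr this, Nat.card_unique]

theorem sq_card (ℓ : ℕ) [Fact ℓ.Prime] (h2 : ℓ ≠ 2) (t : ℤ) :
    (Nat.card {z : ZMod ℓ // z ^ 2 + (t : ZMod ℓ) = 0} : ℤ) = legendreSym ℓ (-t) + 1 := by
  rw [← legendreSym.card_sqrts ℓ h2 (-t)]
  rw [← Nat.card_eq_card_toFinset]
  congr 1
  apply Nat.card_congr
  apply Equiv.subtypeEquivRight
  intro z
  simp [add_eq_zero_iff_eq_neg]

theorem quad_ext {K : Type} [Field K] [NumberField K] (t : ℤ) (hirr : ∀ w : 𝓞 K, w ^ 2 + (t : 𝓞 K) ≠ 0) :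
    ∃ (L : Type) (_ : Field L) (_ : NumberField L), finrank ℚ L = finrank ℚ K * 2 ∧ 
     ∃ m : ℕ, m ≠ 0 ∧ ∀ ℓ : ℕ, ∀ [Fact ℓ.Prime], ¬ ℓ ∣ m → 
     (bK L ℓ : ℤ) = bK K ℓ * (legendreSym ℓ (-t) + 1) := by
  obtain ⟨L, i1, i2, ι, α, h1, h2, m, hm0, h3⟩ := step_ext (X ^ 2 + C (t : 𝓞 K)) (by monicity!) 
    (by intro w; simpa using hirr w) (by rw [natDegree_X_pow_add_C]) (by rw [natDegree_X_pow_add_C]; norm_num)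
  rw [natDegree_X_pow_add_C] at h1
  refine ⟨L, i1, i2, h1, m * 2, by positivity, fun ℓ hF hℓ => ?_⟩
  rw [h3 ℓ (fun h => hℓ (h.mul_right _)) (Nat.card {z : ZMod ℓ // z ^ 2 + (t : ZMod ℓ) = 0})]
  · push_cast
    rw [sq_card]
    rintro rfl
    exact hℓ (by simp)
  · intro φ
    simp_rw [eval₂_add, eval₂_pow, eval₂_X, eval₂_C, map_intCast]

theorem exE (N : ℕ) (hN : 0 < N) : ∃ (E : Type) (_ : Field E) (_ : NumberField E) (m n : ℕ),
    m ≠ 0 ∧ n ≠ 0 ∧ n ≤ 4 ∧ ¬ 3 ∣ n ∧ finrank ℚ E = n ∧ ∀ ℓ : ℕ, ∀ [Fact ℓ.Prime], ¬ ℓ ∣ m → 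
      ((ℓ % 4 = 1 ∧ legendreSym ℓ (-(N : ℤ)) = 1) → bK E ℓ = n) ∧ 
      (¬ (ℓ % 4 = 1 ∧ legendreSym ℓ (-(N : ℤ)) = 1) → bK E ℓ = 0) := by
  obtain ⟨K, i1, i2, hd, m, hm0, hb⟩ := quad_ext (K := ℚ) 1 (by
    intro w hw
    have : (w : ℚ) ^ 2 + 1 = 0 := by
      have := congrArg (algebraMap (𝓞 ℚ) ℚ) hw
      simpa using this
    nlinarith [sq_nonneg (w : ℚ)])
  rw [finrank_self] at hd
  have hK : ∀ ℓ : ℕ, ∀ [Fact ℓ.Prime], ¬ ℓ ∣ m * 2 → (ℓ % 4 = 1 → bK K ℓ = 2) ∧ (ℓ % 4 ≠ 1 → bK K ℓ = 0) := by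
    intro ℓ hF hℓ
    have h1 := hb ℓ (fun h => hℓ (h.mul_right _))
    have h2 : ℓ ≠ 2 := by rintro rfl; exact hℓ (by simp)
    rw [bK_rat, legendreSym.at_neg_one h2] at h1
    have hodd : ℓ % 2 = 1 := hF.out.eq_two_or_odd.resolve_left h2
    constructor
    · intro h4
      rw [ZMod.χ₄_nat_one_mod_four h4] at h1
      norm_num at h1
      exact_mod_cast h1
    · intro h4
      rw [ZMod.χ₄_nat_three_mod_four (by omega)] at h1
      norm_num at h1
      exact_mod_cast h1
  have hNl : ∀ ℓ : ℕ, ∀ [Fact ℓ.Prime], ¬ ℓ ∣ N → ((-(N : ℤ) : ℤ) : ZMod ℓ) ≠ 0 := by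
    intro ℓ hF hℓ
    simpa [ZMod.natCast_eq_zero_iff] using hℓ
  by_cases hw : ∃ w : 𝓞 K, w ^ 2 + ((N : ℤ) : 𝓞 K) = 0
  · obtain ⟨w, hw⟩ := hw
    refine ⟨K, i1, i2, m * 2 * N, 2, by positivity, by norm_num, by norm_num, by norm_num, by omega, fun ℓ hF hℓ => ?_⟩
    have h1 := hK ℓ (fun h => hℓ (h.mul_right _))
    refine ⟨fun h => h1.1 h.1, fun h => ?_⟩
    by_contra hne
    have h4 : ℓ % 4 = 1 := by
      by_contra h4
      exact hne (h1.2 h4)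
    refine h ⟨h4, ?_⟩
    rw [legendreSym.eq_one_iff ℓ (hNl ℓ (fun h => hℓ (h.mul_left _)))]
    obtain ⟨⟨φ⟩, _⟩ := Nat.card_ne_zero.1 hne
    refine ⟨φ w, ?_⟩
    have := congrArg φ hw
    simp at this
    push_cast
    linear_combination -this
  · push Not at hw
    obtain ⟨E, j1, j2, hd', m', hm0', hb'⟩ := quad_ext (K := K) N hw
    refine ⟨E, j1, j2, m * 2 * N * m', 4, by positivity, by norm_num, by norm_num, by norm_num, by omega, fun ℓ hF hℓ => ?_⟩
    have h1 := hK ℓ (fun h => hℓ ((h.mul_right _).mul_right _))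
    have h2 := hb' ℓ (fun h => hℓ (h.mul_left _))
    constructor
    · rintro ⟨h4, h5⟩
      rw [h1.1 h4, h5] at h2
      norm_num at h2
      exact_mod_cast h2
    · intro h
      by_cases h4 : ℓ % 4 = 1
      · have h5 := (legendreSym.eq_one_or_neg_one ℓ (hNl ℓ (fun h => hℓ ((h.mul_left _).mul_right _)))).resolve_left (fun h5 => h ⟨h4, h5⟩)
        rw [h5] at h2
        simpa using h2
      · rw [h1.2 h4] at h2
        simpa using h2
end
end

section
open NumberField Filter Topology Module Polynomial

noncomputable section

def rC (A B : ℤ) (ℓ : ℕ) : ℕ := Nat.card {z : ZMod ℓ // z ^ 3 + (A : ZMod ℓ) * z + (B : ZMod ℓ) = 0}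

theorem quad_of_root {F : Type*} [Field F] [Fintype F] (a b z : F) (hD : 4 * a ^ 3 + 27 * b ^ 2 ≠ 0)
    (hz : z ^ 3 + a * z + b = 0) :
    Nat.card {x : F // x ^ 3 + a * x + b = 0} = Nat.card {x : F // x ^ 2 + z * x + (z ^ 2 + a) = 0} + 1 ∧
    ((∃ x : F, x ^ 2 + z * x + (z ^ 2 + a) = 0) → Nat.card {x : F // x ^ 2 + z * x + (z ^ 2 + a) = 0} = 2) := by
  classical
  have hsimple : ∀ x : F, x ^ 3 + a * x + b = 0 → 3 * x ^ 2 + a ≠ 0 := by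
    intro x hx h
    apply hD
    have ha : a = -3 * x ^ 2 := by linear_combination h
    have hb : b = 2 * x ^ 3 := by rw [ha] at hx; linear_combination hx
    rw [ha, hb]; ring
  constructor
  · have e : {x : F | x ^ 3 + a * x + b = 0} = insert z {x : F | x ^ 2 + z * x + (z ^ 2 + a) = 0} := by
      ext x
      simp only [Set.mem_ofPred_eq, Set.mem_insert_iff]
      constructor
      · intro hx
        have : (x - z) * (x ^ 2 + z * x + (z ^ 2 + a)) = 0 := by linear_combination hx - hz
        rcases mul_eq_zero.1 this with h | h
        · left; linear_combination h
        · right; exact h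
      · rintro (rfl | h)
        · exact hz
        · linear_combination (x - z) * h + hz
    have hn : z ∉ {x : F | x ^ 2 + z * x + (z ^ 2 + a) = 0} := by
      intro h
      apply hsimple z hz
      have h' : z ^ 2 + z * z + (z ^ 2 + a) = 0 := h
      linear_combination h'
    have := Set.ncard_insert_of_notMem hn (Set.toFinite _)
    rw [← e] at this
    exact this
  · rintro ⟨x, hx⟩
    have e : {x : F | x ^ 2 + z * x + (z ^ 2 + a) = 0} = {x, -z - x} := by
      ext y
      simp only [Set.mem_ofPred_eq, Set.mem_insert_iff, Set.mem_singleton_iff]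
      constructor
      · intro hy
        have : (y - x) * (y + x + z) = 0 := by linear_combination hy - hx
        rcases mul_eq_zero.1 this with h | h
        · left; linear_combination h
        · right; linear_combination h
      · rintro (rfl | rfl)
        · exact hx
        · linear_combination hx
    have hne : x ≠ -z - x := by
      intro h
      have hzz : z = -2 * x := by linear_combination h
      apply hsimple x
      · linear_combination (x - z) * hx + hz
      · rw [hzz] at hx; linear_combination hx
    have := Set.ncard_pair hne
    rw [← e] at this
    exact this

theorem rC_cases (A B : ℤ) (ℓ : ℕ) [Fact ℓ.Prime] (hD : ¬ (ℓ : ℤ) ∣ 4 * A ^ 3 + 27 * B ^ 2) :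
    (rC A B ℓ = 0 ∨ rC A B ℓ = 1 ∨ rC A B ℓ = 3) ∧ ∀ z : ZMod ℓ, z ^ 3 + (A : ZMod ℓ) * z + (B : ZMod ℓ) = 0 →
      rC A B ℓ = Nat.card {x : ZMod ℓ // x ^ 2 + z * x + (z ^ 2 + (A : ZMod ℓ)) = 0} + 1 ∧ 
      ((∃ x : ZMod ℓ, x ^ 2 + z * x + (z ^ 2 + (A : ZMod ℓ)) = 0) → rC A B ℓ = 3) := by
  have hD' : 4 * (A : ZMod ℓ) ^ 3 + 27 * (B : ZMod ℓ) ^ 2 ≠ 0 := by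
    intro h
    apply hD
    rw [← ZMod.intCast_zmod_eq_zero_iff_dvd]
    exact_mod_cast h
  constructor
  · by_cases h : ∃ z : ZMod ℓ, z ^ 3 + (A : ZMod ℓ) * z + (B : ZMod ℓ) = 0
    · obtain ⟨z, hz⟩ := h
      obtain ⟨h1, h2⟩ := quad_of_root _ _ z hD' hz
      right
      by_cases h3 : ∃ x : ZMod ℓ, x ^ 2 + z * x + (z ^ 2 + (A : ZMod ℓ)) = 0
      · right; rw [rC, h1, h2 h3]
      · left
        push Not at h3
        rw [rC, h1]
        have : IsEmpty {x : ZMod ℓ // x ^ 2 + z * x + (z ^ 2 + (A : ZMod ℓ)) = 0} := ⟨fun x => h3 x.1 x.2⟩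
        rw [Nat.card_of_isEmpty]
    · left
      push Not at h
      have : IsEmpty {z : ZMod ℓ // z ^ 3 + (A : ZMod ℓ) * z + (B : ZMod ℓ) = 0} := ⟨fun x => h x.1 x.2⟩
      rw [rC, Nat.card_of_isEmpty]
  · intro z hz
    obtain ⟨h1, h2⟩ := quad_of_root _ _ z hD' hz
    exact ⟨h1, fun h3 => by rw [rC, h1, h2 h3]⟩

theorem disc_ne (A B : ℤ) (hirr : Irreducible (X ^ 3 + C (A : ℚ) * X + C (B : ℚ))) : 4 * A ^ 3 + 27 * B ^ 2 ≠ 0 := by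
  intro h
  have hq : 4 * (A : ℚ) ^ 3 + 27 * (B : ℚ) ^ 2 = 0 := by exact_mod_cast h
  have hdeg : (X ^ 3 + C (A : ℚ) * X + C (B : ℚ)).natDegree = 3 := by compute_degree!
  have hroot : ∃ x : ℚ, IsRoot (X ^ 3 + C (A : ℚ) * X + C (B : ℚ)) x := by
    by_cases hA : (A : ℚ) = 0
    · have hB : (B : ℚ) = 0 := by rw [hA] at hq; simpa using hq
      exact ⟨0, by simp [hA, hB]⟩
    · refine ⟨-3 * B / (2 * A), ?_⟩
      simp only [IsRoot.def, eval_add, eval_mul, eval_pow, eval_X, eval_C]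
      field_simp
      linear_combination (-B : ℚ) * hq
  obtain ⟨x, hx⟩ := hroot
  have := degree_eq_one_of_irreducible_of_root hirr hx
  rw [degree_eq_natDegree hirr.ne_zero, hdeg] at this
  norm_num at this

theorem no_root {E : Type} [Field E] [NumberField E] (A B : ℤ) (hirr : Irreducible (X ^ 3 + C (A : ℚ) * X + C (B : ℚ)))
    (h3 : ¬ 3 ∣ finrank ℚ E) (w : 𝓞 E) : w ^ 3 + A * w + B ≠ 0 := by
  intro h
  have hw : (w : E) ^ 3 + A * w + B = 0 := by
    have := congrArg (algebraMap (𝓞 E) E) h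
    simpa using this
  have hm : (X ^ 3 + C (A : ℚ) * X + C (B : ℚ)).Monic := by monicity!
  have hdeg : (X ^ 3 + C (A : ℚ) * X + C (B : ℚ)).natDegree = 3 := by compute_degree!
  have := minpoly.eq_of_irreducible_of_monic hirr (x := (w : E)) (by simpa using hw) hm
  apply h3
  have hdvd := minpoly.degree_dvd (K := ℚ) (x := (w : E)) (RingOfIntegers.isIntegral_coe w).tower_top
  rwa [← this, hdeg] at hdvd
end
end

section
open NumberField Filter Topology Module Polynomial

noncomputable section

def HasT (c : ℕ → ℝ) (δ : ℝ) : Prop :=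
  Tendsto (fun x : ℝ => (∑ p ∈ Finset.Icc 1 ⌊x⌋₊ with p.Prime, c p * Real.log p) / x) atTop (𝓝 δ)

theorem HasT.congr' {c d : ℕ → ℝ} {δ : ℝ} (h : HasT c δ) (m : ℕ) (hm : m ≠ 0)
    (hcd : ∀ p : ℕ, p.Prime → ¬ p ∣ m → d p = c p) : HasT d δ := by
  let g : ℕ → ℝ := fun p => (d p - c p) * Real.log p
  have hg : ∀ x : ℝ, m ≤ x → ∑ p ∈ Finset.Icc 1 ⌊x⌋₊ with p.Prime, g p = ∑ p ∈ Finset.Icc 1 m with p.Prime, g p := by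
    intro x hx
    symm
    apply Finset.sum_subset
    · intro p hp
      simp only [Finset.mem_filter, Finset.mem_Icc] at hp ⊢
      exact ⟨⟨hp.1.1, hp.1.2.trans (Nat.le_floor hx)⟩, hp.2⟩
    · intro p hp hp'
      simp only [Finset.mem_filter, Finset.mem_Icc] at hp hp'
      have : ¬ p ∣ m := fun hd => hp' ⟨⟨hp.1.1, Nat.le_of_dvd (Nat.pos_of_ne_zero hm) hd⟩, hp.2⟩
      simp [g, hcd p hp.2 this]
  have hlim : Tendsto (fun x : ℝ => (∑ p ∈ Finset.Icc 1 ⌊x⌋₊ with p.Prime, g p) / x) atTop (𝓝 0) := by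
    refine Tendsto.congr' ?_ ((tendsto_const_nhds (x := ∑ p ∈ Finset.Icc 1 m with p.Prime, g p)).div_atTop tendsto_id)
    filter_upwards [eventually_ge_atTop (m : ℝ)] with x hx
    rw [hg x hx]; rfl
  have := Tendsto.add h hlim
  rw [add_zero] at this
  refine this.congr fun x => ?_
  rw [← add_div, ← Finset.sum_add_distrib]
  congr 1
  apply Finset.sum_congr rfl
  intro p _
  simp only [g]; ring

theorem HasT.lin {c d : ℕ → ℝ} {δ ε : ℝ} (h : HasT c δ) (h' : HasT d ε) (s t : ℝ) :
    HasT (fun p => s * c p + t * d p) (s * δ + t * ε) := by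
  have := (Tendsto.const_mul s h).add (Tendsto.const_mul t h')
  refine this.congr fun x => ?_
  rw [mul_div_assoc', mul_div_assoc', ← add_div, Finset.mul_sum, Finset.mul_sum, ← Finset.sum_add_distrib]
  congr 1
  apply Finset.sum_congr rfl
  intro p _
  ring

theorem hasT_bK (K : Type) [Field K] [NumberField K] : HasT (fun p => (bK K p : ℝ)) 1 := by
  refine (theta_K K).congr fun x => ?_
  congr 1
  apply Finset.sum_congr rfl
  intro p hp
  have : Fact p.Prime := ⟨(Finset.mem_filter.1 hp).2⟩
  have e : bK K p = aK K p := hom_card p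
  simp only [e]

theorem hasT_one : HasT (fun _ => 1) 1 := by
  refine (hasT_bK ℚ).congr' 1 one_ne_zero fun p _ _ => ?_
  rw [bK_rat]; simp

theorem hasT_M (A B : ℤ) (hirr : Irreducible (X ^ 3 + C (A : ℚ) * X + C (B : ℚ))) (N : ℕ) (hN : 0 < N)
    (c : ℕ → ℝ) (hc1 : ∀ ℓ : ℕ, ∀ [Fact ℓ.Prime], ¬ (ℓ : ℤ) ∣ 2 * (N : ℤ) * (4 * A ^ 3 + 27 * B ^ 2) →
      ℓ % 4 = 1 ∧ legendreSym ℓ (-(N : ℤ)) = 1 → rC A B ℓ = 0 → c ℓ = 1) 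
    (hc0 : ∀ ℓ : ℕ, ∀ [Fact ℓ.Prime], ¬ (ℓ % 4 = 1 ∧ legendreSym ℓ (-(N : ℤ)) = 1 ∧ rC A B ℓ = 0) → c ℓ = 0) : 
    ∃ δ : ℝ, HasT c δ ∧ 1 / 12 ≤ δ := by
  obtain ⟨E, i1, i2, m₁, n, hm₁, hn0, hn4, hn3, hfin, hE⟩ := exE N hN
  have hdisc := disc_ne A B hirr
  have hmf : (X ^ 3 + C (A : 𝓞 E) * X + C (B : 𝓞 E)).Monic := by monicity!
  have hdf : (X ^ 3 + C (A : 𝓞 E) * X + C (B : 𝓞 E)).natDegree = 3 := by compute_degree!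
  obtain ⟨E3, j1, j2, ι, θ, hfin3, hθ, m₂, hm₂, hE3⟩ := step_ext (X ^ 3 + C (A : 𝓞 E) * X + C (B : 𝓞 E)) hmf
    (fun w hw => no_root A B hirr (by rwa [hfin]) w (by simpa using hw)) (by omega) (by omega)
  simp only [eval₂_add, eval₂_mul, eval₂_pow, eval₂_X] at hθ
  rw [eval₂_C, eval₂_C, map_intCast, map_intCast] at hθ
  have hE3' : ∀ ℓ : ℕ, ∀ [Fact ℓ.Prime], ¬ ℓ ∣ m₂ → bK E3 ℓ = bK E ℓ * rC A B ℓ := by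
    intro ℓ hF hℓ
    apply hE3 ℓ hℓ
    intro φ
    simp_rw [eval₂_add, eval₂_mul, eval₂_pow, eval₂_X, eval₂_C, map_intCast]
    rfl
  have hφθ : ∀ ℓ : ℕ, ∀ φ : 𝓞 E3 →+* ZMod ℓ, (φ θ) ^ 3 + (A : ZMod ℓ) * φ θ + (B : ZMod ℓ) = 0 := by
    intro ℓ φ
    have := congrArg φ hθ
    simpa using this
  let D : ℕ := 2 * N * (4 * A ^ 3 + 27 * B ^ 2).natAbs
  have hD0 : D ≠ 0 := by
    have : (4 * A ^ 3 + 27 * B ^ 2).natAbs ≠ 0 := Int.natAbs_ne_zero.2 hdisc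
    positivity
  have hDd : ∀ ℓ : ℕ, ¬ ℓ ∣ D → ¬ (ℓ : ℤ) ∣ 2 * (N : ℤ) * (4 * A ^ 3 + 27 * B ^ 2) := by
    intro ℓ h h'
    apply h
    have := Int.natAbs_dvd_natAbs.2 h'
    simpa [Int.natAbs_mul, D] using this
  have hDd' : ∀ ℓ : ℕ, ¬ ℓ ∣ D → ¬ (ℓ : ℤ) ∣ (4 * A ^ 3 + 27 * B ^ 2) := fun ℓ h h' => hDd ℓ h (h'.mul_left _)
  have hnR : (0 : ℝ) < n := by positivity
  have hnR4 : (n : ℝ) ≤ 4 := by exact_mod_cast hn4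
  have hmq : (X ^ 2 + C θ * X + C (θ ^ 2 + (A : 𝓞 E3))).Monic := by monicity!
  have hdq : (X ^ 2 + C θ * X + C (θ ^ 2 + (A : 𝓞 E3))).natDegree = 2 := by compute_degree!
  by_cases hw : ∃ w : 𝓞 E3, w ^ 2 + θ * w + (θ ^ 2 + (A : 𝓞 E3)) = 0
  · obtain ⟨w, hw⟩ := hw
    have H := (hasT_bK E).lin (hasT_bK E3) (1 / n) (-1 / (3 * n))
    refine ⟨_, H.congr' (m₁ * m₂ * D) (by positivity) fun ℓ hℓ hd => ?_, ?_⟩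
    · have hF : Fact ℓ.Prime := ⟨hℓ⟩
      have d1 : ¬ ℓ ∣ m₁ := fun h => hd ((h.mul_right _).mul_right _)
      have d2 : ¬ ℓ ∣ m₂ := fun h => hd ((h.mul_left _).mul_right _)
      have d3 : ¬ ℓ ∣ D := fun h => hd (h.mul_left _)
      rw [hE3' ℓ d2]
      by_cases hP : ℓ % 4 = 1 ∧ legendreSym ℓ (-(N : ℤ)) = 1
      · have hb := (hE ℓ d1).1 hP
        by_cases hr : rC A B ℓ = 0
        · rw [hc1 ℓ (hDd ℓ d3) hP hr, hb, hr]
          field_simp; simp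
        · have hne : bK E3 ℓ ≠ 0 := by
            rw [hE3' ℓ d2, hb]; positivity
          obtain ⟨⟨φ⟩, _⟩ := Nat.card_ne_zero.1 hne
          have h3 : rC A B ℓ = 3 := ((rC_cases A B ℓ (hDd' ℓ d3)).2 _ (hφθ ℓ φ)).2 ⟨φ w, by
            have := congrArg φ hw
            simpa using this⟩
          rw [hc0 ℓ (fun h => hr h.2.2), hb, h3]
          push_cast; field_simp; simp
      · have hb := (hE ℓ d1).2 hP
        rw [hc0 ℓ (fun h => hP ⟨h.1, h.2.1⟩), hb]; simp
    · have : (1 / n * 1 + -1 / (3 * n) * 1 : ℝ) = 2 / (3 * n) := by field_simp; ring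
      rw [this, div_le_div_iff₀ (by norm_num) (by positivity)]
      linarith
  · push Not at hw
    obtain ⟨L, k1, k2, -, -, -, -, m₃, hm₃, hL⟩ := step_ext _ hmq
      (fun w hw' => hw w (by simpa using hw')) (by omega) (by omega)
    have H := ((hasT_bK E).lin (hasT_bK E3) (1 / n) (-1 / n)).lin (hasT_bK L) 1 (1 / (3 * n))
    refine ⟨_, H.congr' (m₁ * m₂ * D * m₃) (by positivity) fun ℓ hℓ hd => ?_, ?_⟩
    · have hF : Fact ℓ.Prime := ⟨hℓ⟩
      have d1 : ¬ ℓ ∣ m₁ := fun h => hd (((h.mul_right _).mul_right _).mul_right _)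
      have d2 : ¬ ℓ ∣ m₂ := fun h => hd (((h.mul_left _).mul_right _).mul_right _)
      have d3 : ¬ ℓ ∣ D := fun h => hd ((h.mul_left _).mul_right _)
      have d4 : ¬ ℓ ∣ m₃ := fun h => hd (h.mul_left _)
      have hL' : bK L ℓ = bK E3 ℓ * (rC A B ℓ - 1) := by
        apply hL ℓ d4
        intro φ
        have := ((rC_cases A B ℓ (hDd' ℓ d3)).2 _ (hφθ ℓ φ)).1
        rw [this, Nat.add_sub_cancel]
        simp_rw [eval₂_add, eval₂_mul, eval₂_pow, eval₂_X, eval₂_C, map_add, map_pow, map_intCast]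
      rw [hL', hE3' ℓ d2]
      by_cases hP : ℓ % 4 = 1 ∧ legendreSym ℓ (-(N : ℤ)) = 1
      · have hb := (hE ℓ d1).1 hP
        rcases (rC_cases A B ℓ (hDd' ℓ d3)).1 with hr | hr | hr
        · rw [hc1 ℓ (hDd ℓ d3) hP hr, hb, hr]
          field_simp; simp
        · rw [hc0 ℓ (fun h => by omega), hb, hr]
          push_cast; field_simp; simp
        · rw [hc0 ℓ (fun h => by omega), hb, hr]
          push_cast; field_simp; norm_num
      · have hb := (hE ℓ d1).2 hP
        rw [hc0 ℓ (fun h => hP ⟨h.1, h.2.1⟩), hb]; simp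
    · have : (1 * (1 / n * 1 + -1 / n * 1) + 1 / (3 * n) * 1 : ℝ) = 1 / (3 * n) := by field_simp; ring
      rw [this, div_le_div_iff₀ (by norm_num) (by positivity)]
      linarith
end
end

section
open NumberField Filter Topology Module Polynomial
noncomputable section

theorem count_asymp (s : ℕ → ℝ) (hs : ∀ p, s p = 0 ∨ s p = 1) (δ : ℝ) (h : HasT s δ) :
    Tendsto (fun x : ℝ => (∑ p ∈ Finset.Icc 1 ⌊x⌋₊ with p.Prime, s p) * (Real.log x / x)) atTop (𝓝 δ) := by
  have hlog := Real.tendsto_log_atTop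
  have hll : Tendsto (fun x : ℝ => Real.log (Real.log x) / Real.log x) atTop (𝓝 0) := 
    (Real.isLittleO_log_id_atTop.tendsto_div_nhds_zero).comp hlog
  have hup : Tendsto (fun x : ℝ => 1 / Real.log x + (∑ p ∈ Finset.Icc 1 ⌊x⌋₊ with p.Prime, s p * Real.log p) / x * (1 - 2 * (Real.log (Real.log x) / Real.log x))⁻¹) atTop (𝓝 δ) := by
    have h1 : Tendsto (fun x : ℝ => 1 / Real.log x) atTop (𝓝 0) := tendsto_const_nhds.div_atTop hlog
    have h2 : Tendsto (fun x : ℝ => (1 - 2 * (Real.log (Real.log x) / Real.log x))⁻¹) atTop (𝓝 1) := by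
      have := ((hll.const_mul 2).const_sub 1).inv₀ (by norm_num)
      simpa using this
    have := h1.add (Tendsto.mul h h2)
    simpa using this
  have hs0 : ∀ p, 0 ≤ s p := fun p => by rcases hs p with h | h <;> rw [h]; norm_num
  have hs1 : ∀ p, s p ≤ 1 := fun p => by rcases hs p with h | h <;> rw [h]; norm_num
  refine tendsto_of_tendsto_of_tendsto_of_le_of_le' h hup ?_ ?_
  · filter_upwards [eventually_gt_atTop 1] with x hx
    rw [mul_div_assoc', Finset.sum_mul]
    gcongr with p hp
    · exact hs0 p
    · have := (Finset.mem_Icc.1 (Finset.mem_filter.1 hp).1)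
      exact_mod_cast this.1
    · have := (Finset.mem_Icc.1 (Finset.mem_filter.1 hp).1).2
      exact (Nat.le_floor_iff (by linarith)).1 this
  · filter_upwards [eventually_gt_atTop 1, hlog.eventually_gt_atTop 1, hll.eventually_lt_const (show (0:ℝ) < 1 / 4 by norm_num)] with x hx hlx hllx
    set l := Real.log x with hl
    set y := x / l ^ 2 with hy
    have hl0 : 0 < l := by linarith
    have hx0 : 0 < x := by linarith
    have hy0 : 0 < y := by positivity
    have hly : Real.log y = l * (1 - 2 * (Real.log l / l)) := by
      rw [hy, Real.log_div hx0.ne' (by positivity), Real.log_pow]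
      push_cast
      field_simp
      rw [← hl]
    have hlypos : 0 < Real.log y := by
      rw [hly]; apply mul_pos hl0; linarith
    have key : ∑ p ∈ Finset.Icc 1 ⌊x⌋₊ with p.Prime, s p ≤ y + (∑ p ∈ Finset.Icc 1 ⌊x⌋₊ with p.Prime, s p * Real.log p) / Real.log y := by
      have hle : ∀ p ∈ (Finset.Icc 1 ⌊x⌋₊).filter Nat.Prime, s p ≤ (if (p : ℝ) ≤ y then 1 else 0) + s p * Real.log p / Real.log y := by
        intro p hp
        have hp1 : (1 : ℝ) ≤ p := by exact_mod_cast (Finset.mem_Icc.1 (Finset.mem_filter.1 hp).1).1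
        have hlp : 0 ≤ Real.log p := Real.log_nonneg hp1
        split_ifs with hpy
        · have : 0 ≤ s p * Real.log p / Real.log y := div_nonneg (mul_nonneg (hs0 p) hlp) hlypos.le
          linarith [hs1 p]
        · rw [zero_add, le_div_iff₀ hlypos]
          apply mul_le_mul_of_nonneg_left _ (hs0 p)
          exact Real.log_le_log hy0 (not_le.1 hpy).le
      refine (Finset.sum_le_sum hle).trans ?_
      rw [Finset.sum_add_distrib, Finset.sum_div]
      gcongr
      rw [← Finset.sum_filter, Finset.sum_const, nsmul_eq_mul, mul_one]
      calc (_ : ℝ) ≤ ((Finset.Icc 1 ⌊y⌋₊).card : ℝ) := by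
            norm_cast
            apply Finset.card_le_card
            intro p hp
            simp only [Finset.mem_filter, Finset.mem_Icc] at hp ⊢
            exact ⟨hp.1.1.1, Nat.le_floor hp.2⟩
        _ = (⌊y⌋₊ : ℝ) := by simp
        _ ≤ y := Nat.floor_le hy0.le
    refine (mul_le_mul_of_nonneg_right key (by positivity)).trans (le_of_eq ?_)
    rw [add_mul, hly]
    have : (1 - 2 * (Real.log l / l)) ≠ 0 := by linarith
    congr 1
    · rw [hy]; field_simp
    · field_simp

theorem primeCount_eq (S : Set ℕ) [DecidablePred (· ∈ S)] (x : ℝ) (hx : 0 ≤ x) : 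
    (primeCount S x : ℝ) = ∑ p ∈ Finset.Icc 1 ⌊x⌋₊ with p.Prime, (if p ∈ S then (1 : ℝ) else 0) := by
  rw [← Finset.sum_filter, Finset.sum_const, nsmul_eq_mul, mul_one, primeCount]
  congr 1
  rw [← Nat.card_eq_finsetCard]
  apply Nat.card_congr
  apply Equiv.subtypeEquivRight
  intro p
  simp only [Finset.mem_filter, Finset.mem_Icc, Nat.le_floor_iff hx, Set.mem_ofPred_eq]
  constructor
  · rintro ⟨h1, h2, h3⟩
    exact ⟨⟨⟨h1.one_le, h3⟩, h1⟩, h2⟩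
  · rintro ⟨⟨⟨h1, h3⟩, h4⟩, h2⟩
    exact ⟨h4, h2, h3⟩

theorem density_of_hasT (S : Set ℕ) [DecidablePred (· ∈ S)] (δ : ℝ) (h : HasT (fun p => if p ∈ S then (1 : ℝ) else 0) δ) :
    HasPrimeDensity S δ := by
  have h1 := count_asymp _ (fun p => by by_cases hp : p ∈ S <;> simp [hp]) δ h
  have h2 := count_asymp _ (fun p => Or.inr rfl) 1 hasT_one
  have h3 := h1.div h2 one_ne_zero
  rw [div_one] at h3
  refine h3.congr' ?_
  filter_upwards [eventually_gt_atTop 1] with x hx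
  have e1 := primeCount_eq S x (by linarith)
  have e2 := primeCount_eq Set.univ x (by linarith)
  have e3 : primePi x = primeCount Set.univ x := by simp [primePi, primeCount]
  rw [e3, e1, e2]
  have hne : Real.log x / x ≠ 0 := (div_pos (Real.log_pos hx) (by linarith)).ne'
  simp only [Pi.div_apply, Set.mem_univ, if_true]
  rw [mul_div_mul_right _ _ hne]

end
end

/-- Suppose `x³ + Ax + B` is irreducible over `ℚ` and `N` is a positive squarefree integer.
The set of primes `ℓ ∤ 2N(4A³ + 27B²)` with `ℓ ≡ 1 (mod 4)`, Legendre symbol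
`(-N | ℓ) = 1`, and such that `x³ + Ax + B` has no root mod `ℓ`, has a natural density
`δ ≥ 1/12`. -/
theorem density_of_admissible_primes (A B : ℤ)
    (hirr : Irreducible (Polynomial.X ^ 3 + Polynomial.C (A : ℚ) * Polynomial.X +
      Polynomial.C (B : ℚ)))
    (N : ℕ) (hNpos : 0 < N) (hNsf : Squarefree N) :
    ∃ δ : ℝ, HasPrimeDensity
      {ℓ : ℕ | ∃ hℓ : Fact ℓ.Prime,
        ¬((ℓ : ℤ) ∣ 2 * (N : ℤ) * (4 * A ^ 3 + 27 * B ^ 2)) ∧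
        ℓ % 4 = 1 ∧
        legendreSym ℓ (-(N : ℤ)) = 1 ∧
        ¬∃ x : ZMod ℓ, x ^ 3 + (A : ZMod ℓ) * x + (B : ZMod ℓ) = 0} δ ∧
      (1 : ℝ) / 12 ≤ δ := by
  classical
  set M := {ℓ : ℕ | ∃ hℓ : Fact ℓ.Prime,
        ¬((ℓ : ℤ) ∣ 2 * (N : ℤ) * (4 * A ^ 3 + 27 * B ^ 2)) ∧
        ℓ % 4 = 1 ∧
        legendreSym ℓ (-(N : ℤ)) = 1 ∧
        ¬∃ x : ZMod ℓ, x ^ 3 + (A : ZMod ℓ) * x + (B : ZMod ℓ) = 0} with hM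
  obtain ⟨δ, hδ, h12⟩ := hasT_M A B hirr N hNpos (fun p => if p ∈ M then (1 : ℝ) else 0)
    (by
      intro ℓ hF h1 h2 h3
      have : ℓ ∈ M := by
        refine ⟨hF, h1, h2.1, h2.2, ?_⟩
        rintro ⟨x, hx⟩
        rcases Nat.card_eq_zero.1 h3 with h | h
        · exact h.elim ⟨x, hx⟩
        · exact not_finite {z : ZMod ℓ // z ^ 3 + (A : ZMod ℓ) * z + (B : ZMod ℓ) = 0}
      simp [this])
    (by
      intro ℓ hF h1
      have : ℓ ∉ M := by
        rintro ⟨hF', h2, h3, h4, h5⟩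
        apply h1
        refine ⟨h3, h4, ?_⟩
        have : IsEmpty {z : ZMod ℓ // z ^ 3 + (A : ZMod ℓ) * z + (B : ZMod ℓ) = 0} := ⟨fun x => h5 ⟨x.1, x.2⟩⟩
        exact Nat.card_of_isEmpty
      simp [this])
  exact ⟨δ, density_of_hasT M δ hδ, h12⟩
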